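/- arXiv:2012.11276 — 3 statements merged into one kernel-verified Lean document; each statement's English description precedes it below -/
import Mathlib

section
/- Let 0 < r ≤ s < 1 with r ≠ 1/2 and s ≠ 1/2. There exists a constant C = C(r,s) > 0, independent of k, such that for every integer k ≥ 1, every real polynomial p of degree at most k, and every N ≥ 0 the following holds: if ∫₀¹ p ψ ≤ N ‖ψ‖_{H^s_0(I)} for every measurable ψ : (0,1) → ℝ with finite ‖ψ‖_{H^s_0(I)}, then for every measurable φ : (0,1) → ℝ with finite ‖φ‖_{H^r_0(I)} one has ∫₀¹ p φ ≤ C k^{2(s−r)} N ‖φ‖_{H^r_0(I)}. (Inverse inequality in negative Sobolev norms: ‖p‖_{(H^r_0(I))'} ≲ k^{2(s−r)} ‖p‖_{(H^s_0(I))'}.) -/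
open MeasureTheory

/-- Squared Gagliardo seminorm `|φ|_{t,(0,1)}²` on the unit interval. -/
noncomputable def gagliardoSq (t : ℝ) (φ : ℝ → ℝ) : ℝ :=
  ∫ x in Set.Ioo (0:ℝ) 1, ∫ y in Set.Ioo (0:ℝ) 1, (φ x - φ y) ^ 2 / |x - y| ^ (2 * t + 1)

/-- Finiteness of the Gagliardo double integral. -/
def gagliardoFinite (t : ℝ) (φ : ℝ → ℝ) : Prop :=
  IntegrableOn (fun q : ℝ × ℝ => (φ q.1 - φ q.2) ^ 2 / |q.1 - q.2| ^ (2 * t + 1))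
    (Set.Ioo (0:ℝ) 1 ×ˢ Set.Ioo (0:ℝ) 1) (volume.prod volume)

/-- Squared `H^t_0((0,1))` norm. -/
noncomputable def Ht0NormSq (t : ℝ) (φ : ℝ → ℝ) : ℝ :=
  gagliardoSq t φ + (∫ x in Set.Ioo (0:ℝ) 1, φ x ^ 2 / x ^ (2 * t))
    + ∫ x in Set.Ioo (0:ℝ) 1, φ x ^ 2 / (1 - x) ^ (2 * t)

/-- Finiteness of the `H^t_0((0,1))` norm. -/
def Ht0Finite (t : ℝ) (φ : ℝ → ℝ) : Prop :=
  gagliardoFinite t φ ∧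
  IntegrableOn (fun x => φ x ^ 2 / x ^ (2 * t)) (Set.Ioo (0:ℝ) 1) ∧
  IntegrableOn (fun x => φ x ^ 2 / (1 - x) ^ (2 * t)) (Set.Ioo (0:ℝ) 1)

section PolynomialInequalities

open Polynomial

theorem integral_eval_derivative (p : ℝ[X]) :
    ∫ x in (0:ℝ)..1, (derivative p).eval x = p.eval 1 - p.eval 0 :=
  intervalIntegral.integral_eq_sub_of_hasDerivAt (fun x _ => p.hasDerivAt x)
    ((derivative p).continuous.intervalIntegrable _ _)

theorem integral_eval_derivative_mul (p q : ℝ[X]) :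
    ∫ x in (0:ℝ)..1, (derivative p).eval x * q.eval x =
      p.eval 1 * q.eval 1 - p.eval 0 * q.eval 0 -
        ∫ x in (0:ℝ)..1, p.eval x * (derivative q).eval x := by
  have h := integral_eval_derivative (p * q)
  simp only [derivative_mul, eval_add, eval_mul] at h
  rw [intervalIntegral.integral_add] at h
  · linarith
  · exact ((derivative p).continuous.mul q.continuous).intervalIntegrable _ _
  · exact (p.continuous.mul (derivative q).continuous).intervalIntegrable _ _

/-- The shifted Legendre polynomial with real coefficients. -/
noncomputable def realLegendre (n : ℕ) : ℝ[X] :=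
  (shiftedLegendre n).map (Int.castRingHom ℝ)

theorem realLegendre_eval_zero (n : ℕ) : (realLegendre n).eval 0 = 1 := by
  rw [← coeff_zero_eq_eval_zero, realLegendre, coeff_map, coeff_shiftedLegendre]
  simp

theorem realLegendre_eq_comp (n : ℕ) :
    realLegendre n = (-1) ^ n * (realLegendre n).comp (1 - X) := by
  have h := congrArg (Polynomial.map (Int.castRingHom ℝ))
    (neg_one_pow_mul_shiftedLegendre_comp_one_sub_X_eq n)
  simp only [Polynomial.map_mul, Polynomial.map_pow, Polynomial.map_neg, Polynomial.map_one,
    Polynomial.map_comp, Polynomial.map_sub, Polynomial.map_X] at h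
  exact h.symm

theorem realLegendre_eval_one (n : ℕ) : (realLegendre n).eval 1 = (-1) ^ n := by
  rw [realLegendre_eq_comp]
  simp [realLegendre_eval_zero]

theorem realLegendre_derivative_eval_zero (n : ℕ) :
    (derivative (realLegendre n)).eval 0 = -(n * (n + 1)) := by
  rw [← coeff_zero_eq_eval_zero, coeff_derivative, realLegendre, coeff_map, coeff_shiftedLegendre]
  simp

theorem realLegendre_derivative_eval_one (n : ℕ) :
    (derivative (realLegendre n)).eval 1 = (-1) ^ n * (n * (n + 1)) := by
  have h := congrArg (fun p => (derivative p).eval 1) (realLegendre_eq_comp n)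
  have hc : ((-1 : ℝ[X]) ^ n) = C ((-1 : ℝ) ^ n) := by simp
  simp only [hc, derivative_mul, derivative_C, derivative_comp] at h
  rw [h]
  simp [realLegendre_derivative_eval_zero]

theorem realLegendre_degree (n : ℕ) : (realLegendre n).degree = n := by
  rw [realLegendre, degree_map_eq_of_injective (RingHom.injective_int _), degree_shiftedLegendre]

theorem realLegendre_natDegree (n : ℕ) : (realLegendre n).natDegree = n :=
  natDegree_eq_of_degree_eq_some (realLegendre_degree n)

theorem factorial_mul_realLegendre (n : ℕ) :
    (n.factorial : ℝ[X]) * realLegendre n = derivative^[n] (X ^ n * (1 - X) ^ n) := by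
  have h := congrArg (Polynomial.map (Int.castRingHom ℝ)) (factorial_mul_shiftedLegendre_eq n)
  rw [← iterate_derivative_map] at h
  simpa [realLegendre] using h

theorem eval_iterate_derivative_eq_zero {n m : ℕ} (hm : m < n) {x : ℝ} (hx : x = 0 ∨ x = 1) :
    (derivative^[m] ((X : ℝ[X]) ^ n * (1 - X) ^ n)).eval x = 0 := by
  have h := pow_sub_dvd_iterate_derivative_pow ((X : ℝ[X]) * (1 - X)) n m
  obtain ⟨q, hq⟩ := h
  rw [← mul_pow, hq]
  rcases hx with rfl | rfl <;> simp [Nat.sub_ne_zero_of_lt hm]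

theorem integral_iterate_derivative_mul_eq_zero (n m : ℕ) (hm : m ≤ n) (q : ℝ[X])
    (hq : q.degree < m) :
    ∫ x in (0:ℝ)..1,
      (derivative^[m] ((X : ℝ[X]) ^ n * (1 - X) ^ n)).eval x * q.eval x = 0 := by
  induction m generalizing q with
  | zero =>
    have : q = 0 := by
      rw [← degree_eq_bot]
      exact Nat.WithBot.lt_zero_iff.1 (by simpa using hq)
    simp [this]
  | succ m ih =>
    rw [Function.iterate_succ_apply', integral_eval_derivative_mul,
      eval_iterate_derivative_eq_zero hm (Or.inl rfl),
      eval_iterate_derivative_eq_zero hm (Or.inr rfl), ih (by omega)]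
    · simp
    · by_cases h0 : q = 0
      · simp [h0]
      · refine (degree_derivative_lt h0).trans_le ?_
        rw [degree_eq_natDegree h0] at hq ⊢
        norm_cast at hq ⊢
        omega

theorem integral_realLegendre_mul_eq_zero (n : ℕ) (q : ℝ[X]) (hq : q.degree < n) :
    ∫ x in (0:ℝ)..1, (realLegendre n).eval x * q.eval x = 0 := by
  have h := integral_iterate_derivative_mul_eq_zero n n le_rfl q hq
  rw [← factorial_mul_realLegendre] at h
  simp only [eval_mul, eval_natCast, mul_assoc] at h
  rw [intervalIntegral.integral_const_mul] at h
  exact (mul_eq_zero.1 h).resolve_left (by positivity)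

theorem degree_sub_C_mul_realLegendre_lt {n : ℕ} {p : ℝ[X]} (hp : p.degree ≤ n) :
    (p - C (p.coeff n / (realLegendre n).leadingCoeff) * realLegendre n).degree < n := by
  have hl : (realLegendre n).leadingCoeff ≠ 0 := by
    rw [Ne, leadingCoeff_eq_zero, ← degree_eq_bot, realLegendre_degree]
    simp
  rw [degree_lt_iff_coeff_zero]
  intro m hm
  rcases hm.eq_or_lt with rfl | hm
  · have : (realLegendre n).coeff n = (realLegendre n).leadingCoeff := by
      rw [leadingCoeff, realLegendre_natDegree]
    rw [coeff_sub, coeff_C_mul, this, div_mul_cancel₀ _ hl, sub_self]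
  · rw [coeff_sub, coeff_C_mul, coeff_eq_zero_of_degree_lt (hp.trans_lt (by exact_mod_cast hm)),
      coeff_eq_zero_of_degree_lt (p := realLegendre n)
        (by rw [realLegendre_degree]; exact_mod_cast hm)]
    simp

theorem integral_realLegendre_sq (n : ℕ) :
    ∫ x in (0:ℝ)..1, (realLegendre n).eval x ^ 2 = 1 / (2 * n + 1) := by
  set P := realLegendre n with hP
  have hlow : (X * derivative P - C (n : ℝ) * P).degree < (n : WithBot ℕ) := by
    rw [degree_lt_iff_coeff_zero]
    intro m hm
    rcases hm.eq_or_lt with rfl | hm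
    · rcases n with _ | n
      · simp [coeff_derivative]
      · simp only [coeff_sub, coeff_X_mul, coeff_C_mul, coeff_derivative]
        push_cast
        ring
    · have h0 : P.coeff m = 0 := coeff_eq_zero_of_degree_lt (p := P)
        (by rw [hP, realLegendre_degree]; exact_mod_cast hm)
      rcases m with _ | m
      · omega
      · simp [coeff_X_mul, coeff_derivative, h0, -eq_natCast]
  have h1 := integral_eval_derivative_mul P (X * P)
  have h2 := integral_realLegendre_mul_eq_zero n _ hlow
  rw [← hP] at h2
  have c : ∀ q : ℝ[X], IntervalIntegrable (fun x => P.eval x * q.eval x) volume 0 1 := fun q =>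
    (P.continuous.mul q.continuous).intervalIntegrable _ _
  have e1 : ∀ x, (derivative P).eval x * (X * P).eval x = P.eval x * (X * derivative P).eval x := by
    intro x; simp; ring
  have e2 : ∀ x, P.eval x * (derivative (X * P)).eval x
      = P.eval x * P.eval x + P.eval x * (X * derivative P).eval x := by
    intro x; simp; ring
  have e3 : ∀ x, P.eval x * (X * derivative P - C (n : ℝ) * P).eval x
      = P.eval x * (X * derivative P).eval x - n * (P.eval x * P.eval x) := by
    intro x; simp; ring
  simp only [e1, e2] at h1
  simp only [e3] at h2
  rw [intervalIntegral.integral_add (c _) (c _)] at h1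
  rw [intervalIntegral.integral_sub (c _) ((c _).const_mul _),
    intervalIntegral.integral_const_mul] at h2
  have h3 : P.eval 1 * (X * P).eval 1 = 1 := by
    simp only [eval_mul, eval_X, one_mul, hP, realLegendre_eval_one, ← mul_pow]
    norm_num
  have h4 : P.eval 0 * (X * P).eval 0 = 0 := by simp
  rw [h3, h4] at h1
  simp only [sq]
  rw [eq_div_iff (by positivity)]
  linarith

theorem integral_realLegendre_derivative_sq (n : ℕ) :
    ∫ x in (0:ℝ)..1, (derivative (realLegendre n)).eval x ^ 2 = 2 * (n * (n + 1)) := by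
  have h := integral_eval_derivative_mul (realLegendre n) (derivative (realLegendre n))
  have hd : (derivative (derivative (realLegendre n))).degree < n := by
    have h0 : realLegendre n ≠ 0 := by
      rw [Ne, ← degree_eq_bot, realLegendre_degree]; simp
    calc _ ≤ (derivative (realLegendre n)).degree := degree_derivative_le
      _ < (realLegendre n).degree := degree_derivative_lt h0
      _ = n := realLegendre_degree n
  rw [integral_realLegendre_mul_eq_zero n _ hd, realLegendre_eval_zero, realLegendre_eval_one,
    realLegendre_derivative_eval_one, realLegendre_derivative_eval_zero] at h
  simp only [sq, h]
  have : ((-1 : ℝ) ^ n) * (-1) ^ n = 1 := by rw [← mul_pow]; norm_num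
  linear_combination (n * (n + 1) : ℝ) * this

/-- Markov's inequality in `L²(0,1)`. -/
theorem integral_derivative_sq_le (k : ℕ) (p : ℝ[X]) (hp : p.natDegree ≤ k) :
    ∫ x in (0:ℝ)..1, (derivative p).eval x ^ 2 ≤
      ((k : ℝ) + 1) ^ 4 * ∫ x in (0:ℝ)..1, p.eval x ^ 2 := by
  induction k generalizing p with
  | zero =>
    rw [derivative_of_natDegree_zero (by omega)]
    simp only [eval_zero, ne_eq, OfNat.ofNat_ne_zero, not_false_eq_true, zero_pow,
      intervalIntegral.integral_zero]
    exact mul_nonneg (by positivity)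
      (intervalIntegral.integral_nonneg zero_le_one fun x _ => sq_nonneg _)
  | succ k ih =>
    set P := realLegendre (k + 1) with hP
    set a := p.coeff (k + 1) / P.leadingCoeff
    set q := p - C a * P with hq
    have hqd : q.degree < (k + 1 : ℕ) :=
      degree_sub_C_mul_realLegendre_lt (natDegree_le_iff_degree_le.1 hp)
    have hqn : q.natDegree ≤ k := by
      by_cases h0 : q = 0
      · simp [h0]
      · rw [degree_eq_natDegree h0] at hqd
        norm_cast at hqd
        omega
    have hpq : p = C a * P + q := by rw [hq]; ring
    have hih := ih q hqn
    have horth := integral_realLegendre_mul_eq_zero (k + 1) q hqd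
    have hn := integral_realLegendre_sq (k + 1)
    have hdn := integral_realLegendre_derivative_sq (k + 1)
    rw [← hP] at horth hn hdn
    set b := ∫ x in (0:ℝ)..1, q.eval x ^ 2 with hb
    have hb0 : 0 ≤ b := intervalIntegral.integral_nonneg zero_le_one fun x _ => sq_nonneg _
    have cont : ∀ u v : ℝ[X], IntervalIntegrable (fun x => u.eval x * v.eval x) volume 0 1 :=
      fun u v => (u.continuous.mul v.continuous).intervalIntegrable _ _
    have conts : ∀ u : ℝ[X], IntervalIntegrable (fun x => u.eval x ^ 2) volume 0 1 :=
      fun u => (u.continuous.pow 2).intervalIntegrable _ _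
    have e1 : ∫ x in (0:ℝ)..1, p.eval x ^ 2 = a ^ 2 * (1 / (2 * (k + 1 : ℕ) + 1)) + b := by
      have : ∀ x, p.eval x ^ 2 =
          a ^ 2 * P.eval x ^ 2 + (2 * a) * (P.eval x * q.eval x) + q.eval x ^ 2 := by
        intro x; rw [hpq]; simp; ring
      simp only [this]
      rw [intervalIntegral.integral_add (((conts _).const_mul _).add ((cont _ _).const_mul _))
        (conts _), intervalIntegral.integral_add ((conts _).const_mul _) ((cont _ _).const_mul _),
        intervalIntegral.integral_const_mul, intervalIntegral.integral_const_mul, horth, hn]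
      simp [hb]
    set A : ℝ := 2 * ((k + 1 : ℕ) * ((k + 1 : ℕ) + 1)) * (2 * (k + 1 : ℕ) + 1) with hA
    set m : ℝ := ((k : ℝ) + 1) ^ 4 with hm
    have hA0 : 0 < A := by positivity
    have hm0 : 0 < m := by positivity
    have e2 : ∫ x in (0:ℝ)..1, (derivative p).eval x ^ 2 ≤
        (1 + m / A) * a ^ 2 * (2 * ((k + 1 : ℕ) * ((k + 1 : ℕ) + 1)))
          + (1 + A / m) * ∫ x in (0:ℝ)..1, (derivative q).eval x ^ 2 := by
      rw [← hdn, ← intervalIntegral.integral_const_mul, ← intervalIntegral.integral_const_mul,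
        ← intervalIntegral.integral_add ((conts _).const_mul _) ((conts _).const_mul _)]
      refine intervalIntegral.integral_mono_on zero_le_one (conts _)
        (((conts _).const_mul _).add ((conts _).const_mul _)) fun x _ => ?_
      have : (derivative p).eval x = a * (derivative P).eval x + (derivative q).eval x := by
        rw [hpq]; simp
      rw [this]
      set u := (derivative P).eval x
      set v := (derivative q).eval x
      have : (1 + m / A) * a ^ 2 * u ^ 2 + (1 + A / m) * v ^ 2 - (a * u + v) ^ 2
          = (m * (a * u) - A * v) ^ 2 / (A * m) := by
        field_simp
        ring
      have h0 : 0 ≤ (m * (a * u) - A * v) ^ 2 / (A * m) := by positivity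
      linarith
    have e3 : (1 + A / m) * ∫ x in (0:ℝ)..1, (derivative q).eval x ^ 2 ≤ (m + A) * b := by
      calc _ ≤ (1 + A / m) * (m * b) := mul_le_mul_of_nonneg_left hih (by positivity)
        _ = _ := by field_simp
    have e4 : (1 + m / A) * a ^ 2 * (2 * ((k + 1 : ℕ) * ((k + 1 : ℕ) + 1))) =
        (m + A) * (a ^ 2 * (1 / (2 * (k + 1 : ℕ) + 1))) := by
      rw [hA]
      field_simp
      ring
    rw [e1]
    calc _ ≤ (m + A) * (a ^ 2 * (1 / (2 * (k + 1 : ℕ) + 1)) + b) := by linarith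
      _ ≤ _ := by
        refine mul_le_mul_of_nonneg_right ?_ (by positivity)
        rw [hA, hm]
        push_cast
        have : (0:ℝ) ≤ k := by positivity
        nlinarith

/-- A polynomial of degree at most `k` on the unit interval is bounded by its `L²` norm. -/
theorem eval_sq_le (k : ℕ) (hk : 1 ≤ k) (p : ℝ[X]) (hp : p.natDegree ≤ k) {x : ℝ}
    (hx : x ∈ Set.Icc (0:ℝ) 1) :
    p.eval x ^ 2 ≤ 9 * (k : ℝ) ^ 2 * ∫ x in (0:ℝ)..1, p.eval x ^ 2 := by
  set P := ∫ x in (0:ℝ)..1, p.eval x ^ 2 with hP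
  have hk' : (1:ℝ) ≤ k := by exact_mod_cast hk
  have hP0 : 0 ≤ P := intervalIntegral.integral_nonneg zero_le_one fun x _ => sq_nonneg _
  have hM : ∫ x in (0:ℝ)..1, (derivative p).eval x ^ 2 ≤ 16 * (k : ℝ) ^ 4 * P := by
    refine (integral_derivative_sq_le k p hp).trans (mul_le_mul_of_nonneg_right ?_ hP0)
    calc ((k:ℝ) + 1) ^ 4 ≤ (2 * k) ^ 4 := by gcongr; linarith
      _ = _ := by ring
  have conts : ∀ u : ℝ[X], ∀ a b, IntervalIntegrable (fun x => u.eval x ^ 2) volume a b :=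
    fun u a b => (u.continuous.pow 2).intervalIntegrable _ _
  have hcont : Continuous fun t => |2 * p.eval t * (derivative p).eval t| :=
    ((continuous_const.mul p.continuous).mul (derivative p).continuous).abs
  have key : ∫ t in (0:ℝ)..1, |2 * p.eval t * (derivative p).eval t| ≤ 8 * (k : ℝ) ^ 2 * P := by
    have : ∀ t, |2 * p.eval t * (derivative p).eval t| ≤
        4 * (k:ℝ) ^ 2 * p.eval t ^ 2 + 1 / (4 * (k:ℝ) ^ 2) * (derivative p).eval t ^ 2 := by
      intro t
      have hh : ∀ u v : ℝ, 2 * u * v ≤ 4 * (k:ℝ) ^ 2 * u ^ 2 + 1 / (4 * (k:ℝ) ^ 2) * v ^ 2 := by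
        intro u v
        have : 4 * (k:ℝ) ^ 2 * u ^ 2 + 1 / (4 * (k:ℝ) ^ 2) * v ^ 2 - 2 * u * v =
            (2 * k * u - v / (2 * k)) ^ 2 := by field_simp; ring
        nlinarith [sq_nonneg (2 * k * u - v / (2 * k))]
      rw [abs_le]
      constructor
      · have := hh (-p.eval t) ((derivative p).eval t)
        nlinarith
      · exact hh _ _
    calc _ ≤ ∫ t in (0:ℝ)..1, (4 * (k:ℝ) ^ 2 * p.eval t ^ 2 +
          1 / (4 * (k:ℝ) ^ 2) * (derivative p).eval t ^ 2) :=
          intervalIntegral.integral_mono_on zero_le_one (hcont.intervalIntegrable _ _)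
            (((conts _ _ _).const_mul _).add ((conts _ _ _).const_mul _)) fun t _ => this t
      _ = 4 * (k:ℝ) ^ 2 * P +
          1 / (4 * (k:ℝ) ^ 2) * ∫ t in (0:ℝ)..1, (derivative p).eval t ^ 2 := by
          rw [intervalIntegral.integral_add ((conts _ _ _).const_mul _)
            ((conts _ _ _).const_mul _), intervalIntegral.integral_const_mul,
            intervalIntegral.integral_const_mul]
      _ ≤ 4 * (k:ℝ) ^ 2 * P + 1 / (4 * (k:ℝ) ^ 2) * (16 * (k : ℝ) ^ 4 * P) := by gcongr
      _ = _ := by field_simp; ring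
  have hxy : ∀ y ∈ Set.Icc (0:ℝ) 1, p.eval x ^ 2 - 8 * (k : ℝ) ^ 2 * P ≤ p.eval y ^ 2 := by
    intro y hy
    have h1 : ∫ t in y..x, 2 * p.eval t * (derivative p).eval t = p.eval x ^ 2 - p.eval y ^ 2 :=
      intervalIntegral.integral_eq_sub_of_hasDerivAt
        (fun t _ => by simpa using (p.hasDerivAt t).pow 2)
        (((continuous_const.mul p.continuous).mul (derivative p).continuous).intervalIntegrable _ _)
    have h2 : |∫ t in y..x, 2 * p.eval t * (derivative p).eval t| ≤
        ∫ t in (0:ℝ)..1, |2 * p.eval t * (derivative p).eval t| := by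
      rw [← Real.norm_eq_abs, intervalIntegral.norm_intervalIntegral_eq]
      refine (norm_integral_le_integral_norm _).trans ?_
      rw [intervalIntegral.integral_of_le zero_le_one]
      refine setIntegral_mono_set ?_ (Filter.Eventually.of_forall fun t => norm_nonneg _) ?_
      · exact (hcont.integrableOn_Icc).mono_set Set.Ioc_subset_Icc_self
      · refine Filter.Eventually.of_forall fun t ht => ?_
        rcases Set.mem_uIoc.1 ht with h | h
        · exact ⟨hy.1.trans_lt h.1, h.2.trans hx.2⟩
        · exact ⟨hx.1.trans_lt h.1, h.2.trans hy.2⟩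
    have h3 := (le_abs_self _).trans (h2.trans key)
    linarith
  have h := intervalIntegral.integral_mono_on zero_le_one
    (by simp) (conts p 0 1) hxy
  rw [intervalIntegral.integral_const] at h
  simp only [sub_zero, one_smul] at h
  nlinarith [mul_nonneg (sub_nonneg.2 (one_le_pow₀ hk' : (1:ℝ) ≤ k ^ 2)) hP0]

end PolynomialInequalities

section Kernels

open scoped ENNReal

/-- Indicator of the ball of radius `R` as a convolution kernel. -/
noncomputable def ballKer (R : ℝ) : ℝ → ℝ≥0∞ :=
  {u | |u| ≤ R}.indicator 1

/-- The kernel `|u| ^ a` restricted to `0 < |u| ≤ ε`. -/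
noncomputable def nearKer (a ε : ℝ) : ℝ → ℝ≥0∞ :=
  {u | 0 < |u| ∧ |u| ≤ ε}.indicator fun u => ENNReal.ofReal (|u| ^ a)

/-- The kernel `|u| ^ a` restricted to `ε < |u|`. -/
noncomputable def farKer (a ε : ℝ) : ℝ → ℝ≥0∞ :=
  {u | ε < |u|}.indicator fun u => ENNReal.ofReal (|u| ^ a)

theorem measurable_ballKer (R : ℝ) : Measurable (ballKer R) :=
  measurable_one.indicator (measurableSet_le (by fun_prop) (by fun_prop))

theorem measurable_nearKer (a ε : ℝ) : Measurable (nearKer a ε) :=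
  Measurable.indicator (by fun_prop)
    (MeasurableSet.inter (measurableSet_lt measurable_const continuous_abs.measurable)
      (measurableSet_le continuous_abs.measurable measurable_const))

theorem measurable_farKer (a ε : ℝ) : Measurable (farKer a ε) :=
  Measurable.indicator (by fun_prop) (measurableSet_lt (by fun_prop) (by fun_prop))

theorem ballKer_of_le {R u : ℝ} (h : |u| ≤ R) : ballKer R u = 1 :=
  Set.indicator_of_mem (s := {u : ℝ | |u| ≤ R}) h _

theorem nearKer_of_le {a ε u : ℝ} (h0 : 0 < |u|) (h : |u| ≤ ε) :
    nearKer a ε u = ENNReal.ofReal (|u| ^ a) :=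
  Set.indicator_of_mem (s := {u : ℝ | 0 < |u| ∧ |u| ≤ ε}) ⟨h0, h⟩ _

theorem farKer_of_lt {a ε u : ℝ} (h : ε < |u|) : farKer a ε u = ENNReal.ofReal (|u| ^ a) :=
  Set.indicator_of_mem (s := {u : ℝ | ε < |u|}) h _

theorem lintegral_ballKer (R : ℝ) : ∫⁻ u, ballKer R u = ENNReal.ofReal (2 * R) := by
  have : {u : ℝ | |u| ≤ R} = Set.Icc (-R) R := by
    ext u; simp [abs_le]
  rw [ballKer, this, lintegral_indicator_one measurableSet_Icc, Real.volume_Icc]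
  congr 1; ring

theorem lintegral_le_two_mul_of_abs {S : Set ℝ} (hS : MeasurableSet S) {K g : ℝ → ℝ≥0∞}
    (hg : Measurable g) (h : ∀ u, K u ≤ S.indicator g u + S.indicator g (-u)) :
    ∫⁻ u, K u ≤ 2 * ∫⁻ u in S, g u := by
  refine (lintegral_mono h).trans_eq ?_
  rw [lintegral_add_left (hg.indicator hS), lintegral_neg_eq_self (f := S.indicator g),
    lintegral_indicator hS, two_mul]

theorem lintegral_nearKer_le {a ε : ℝ} (ha : -1 < a) (hε : 0 < ε) :
    ∫⁻ u, nearKer a ε u ≤ ENNReal.ofReal (2 / (a + 1) * ε ^ (a + 1)) := by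
  refine (lintegral_le_two_mul_of_abs (S := Set.Ioc 0 ε) (g := fun u => ENNReal.ofReal (u ^ a))
    measurableSet_Ioc (by fun_prop) fun u => ?_).trans ?_
  · by_cases hu : 0 < |u| ∧ |u| ≤ ε
    · have hn : nearKer a ε u = ENNReal.ofReal (|u| ^ a) := nearKer_of_le hu.1 hu.2
      rw [hn]
      rcases le_total 0 u with h | h
      · rw [abs_of_nonneg h] at hu ⊢
        rw [Set.indicator_of_mem (show u ∈ Set.Ioc 0 ε from hu)]
        exact le_self_add
      · rw [abs_of_nonpos h] at hu ⊢
        rw [Set.indicator_of_mem (show -u ∈ Set.Ioc 0 ε from hu)]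
        exact le_add_self
    · have hn : nearKer a ε u = 0 :=
        Set.indicator_of_notMem (s := {u : ℝ | 0 < |u| ∧ |u| ≤ ε}) hu _
      simp [hn]
  · have hi : IntervalIntegrable (fun u : ℝ => u ^ a) volume 0 ε :=
      intervalIntegral.intervalIntegrable_rpow' ha
    rw [← ofReal_integral_eq_lintegral_ofReal
      ((intervalIntegrable_iff_integrableOn_Ioc_of_le hε.le).1 hi)
      ((ae_restrict_iff' measurableSet_Ioc).2
        (Filter.Eventually.of_forall fun u hu => Real.rpow_nonneg hu.1.le _)),
      ← intervalIntegral.integral_of_le hε.le, integral_rpow (Or.inl ha),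
      Real.zero_rpow (by linarith), ← ENNReal.ofReal_ofNat 2, ← ENNReal.ofReal_mul (by norm_num)]
    apply le_of_eq
    congr 1
    ring

theorem lintegral_farKer_le {a ε : ℝ} (ha : a < -1) (hε : 0 < ε) :
    ∫⁻ u, farKer a ε u ≤ ENNReal.ofReal (2 / (-(a + 1)) * ε ^ (a + 1)) := by
  refine (lintegral_le_two_mul_of_abs (S := Set.Ioi ε) (g := fun u => ENNReal.ofReal (u ^ a))
    measurableSet_Ioi (by fun_prop) fun u => ?_).trans ?_
  · by_cases hu : ε < |u|
    · rcases le_total 0 u with h | h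
      · rw [abs_of_nonneg h] at hu
        simp [farKer, Set.indicator, hu, abs_of_nonneg h]
      · rw [abs_of_nonpos h] at hu
        simp [farKer, Set.indicator, abs_of_nonpos h, hu]
    · simp [farKer, Set.indicator, hu]
  · rw [← ofReal_integral_eq_lintegral_ofReal (integrableOn_Ioi_rpow_of_lt ha hε)
      ((ae_restrict_iff' measurableSet_Ioi).2
        (Filter.Eventually.of_forall fun u hu => Real.rpow_nonneg (hε.trans hu).le _)),
      integral_Ioi_rpow_of_lt ha hε, ← ENNReal.ofReal_ofNat 2, ← ENNReal.ofReal_mul (by norm_num)]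
    apply le_of_eq
    congr 1
    rw [div_neg]
    ring

theorem lintegral_lintegral_ker_mul_left_le {κ h : ℝ → ℝ≥0∞} (hκ : Measurable κ)
    (hfin : ∫⁻ u, κ u ≠ ∞) (S T : Set ℝ) :
    ∫⁻ x in S, ∫⁻ y in T, κ (x - y) * h x ≤ (∫⁻ u, κ u) * ∫⁻ x in S, h x := by
  rw [← lintegral_const_mul' _ _ hfin]
  refine lintegral_mono fun x => ?_
  rw [lintegral_mul_const _ (by fun_prop)]
  refine mul_le_mul_left ?_ _
  exact (setLIntegral_le_lintegral _ _).trans_eq (lintegral_sub_left_eq_self (μ := volume) κ x)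

theorem lintegral_lintegral_ker_mul_right_le {κ h : ℝ → ℝ≥0∞} (hκ : Measurable κ)
    (hh : Measurable h) (S T : Set ℝ) :
    ∫⁻ x in S, ∫⁻ y in T, κ (x - y) * h y ≤ (∫⁻ u, κ u) * ∫⁻ y in T, h y := by
  rw [lintegral_lintegral_swap (by fun_prop), ← lintegral_const_mul _ hh]
  refine lintegral_mono fun y => ?_
  rw [lintegral_mul_const _ (by fun_prop)]
  refine mul_le_mul_left ?_ _
  exact (setLIntegral_le_lintegral _ _).trans_eq (lintegral_sub_right_eq_self (μ := volume) κ y)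

theorem lintegral_ker_mul_sq_le {κ h : ℝ → ℝ≥0∞} (hκ : Measurable κ) (hh : Measurable h) :
    (∫⁻ z, κ z * h z) ^ 2 ≤ (∫⁻ z, κ z) * ∫⁻ z, κ z * h z ^ 2 := by
  have h2 := ENNReal.lintegral_mul_le_Lp_mul_Lq volume Real.HolderConjugate.two_two
    (f := fun z => κ z ^ (1/2 : ℝ)) (g := fun z => κ z ^ (1/2 : ℝ) * h z)
    (hκ.pow_const _).aemeasurable ((hκ.pow_const _).mul hh).aemeasurable
  have e1 : ∀ z, κ z ^ (1/2:ℝ) * κ z ^ (1/2:ℝ) = κ z := fun z => by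
    rw [← ENNReal.rpow_add_of_nonneg _ _ (by norm_num) (by norm_num)]; norm_num
  simp only [Pi.mul_apply, ← mul_assoc, e1] at h2
  have e2 : ∀ z, (κ z ^ (1/2:ℝ)) ^ (2:ℝ) = κ z := fun z => by
    rw [← ENNReal.rpow_mul]; norm_num
  simp only [ENNReal.mul_rpow_of_nonneg _ _ (show (0:ℝ) ≤ 2 by norm_num), e2,
    ENNReal.rpow_two] at h2
  calc _ ≤ _ := pow_le_pow_left' h2 2
    _ = _ := by
      rw [mul_pow]
      simp only [← ENNReal.rpow_two, ← ENNReal.rpow_mul]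
      norm_num

/-- Cauchy-Schwarz for an integral against a bounded compactly supported kernel. -/
theorem ofReal_integral_mul_sq_le {K h : ℝ → ℝ} (hh : Measurable h) {x R M : ℝ}
    (hM : 0 ≤ M) (hK : ∀ z, |K z| ≤ M) (hsupp : ∀ z, R < |x - z| → K z = 0) :
    ENNReal.ofReal ((∫ z, K z * h z) ^ 2) ≤
      ENNReal.ofReal (M ^ 2 * (2 * R)) * ∫⁻ z, ballKer R (x - z) * ENNReal.ofReal (h z ^ 2) := by
  have e : ∀ t : ℝ, ENNReal.ofReal (t ^ 2) = ‖t‖ₑ ^ 2 := fun t => by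
    rw [Real.enorm_eq_ofReal_abs, ← ENNReal.ofReal_pow (abs_nonneg t), sq_abs]
  have h1 : ‖∫ z, K z * h z‖ₑ ≤ ENNReal.ofReal M * ∫⁻ z, ballKer R (x - z) * ‖h z‖ₑ := by
    refine (enorm_integral_le_lintegral_enorm _).trans ?_
    rw [← lintegral_const_mul' _ _ ENNReal.ofReal_ne_top]
    refine lintegral_mono fun z => ?_
    rw [enorm_mul, ← mul_assoc]
    gcongr
    by_cases hz : |x - z| ≤ R
    · simp only [ballKer, Set.indicator, Set.mem_ofPred_eq, hz, if_true, Pi.one_apply, mul_one]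
      rw [Real.enorm_eq_ofReal_abs]
      exact ENNReal.ofReal_le_ofReal (hK z)
    · simp [hsupp z (not_le.1 hz)]
  have hb : Measurable fun z => ballKer R (x - z) := (measurable_ballKer R).comp (by fun_prop)
  rw [e]
  calc _ ≤ _ := pow_le_pow_left' h1 2
    _ = ENNReal.ofReal (M ^ 2) * (∫⁻ z, ballKer R (x - z) * ‖h z‖ₑ) ^ 2 := by
      rw [mul_pow, ENNReal.ofReal_pow hM]
    _ ≤ ENNReal.ofReal (M ^ 2) * (ENNReal.ofReal (2 * R) *
        ∫⁻ z, ballKer R (x - z) * ‖h z‖ₑ ^ 2) := by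
      gcongr
      refine (lintegral_ker_mul_sq_le hb hh.enorm).trans_eq ?_
      rw [lintegral_sub_left_eq_self (ballKer R) x, lintegral_ballKer]
    _ = _ := by
      rw [← mul_assoc, ← ENNReal.ofReal_mul (by positivity)]
      congr 1
      simp only [e]

end Kernels

section Regularization

open scoped ENNReal

/-- The hat function of width `ε` and unit mass. -/
noncomputable def hat (ε u : ℝ) : ℝ := max 0 (1 - |u| / ε) / ε

theorem continuous_hat (ε : ℝ) : Continuous (hat ε) := by
  unfold hat; fun_prop

theorem hat_eq_zero {ε u : ℝ} (hε : 0 < ε) (h : ε ≤ |u|) : hat ε u = 0 := by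
  have : 1 - |u| / ε ≤ 0 := by
    rw [sub_nonpos, le_div_iff₀ hε]; linarith
  simp [hat, max_eq_left this]

theorem abs_hat_le {ε : ℝ} (hε : 0 < ε) (u : ℝ) : |hat ε u| ≤ 1 / ε := by
  have h0 : 0 ≤ hat ε u := div_nonneg (le_max_left _ _) hε.le
  rw [abs_of_nonneg h0]
  refine div_le_div_of_nonneg_right (max_le zero_le_one ?_) hε.le
  have : 0 ≤ |u| / ε := by positivity
  linarith

theorem abs_hat_sub_hat_le {ε : ℝ} (hε : 0 < ε) (u v : ℝ) :
    |hat ε u - hat ε v| ≤ |u - v| / ε ^ 2 := by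
  have h1 : hat ε u - hat ε v = (max 0 (1 - |u| / ε) - max 0 (1 - |v| / ε)) / ε := by
    simp only [hat]; ring
  rw [h1, abs_div, abs_of_pos hε, sq, ← div_div]
  refine div_le_div_of_nonneg_right ?_ hε.le
  refine (abs_max_sub_max_le_max _ _ _ _).trans ?_
  rw [sub_self, abs_zero, max_eq_right (abs_nonneg _)]
  have h2 : 1 - |u| / ε - (1 - |v| / ε) = (|v| - |u|) / ε := by ring
  rw [h2, abs_div, abs_of_pos hε, abs_sub_comm]
  exact div_le_div_of_nonneg_right (abs_abs_sub_abs_le_abs_sub u v) hε.le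

theorem integral_hat {ε : ℝ} (hε : 0 < ε) : ∫ u, hat ε u = 1 := by
  have h1 : ∫ u, hat ε u = 2 * ∫ u in Set.Ioi (0:ℝ), max 0 (1 - u / ε) / ε :=
    integral_comp_abs (f := fun u => max 0 (1 - u / ε) / ε)
  have h2 : ∫ u in Set.Ioi (0:ℝ), max 0 (1 - u / ε) / ε =
      ∫ u in Set.Ioc 0 ε, max 0 (1 - u / ε) / ε := by
    refine setIntegral_eq_of_subset_of_forall_sdiff_eq_zero measurableSet_Ioi
      (fun u hu => hu.1) fun u hu => ?_
    have h : ε < u := by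
      by_contra h
      exact hu.2 ⟨hu.1, not_lt.1 h⟩
    have : 1 - u / ε ≤ 0 := by
      rw [sub_nonpos, le_div_iff₀ hε]; linarith
    simp [max_eq_left this]
  have h3 : ∫ u in Set.Ioc 0 ε, max 0 (1 - u / ε) / ε = ∫ u in (0:ℝ)..ε, (1 - u / ε) / ε := by
    rw [intervalIntegral.integral_of_le hε.le]
    refine setIntegral_congr_fun measurableSet_Ioc fun u hu => ?_
    have : 0 ≤ 1 - u / ε := by
      rw [sub_nonneg, div_le_one hε]; exact hu.2
    simp [max_eq_right this]
  have h4 : ∫ u in (0:ℝ)..ε, (1 - u / ε) / ε = 1 / 2 := by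
    rw [intervalIntegral.integral_div, intervalIntegral.integral_sub (by simp)
      ((by fun_prop : Continuous fun u : ℝ => u / ε).intervalIntegrable _ _), intervalIntegral.integral_div]
    simp
    field_simp
    norm_num
  rw [h1, h2, h3, h4]; norm_num

/-- The function `f` cut off at distance `2 * ε` from the end points of the unit interval. -/
noncomputable def interiorCut (ε : ℝ) (f : ℝ → ℝ) : ℝ → ℝ :=
  (Set.Ioo (2 * ε) (1 - 2 * ε)).indicator f

/-- Mollification of the interior cut-off of `f`. -/
noncomputable def regularize (ε : ℝ) (f : ℝ → ℝ) (x : ℝ) : ℝ :=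
  ∫ z, hat ε (x - z) * interiorCut ε f z

/-- Local mean square oscillation of the interior cut-off of `f`. -/
noncomputable def localOsc (ε : ℝ) (f : ℝ → ℝ) (x : ℝ) : ℝ≥0∞ :=
  ∫⁻ z, ballKer (2 * ε) (x - z) * ENNReal.ofReal ((interiorCut ε f z - interiorCut ε f x) ^ 2)

/-- The square of `f`, restricted to the boundary layer of width `4 * ε`. -/
noncomputable def layerSq (ε : ℝ) (f : ℝ → ℝ) : ℝ → ℝ≥0∞ :=
  {x | x ≤ 4 * ε ∨ 1 - 4 * ε ≤ x}.indicator fun x => ENNReal.ofReal (f x ^ 2)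

theorem measurable_interiorCut {ε : ℝ} {f : ℝ → ℝ} (hf : Measurable f) :
    Measurable (interiorCut ε f) := hf.indicator measurableSet_Ioo

theorem measurable_regularize {ε : ℝ} {f : ℝ → ℝ} (hf : Measurable f) :
    Measurable (regularize ε f) := by
  have h : StronglyMeasurable fun q : ℝ × ℝ => hat ε (q.1 - q.2) * interiorCut ε f q.2 :=
    (((continuous_hat ε).measurable.comp (measurable_fst.sub measurable_snd)).mul
      ((measurable_interiorCut hf).comp measurable_snd)).stronglyMeasurable
  exact h.integral_prod_right.measurable

theorem measurable_layerSq {ε : ℝ} {f : ℝ → ℝ} (hf : Measurable f) :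
    Measurable (layerSq ε f) :=
  Measurable.indicator (by fun_prop)
    (MeasurableSet.union (measurableSet_le measurable_id measurable_const)
      (measurableSet_le measurable_const measurable_id))

theorem integrable_interiorCut {ε : ℝ} {f : ℝ → ℝ} (hε : 0 < ε)
    (hfi : IntegrableOn f (Set.Ioo 0 1)) : Integrable (interiorCut ε f) :=
  (integrable_indicator_iff measurableSet_Ioo).2
    (hfi.mono_set (Set.Ioo_subset_Ioo (by linarith) (by linarith)))

theorem integrable_hat_sub {ε : ℝ} (hε : 0 < ε) (x : ℝ) : Integrable fun z => hat ε (x - z) := by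
  refine Integrable.comp_sub_left (f := hat ε) ?_ x
  by_contra h
  have := integral_hat hε
  rw [integral_undef h] at this
  exact zero_ne_one this

theorem integrable_hat_mul {ε : ℝ} (hε : 0 < ε) (x : ℝ) {g : ℝ → ℝ} (hg : Integrable g) :
    Integrable fun z => hat ε (x - z) * g z :=
  hg.bdd_mul (c := 1 / ε) ((continuous_hat ε).comp (by fun_prop)).aestronglyMeasurable
    (Filter.Eventually.of_forall fun z => abs_hat_le hε _)

theorem regularize_sub_const {ε : ℝ} {f : ℝ → ℝ} (hε : 0 < ε)
    (hfi : IntegrableOn f (Set.Ioo 0 1)) (x c : ℝ) :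
    regularize ε f x - c = ∫ z, hat ε (x - z) * (interiorCut ε f z - c) := by
  have h1 : ∫ z, hat ε (x - z) * c = c := by
    rw [integral_mul_const, integral_sub_left_eq_self (hat ε) volume x, integral_hat hε, one_mul]
  simp only [mul_sub]
  rw [integral_sub (integrable_hat_mul hε x (integrable_interiorCut hε hfi))
    ((integrable_hat_sub hε x).mul_const c), h1, regularize]

theorem regularize_eq_zero {ε : ℝ} {f : ℝ → ℝ} (hε : 0 < ε) {x : ℝ} (hx : x ≤ ε ∨ 1 - ε ≤ x) :
    regularize ε f x = 0 := by
  rw [regularize, ← integral_zero ℝ ℝ (μ := volume)]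
  congr 1
  ext z
  by_cases hz : z ∈ Set.Ioo (2 * ε) (1 - 2 * ε)
  · rw [hat_eq_zero hε, zero_mul]
    rcases hx with h | h
    · rw [abs_of_nonpos] <;> linarith [hz.1]
    · rw [abs_of_nonneg] <;> linarith [hz.2]
  · simp [interiorCut, hz]

theorem regularize_sub_interiorCut_sq_le {ε : ℝ} {f : ℝ → ℝ} (hε : 0 < ε) (hf : Measurable f)
    (hfi : IntegrableOn f (Set.Ioo 0 1)) (x : ℝ) :
    ENNReal.ofReal ((regularize ε f x - interiorCut ε f x) ^ 2) ≤
      ENNReal.ofReal (4 / ε) * localOsc ε f x := by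
  rw [regularize_sub_const hε hfi]
  refine (ofReal_integral_mul_sq_le (x := x) (R := 2 * ε) (M := 1 / ε)
    ((measurable_interiorCut hf).sub_const _) (by positivity) (fun z => abs_hat_le hε _)
    fun z hz => hat_eq_zero hε (by linarith)).trans_eq ?_
  rw [localOsc]
  congr 2
  field_simp
  norm_num

theorem regularize_sub_regularize_sq_le {ε : ℝ} {f : ℝ → ℝ} (hε : 0 < ε) (hf : Measurable f)
    (hfi : IntegrableOn f (Set.Ioo 0 1)) {x y : ℝ} (hxy : |x - y| ≤ ε) :
    ENNReal.ofReal ((regularize ε f x - regularize ε f y) ^ 2) ≤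
      ENNReal.ofReal (4 / ε ^ 3 * |x - y| ^ 2) * localOsc ε f x := by
  have h1 : regularize ε f x - regularize ε f y =
      ∫ z, (hat ε (x - z) - hat ε (y - z)) * (interiorCut ε f z - interiorCut ε f x) := by
    have i : ∀ w, Integrable fun z => hat ε (w - z) * (interiorCut ε f z - interiorCut ε f x) := by
      intro w
      simp only [mul_sub]
      exact (integrable_hat_mul hε w (integrable_interiorCut hε hfi)).sub
        ((integrable_hat_sub hε w).mul_const _)
    simp only [sub_mul]
    rw [integral_sub (i x) (i y), ← regularize_sub_const hε hfi, ← regularize_sub_const hε hfi]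
    ring
  rw [h1]
  refine (ofReal_integral_mul_sq_le (x := x) (R := 2 * ε) (M := |x - y| / ε ^ 2)
    ((measurable_interiorCut hf).sub_const _) (by positivity)
    (fun z => (abs_hat_sub_hat_le hε _ _).trans_eq (by congr 2; ring))
    fun z hz => ?_).trans_eq ?_
  · have h2 : |x - z| ≤ |x - y| + |y - z| := abs_sub_le _ _ _
    rw [hat_eq_zero hε (by linarith), hat_eq_zero hε (by linarith), sub_zero]
  · rw [localOsc]
    congr 2
    field_simp
    norm_num

theorem localOsc_le {ε : ℝ} {f : ℝ → ℝ} (hε : 0 < ε) (x : ℝ) :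
    localOsc ε f x ≤ ∫⁻ z in Set.Ioo (0:ℝ) 1, ballKer (2 * ε) (x - z) *
      (2 * ENNReal.ofReal ((f z - f x) ^ 2) + 2 * layerSq ε f x) := by
  rw [localOsc, ← lintegral_indicator measurableSet_Ioo]
  refine lintegral_mono fun z => ?_
  by_cases hxz : |x - z| ≤ 2 * ε
  swap
  · have : ballKer (2 * ε) (x - z) = 0 :=
      Set.indicator_of_notMem (s := {u : ℝ | |u| ≤ 2 * ε}) hxz _
    simp [this]
  obtain ⟨h1, h2⟩ := abs_le.1 hxz
  have hof : ∀ a b : ℝ, ENNReal.ofReal (2 * a ^ 2 + 2 * b ^ 2) =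
      2 * ENNReal.ofReal (a ^ 2) + 2 * ENNReal.ofReal (b ^ 2) := fun a b => by
    rw [ENNReal.ofReal_add (by positivity) (by positivity), ENNReal.ofReal_mul (by norm_num),
      ENNReal.ofReal_mul (by norm_num), ENNReal.ofReal_ofNat]
  have hlayer : x ≤ 4 * ε ∨ 1 - 4 * ε ≤ x → layerSq ε f x = ENNReal.ofReal (f x ^ 2) := fun h =>
    Set.indicator_of_mem (s := {x : ℝ | x ≤ 4 * ε ∨ 1 - 4 * ε ≤ x}) h _
  by_cases hxc : x ∈ Set.Ioo (2 * ε) (1 - 2 * ε)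
  · have hz : z ∈ Set.Ioo (0:ℝ) 1 := ⟨by linarith [hxc.1], by linarith [hxc.2]⟩
    rw [Set.indicator_of_mem hz, ballKer_of_le hxz, one_mul, one_mul]
    by_cases hzc : z ∈ Set.Ioo (2 * ε) (1 - 2 * ε)
    · simp only [interiorCut, Set.indicator_of_mem hxc, Set.indicator_of_mem hzc]
      refine le_trans ?_ le_self_add
      rw [two_mul]
      exact le_self_add
    · rw [hlayer]
      · simp only [interiorCut, Set.indicator_of_mem hxc, Set.indicator_of_notMem hzc]
        refine le_trans ?_ le_add_self
        rw [two_mul, zero_sub, neg_sq]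
        exact le_self_add
      · by_contra! h
        exact hzc ⟨by linarith [h.1], by linarith [h.2]⟩
  · by_cases hzc : z ∈ Set.Ioo (2 * ε) (1 - 2 * ε)
    · have hz : z ∈ Set.Ioo (0:ℝ) 1 := ⟨by linarith [hzc.1], by linarith [hzc.2]⟩
      rw [Set.indicator_of_mem hz, ballKer_of_le hxz, one_mul, one_mul, hlayer, ← hof]
      · simp only [interiorCut, Set.indicator_of_notMem hxc, Set.indicator_of_mem hzc]
        refine ENNReal.ofReal_le_ofReal ?_
        nlinarith [sq_nonneg (f z - 2 * f x)]
      · by_contra! h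
        exact hxc ⟨by linarith [h.1], by linarith [h.2]⟩
    · simp [interiorCut, Set.indicator_of_notMem hxc, Set.indicator_of_notMem hzc]

theorem lintegral_localOsc_le {ε A : ℝ} {f : ℝ → ℝ} (hε : 0 < ε) (hA : 0 ≤ A) (hf : Measurable f)
    (hW : ∫⁻ x in Set.Ioo (0:ℝ) 1, ∫⁻ z in Set.Ioo (0:ℝ) 1,
      ballKer (2 * ε) (x - z) * ENNReal.ofReal ((f z - f x) ^ 2) ≤ ENNReal.ofReal (A * ε))
    (hL : ∫⁻ x in Set.Ioo (0:ℝ) 1, layerSq ε f x ≤ ENNReal.ofReal A) :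
    ∫⁻ x in Set.Ioo (0:ℝ) 1, localOsc ε f x ≤ ENNReal.ofReal (10 * A * ε) := by
  have hb : ∀ x, Measurable fun z => ballKer (2 * ε) (x - z) := fun x =>
    (measurable_ballKer _).comp (by fun_prop)
  have hb2 : Measurable fun q : ℝ × ℝ => ballKer (2 * ε) (q.1 - q.2) :=
    (measurable_ballKer _).comp (by fun_prop)
  have h1 : ∀ x, localOsc ε f x ≤
      2 * (∫⁻ z in Set.Ioo (0:ℝ) 1, ballKer (2 * ε) (x - z) * ENNReal.ofReal ((f z - f x) ^ 2)) +
      2 * ∫⁻ z in Set.Ioo (0:ℝ) 1, ballKer (2 * ε) (x - z) * layerSq ε f x := by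
    intro x
    refine (localOsc_le hε x).trans_eq ?_
    rw [← lintegral_const_mul _ (by have := hb x; fun_prop),
      ← lintegral_const_mul _ ((hb x).mul_const _), ← lintegral_add_left
        (by have := hb x; fun_prop)]
    refine lintegral_congr fun z => ?_
    ring
  have hm : Measurable fun x => ∫⁻ z in Set.Ioo (0:ℝ) 1,
      ballKer (2 * ε) (x - z) * ENNReal.ofReal ((f z - f x) ^ 2) :=
    Measurable.lintegral_prod_right' (f := fun q : ℝ × ℝ => ballKer (2 * ε) (q.1 - q.2) *
      ENNReal.ofReal ((f q.2 - f q.1) ^ 2)) (by fun_prop)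
  have hfin : ∫⁻ u, ballKer (2 * ε) u ≠ ∞ := by
    rw [lintegral_ballKer]; exact ENNReal.ofReal_ne_top
  calc _ ≤ ∫⁻ x in Set.Ioo (0:ℝ) 1, _ := lintegral_mono h1
    _ = 2 * (∫⁻ x in Set.Ioo (0:ℝ) 1, ∫⁻ z in Set.Ioo (0:ℝ) 1,
        ballKer (2 * ε) (x - z) * ENNReal.ofReal ((f z - f x) ^ 2)) +
        2 * ∫⁻ x in Set.Ioo (0:ℝ) 1, ∫⁻ z in Set.Ioo (0:ℝ) 1,
          ballKer (2 * ε) (x - z) * layerSq ε f x := by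
      rw [lintegral_add_left (hm.const_mul 2), lintegral_const_mul' _ _ (by simp),
        lintegral_const_mul' _ _ (by simp)]
    _ ≤ ENNReal.ofReal 2 * ENNReal.ofReal (A * ε) +
        ENNReal.ofReal 2 * (ENNReal.ofReal (2 * (2 * ε)) * ENNReal.ofReal A) := by
      rw [ENNReal.ofReal_ofNat]
      gcongr
      refine (lintegral_lintegral_ker_mul_left_le (measurable_ballKer _) hfin _ _).trans ?_
      rw [lintegral_ballKer]
      gcongr
    _ = _ := by
      rw [← ENNReal.ofReal_mul (by positivity), ← ENNReal.ofReal_mul (by positivity),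
        ← ENNReal.ofReal_mul (by positivity), ← ENNReal.ofReal_add (by positivity) (by positivity)]
      congr 1
      ring

/-- The regularization error in `L²(0,1)`. -/
theorem lintegral_sub_regularize_sq_le {ε A : ℝ} {f : ℝ → ℝ} (hε : 0 < ε) (hA : 0 ≤ A)
    (hf : Measurable f) (hfi : IntegrableOn f (Set.Ioo 0 1))
    (hW : ∫⁻ x in Set.Ioo (0:ℝ) 1, ∫⁻ z in Set.Ioo (0:ℝ) 1,
      ballKer (2 * ε) (x - z) * ENNReal.ofReal ((f z - f x) ^ 2) ≤ ENNReal.ofReal (A * ε))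
    (hL : ∫⁻ x in Set.Ioo (0:ℝ) 1, layerSq ε f x ≤ ENNReal.ofReal A) :
    ∫⁻ x in Set.Ioo (0:ℝ) 1, ENNReal.ofReal ((f x - regularize ε f x) ^ 2) ≤
      ENNReal.ofReal (82 * A) := by
  have h1 : ∀ x, ENNReal.ofReal ((f x - regularize ε f x) ^ 2) ≤
      ENNReal.ofReal 2 * layerSq ε f x +
        ENNReal.ofReal 2 * (ENNReal.ofReal (4 / ε) * localOsc ε f x) := by
    intro x
    calc _ ≤ ENNReal.ofReal (2 * (f x - interiorCut ε f x) ^ 2 +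
          2 * (regularize ε f x - interiorCut ε f x) ^ 2) := by
          refine ENNReal.ofReal_le_ofReal ?_
          nlinarith [sq_nonneg (f x - interiorCut ε f x +
            (regularize ε f x - interiorCut ε f x))]
      _ = ENNReal.ofReal 2 * ENNReal.ofReal ((f x - interiorCut ε f x) ^ 2) +
          ENNReal.ofReal 2 * ENNReal.ofReal ((regularize ε f x - interiorCut ε f x) ^ 2) := by
          rw [ENNReal.ofReal_add (by positivity) (by positivity),
            ENNReal.ofReal_mul (by norm_num), ENNReal.ofReal_mul (by norm_num)]
      _ ≤ _ := by
          gcongr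
          · by_cases hx : x ∈ Set.Ioo (2 * ε) (1 - 2 * ε)
            · simp [interiorCut, Set.indicator_of_mem hx]
            · have : x ≤ 4 * ε ∨ 1 - 4 * ε ≤ x := by
                by_contra! h
                exact hx ⟨by linarith [h.1], by linarith [h.2]⟩
              rw [layerSq, Set.indicator_of_mem (show x ∈ {x | x ≤ 4 * ε ∨ 1 - 4 * ε ≤ x} from this)]
              simp [interiorCut, Set.indicator_of_notMem hx]
          · exact regularize_sub_interiorCut_sq_le hε hf hfi x
  calc _ ≤ ∫⁻ x in Set.Ioo (0:ℝ) 1, _ := lintegral_mono h1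
    _ = ENNReal.ofReal 2 * (∫⁻ x in Set.Ioo (0:ℝ) 1, layerSq ε f x) + ENNReal.ofReal 2 *
        (ENNReal.ofReal (4 / ε) * ∫⁻ x in Set.Ioo (0:ℝ) 1, localOsc ε f x) := by
      rw [lintegral_add_left ((measurable_layerSq hf).const_mul _),
        lintegral_const_mul' _ _ ENNReal.ofReal_ne_top,
        lintegral_const_mul' _ _ ENNReal.ofReal_ne_top,
        lintegral_const_mul' _ _ ENNReal.ofReal_ne_top]
    _ ≤ ENNReal.ofReal 2 * ENNReal.ofReal A + ENNReal.ofReal 2 *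
        (ENNReal.ofReal (4 / ε) * ENNReal.ofReal (10 * A * ε)) := by
      gcongr
      exact lintegral_localOsc_le hε hA hf hW hL
    _ = _ := by
      rw [← ENNReal.ofReal_mul (by positivity), ← ENNReal.ofReal_mul (by positivity),
        ← ENNReal.ofReal_mul (by positivity), ← ENNReal.ofReal_add (by positivity) (by positivity)]
      congr 1
      field_simp
      ring

end Regularization

section EnergyRegularize

open scoped ENNReal

/-- The squared `H^t_0(0,1)` norm with values in `[0, ∞]`. -/
noncomputable def energy (t : ℝ) (f : ℝ → ℝ) : ℝ≥0∞ :=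
  (∫⁻ x in Set.Ioo (0:ℝ) 1, ∫⁻ y in Set.Ioo (0:ℝ) 1,
      ENNReal.ofReal ((f x - f y) ^ 2 / |x - y| ^ (2 * t + 1))) +
    (∫⁻ x in Set.Ioo (0:ℝ) 1, ENNReal.ofReal (f x ^ 2 / x ^ (2 * t))) +
    ∫⁻ x in Set.Ioo (0:ℝ) 1, ENNReal.ofReal (f x ^ 2 / (1 - x) ^ (2 * t))

theorem ofReal_regularize_gagliardo_le {ε s : ℝ} {f : ℝ → ℝ} (hε : 0 < ε) (hs : 0 < s)
    (hf : Measurable f) (hfi : IntegrableOn f (Set.Ioo 0 1)) (x y : ℝ) :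
    ENNReal.ofReal ((regularize ε f x - regularize ε f y) ^ 2 / |x - y| ^ (2 * s + 1)) ≤
      ENNReal.ofReal 3 * (farKer (-(2 * s + 1)) ε (x - y) * ENNReal.ofReal ((f x - f y) ^ 2)) +
      (ENNReal.ofReal 3 * (farKer (-(2 * s + 1)) ε (x - y) *
        ENNReal.ofReal ((f x - regularize ε f x) ^ 2)) +
      (ENNReal.ofReal 3 * (farKer (-(2 * s + 1)) ε (x - y) *
        ENNReal.ofReal ((f y - regularize ε f y) ^ 2)) +
      ENNReal.ofReal (4 / ε ^ 3) * (nearKer (1 - 2 * s) ε (x - y) * localOsc ε f x))) := by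
  rcases lt_or_ge ε |x - y| with h | h
  · have h0 : 0 < |x - y| := hε.trans h
    rw [farKer_of_lt h, ← add_assoc, ← add_assoc]
    refine le_trans ?_ le_self_add
    rw [← ENNReal.ofReal_mul (by positivity), ← ENNReal.ofReal_mul (by positivity),
      ← ENNReal.ofReal_mul (by positivity), ← ENNReal.ofReal_mul (by positivity),
      ← ENNReal.ofReal_mul (by positivity), ← ENNReal.ofReal_mul (by positivity),
      ← ENNReal.ofReal_add (by positivity) (by positivity),
      ← ENNReal.ofReal_add (by positivity) (by positivity)]
    refine ENNReal.ofReal_le_ofReal ?_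
    rw [Real.rpow_neg h0.le, div_eq_mul_inv]
    set K := (|x - y| ^ (2 * s + 1))⁻¹
    have hK : 0 ≤ K := by positivity
    have : (regularize ε f x - regularize ε f y) ^ 2 ≤ 3 * (f x - f y) ^ 2 +
        3 * (f x - regularize ε f x) ^ 2 + 3 * (f y - regularize ε f y) ^ 2 := by
      set a := f x - f y with ha
      set b := f x - regularize ε f x with hb
      set c := f y - regularize ε f y with hc
      have : regularize ε f x - regularize ε f y = a - b + c := by rw [ha, hb, hc]; ring
      rw [this]
      nlinarith [sq_nonneg (a + b), sq_nonneg (a - c), sq_nonneg (b + c)]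
    nlinarith [mul_le_mul_of_nonneg_right this hK]
  · rcases (abs_nonneg (x - y)).eq_or_lt with h0 | h0
    · rw [← h0, Real.zero_rpow (by linarith)]
      simp
    · refine le_trans ?_ (le_add_left (le_add_left le_add_self))
      rw [nearKer_of_le h0 h, div_eq_mul_inv, ENNReal.ofReal_mul (by positivity)]
      calc _ ≤ ENNReal.ofReal (4 / ε ^ 3 * |x - y| ^ 2) * localOsc ε f x *
            ENNReal.ofReal (|x - y| ^ (2 * s + 1))⁻¹ := by
            gcongr
            exact regularize_sub_regularize_sq_le hε hf hfi h
        _ = ENNReal.ofReal (4 / ε ^ 3 * |x - y| ^ 2) * ENNReal.ofReal (|x - y| ^ (2 * s + 1))⁻¹ *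
            localOsc ε f x := by ring
        _ = ENNReal.ofReal (4 / ε ^ 3) * ENNReal.ofReal (|x - y| ^ (1 - 2 * s)) *
            localOsc ε f x := by
            rw [← ENNReal.ofReal_mul (by positivity), ← ENNReal.ofReal_mul (by positivity)]
            congr 2
            rw [show 1 - 2 * s = 2 - (2 * s + 1) by ring, Real.rpow_sub h0, Real.rpow_two]
            ring
        _ ≤ _ := by rw [mul_assoc]

theorem lintegral_lintegral_add_left {F G : ℝ → ℝ → ℝ≥0∞} (S : Set ℝ)
    (hF : Measurable (Function.uncurry F)) :
    ∫⁻ x in S, ∫⁻ y in S, (F x y + G x y) =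
      (∫⁻ x in S, ∫⁻ y in S, F x y) + ∫⁻ x in S, ∫⁻ y in S, G x y := by
  have hF' : Measurable fun x => ∫⁻ y in S, F x y :=
    hF.lintegral_prod_right' (ν := volume.restrict S)
  rw [← lintegral_add_left hF']
  exact lintegral_congr fun x => lintegral_add_left (hF.comp measurable_prodMk_left) _

theorem lintegral_lintegral_const_mul {F : ℝ → ℝ → ℝ≥0∞} (S : Set ℝ) {c : ℝ≥0∞} (hc : c ≠ ∞) :
    ∫⁻ x in S, ∫⁻ y in S, c * F x y = c * ∫⁻ x in S, ∫⁻ y in S, F x y := by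
  simp only [lintegral_const_mul' _ _ hc]

theorem gagliardo_regularize_le {ε s A : ℝ} {f : ℝ → ℝ} (hε : 0 < ε) (hs : 0 < s) (hs1 : s < 1)
    (hA : 0 ≤ A) (hf : Measurable f) (hfi : IntegrableOn f (Set.Ioo 0 1))
    (hW : ∫⁻ x in Set.Ioo (0:ℝ) 1, ∫⁻ z in Set.Ioo (0:ℝ) 1,
      ballKer (2 * ε) (x - z) * ENNReal.ofReal ((f z - f x) ^ 2) ≤ ENNReal.ofReal (A * ε))
    (hL : ∫⁻ x in Set.Ioo (0:ℝ) 1, layerSq ε f x ≤ ENNReal.ofReal A)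
    (hF : ∫⁻ x in Set.Ioo (0:ℝ) 1, ∫⁻ y in Set.Ioo (0:ℝ) 1,
      farKer (-(2 * s + 1)) ε (x - y) * ENNReal.ofReal ((f x - f y) ^ 2) ≤
        ENNReal.ofReal (A * ε ^ (-(2 * s)))) :
    ∫⁻ x in Set.Ioo (0:ℝ) 1, ∫⁻ y in Set.Ioo (0:ℝ) 1,
      ENNReal.ofReal ((regularize ε f x - regularize ε f y) ^ 2 / |x - y| ^ (2 * s + 1)) ≤
      ENNReal.ofReal ((3 + 492 / s + 40 / (1 - s)) * (A * ε ^ (-(2 * s)))) := by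
  have hr := measurable_regularize (ε := ε) hf
  have hk : Measurable fun q : ℝ × ℝ => farKer (-(2 * s + 1)) ε (q.1 - q.2) :=
    (measurable_farKer _ _).comp (by fun_prop)
  have hapx := lintegral_sub_regularize_sq_le hε hA hf hfi hW hL
  have hfar : ∫⁻ u, farKer (-(2 * s + 1)) ε u ≤ ENNReal.ofReal (1 / s * ε ^ (-(2 * s))) := by
    refine (lintegral_farKer_le (by linarith) hε).trans_eq ?_
    congr 2
    · field_simp; ring
    · congr 1; ring
  have hnear : ∫⁻ u, nearKer (1 - 2 * s) ε u ≤
      ENNReal.ofReal (1 / (1 - s) * ε ^ (2 - 2 * s)) := by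
    refine (lintegral_nearKer_le (by linarith) hε).trans_eq ?_
    have : 1 - s ≠ 0 := by linarith
    rw [show 1 - 2 * s + 1 = 2 - 2 * s by ring]
    congr 2
    rw [show 2 - 2 * s = 2 * (1 - s) by ring]
    field_simp
  calc _ ≤ ∫⁻ x in Set.Ioo (0:ℝ) 1, ∫⁻ y in Set.Ioo (0:ℝ) 1, _ :=
        lintegral_mono fun x => lintegral_mono fun y =>
          ofReal_regularize_gagliardo_le hε hs hf hfi x y
    _ ≤ ENNReal.ofReal 3 * ENNReal.ofReal (A * ε ^ (-(2 * s))) +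
        (ENNReal.ofReal 3 * (ENNReal.ofReal (1 / s * ε ^ (-(2 * s))) * ENNReal.ofReal (82 * A)) +
        (ENNReal.ofReal 3 * (ENNReal.ofReal (1 / s * ε ^ (-(2 * s))) * ENNReal.ofReal (82 * A)) +
        ENNReal.ofReal (4 / ε ^ 3) * (ENNReal.ofReal (1 / (1 - s) * ε ^ (2 - 2 * s)) *
          ENNReal.ofReal (10 * A * ε)))) := by
      rw [lintegral_lintegral_add_left _ (by unfold Function.uncurry; fun_prop),
        lintegral_lintegral_add_left _ (by unfold Function.uncurry; fun_prop),
        lintegral_lintegral_add_left _ (by unfold Function.uncurry; fun_prop),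
        lintegral_lintegral_const_mul _ ENNReal.ofReal_ne_top,
        lintegral_lintegral_const_mul _ ENNReal.ofReal_ne_top,
        lintegral_lintegral_const_mul _ ENNReal.ofReal_ne_top,
        lintegral_lintegral_const_mul _ ENNReal.ofReal_ne_top]
      gcongr
      · exact (lintegral_lintegral_ker_mul_left_le (measurable_farKer _ _)
          (ne_top_of_le_ne_top ENNReal.ofReal_ne_top hfar) _ _).trans (mul_le_mul' hfar hapx)
      · exact (lintegral_lintegral_ker_mul_right_le (measurable_farKer _ _)
          (h := fun y => ENNReal.ofReal ((f y - regularize ε f y) ^ 2)) (by fun_prop)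
          _ _).trans (mul_le_mul' hfar hapx)
      · exact (lintegral_lintegral_ker_mul_left_le (measurable_nearKer _ _)
          (ne_top_of_le_ne_top ENNReal.ofReal_ne_top hnear) _ _).trans
          (mul_le_mul' hnear (lintegral_localOsc_le hε hA hf hW hL))
    _ = _ := by
      have h1 : 0 < 1 - s := by linarith
      rw [← ENNReal.ofReal_mul (by positivity), ← ENNReal.ofReal_mul (by positivity),
        ← ENNReal.ofReal_mul (by positivity), ← ENNReal.ofReal_mul (by positivity),
        ← ENNReal.ofReal_mul (by positivity),
        ← ENNReal.ofReal_add (by positivity) (by positivity),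
        ← ENNReal.ofReal_add (by positivity) (by positivity),
        ← ENNReal.ofReal_add (by positivity) (by positivity)]
      congr 1
      have h2 : ε ^ (2 - 2 * s) = ε ^ 2 * ε ^ (-(2 * s)) := by
        rw [sub_eq_add_neg, Real.rpow_add hε, Real.rpow_two]
      rw [h2]
      field_simp
      ring

theorem hardy_regularize_le {ε s A : ℝ} {f w : ℝ → ℝ} (hε : 0 < ε) (hs : 0 < s)
    (hA : 0 ≤ A) (hf : Measurable f) (hw : Measurable w)
    (hwr : ∀ x, w x ≤ ε → regularize ε f x = 0)
    (hapx : ∫⁻ x in Set.Ioo (0:ℝ) 1, ENNReal.ofReal ((f x - regularize ε f x) ^ 2) ≤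
      ENNReal.ofReal (82 * A))
    (hH : ∫⁻ x in Set.Ioo (0:ℝ) 1, {x | ε < w x}.indicator
      (fun x => ENNReal.ofReal (f x ^ 2 / w x ^ (2 * s))) x ≤ ENNReal.ofReal (A * ε ^ (-(2 * s)))) :
    ∫⁻ x in Set.Ioo (0:ℝ) 1, ENNReal.ofReal (regularize ε f x ^ 2 / w x ^ (2 * s)) ≤
      ENNReal.ofReal (166 * (A * ε ^ (-(2 * s)))) := by
  have hm : MeasurableSet {x | ε < w x} := measurableSet_lt measurable_const hw
  calc _ ≤ ∫⁻ x in Set.Ioo (0:ℝ) 1, (ENNReal.ofReal 2 * {x | ε < w x}.indicator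
        (fun x => ENNReal.ofReal (f x ^ 2 / w x ^ (2 * s))) x + ENNReal.ofReal (2 * ε ^ (-(2 * s))) *
          ENNReal.ofReal ((f x - regularize ε f x) ^ 2)) := by
        refine lintegral_mono fun x => ?_
        rcases le_or_gt (w x) ε with h | h
        · simp [hwr x h]
        · have hwx : 0 < w x := hε.trans h
          rw [Set.indicator_of_mem (show x ∈ {x | ε < w x} from h),
            ← ENNReal.ofReal_mul (by positivity), ← ENNReal.ofReal_mul (by positivity),
            ← ENNReal.ofReal_add (by positivity) (by positivity)]
          refine ENNReal.ofReal_le_ofReal ?_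
          have h1 : (w x ^ (2 * s))⁻¹ ≤ ε ^ (-(2 * s)) := by
            rw [Real.rpow_neg hε.le]
            exact inv_anti₀ (by positivity) (Real.rpow_le_rpow hε.le h.le (by positivity))
          have h2 : regularize ε f x ^ 2 ≤ 2 * f x ^ 2 + 2 * (f x - regularize ε f x) ^ 2 := by
            nlinarith [sq_nonneg (f x + (f x - regularize ε f x))]
          rw [div_eq_mul_inv, div_eq_mul_inv]
          set K := (w x ^ (2 * s))⁻¹
          have hK : 0 ≤ K := by positivity
          calc _ ≤ (2 * f x ^ 2 + 2 * (f x - regularize ε f x) ^ 2) * K := by gcongr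
            _ = 2 * (f x ^ 2 * K) + 2 * K * (f x - regularize ε f x) ^ 2 := by ring
            _ ≤ _ := by gcongr
    _ ≤ ENNReal.ofReal 2 * ENNReal.ofReal (A * ε ^ (-(2 * s))) +
        ENNReal.ofReal (2 * ε ^ (-(2 * s))) * ENNReal.ofReal (82 * A) := by
      rw [lintegral_add_left ((Measurable.indicator (by fun_prop) hm).const_mul _),
        lintegral_const_mul' _ _ ENNReal.ofReal_ne_top,
        lintegral_const_mul' _ _ ENNReal.ofReal_ne_top]
      gcongr
    _ = _ := by
      rw [← ENNReal.ofReal_mul (by positivity), ← ENNReal.ofReal_mul (by positivity),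
        ← ENNReal.ofReal_add (by positivity) (by positivity)]
      congr 1
      ring

theorem energy_regularize_le {ε s A : ℝ} {f : ℝ → ℝ} (hε : 0 < ε) (hs : 0 < s) (hs1 : s < 1)
    (hA : 0 ≤ A) (hf : Measurable f) (hfi : IntegrableOn f (Set.Ioo 0 1))
    (hW : ∫⁻ x in Set.Ioo (0:ℝ) 1, ∫⁻ z in Set.Ioo (0:ℝ) 1,
      ballKer (2 * ε) (x - z) * ENNReal.ofReal ((f z - f x) ^ 2) ≤ ENNReal.ofReal (A * ε))
    (hL : ∫⁻ x in Set.Ioo (0:ℝ) 1, layerSq ε f x ≤ ENNReal.ofReal A)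
    (hF : ∫⁻ x in Set.Ioo (0:ℝ) 1, ∫⁻ y in Set.Ioo (0:ℝ) 1,
      farKer (-(2 * s + 1)) ε (x - y) * ENNReal.ofReal ((f x - f y) ^ 2) ≤
        ENNReal.ofReal (A * ε ^ (-(2 * s))))
    (hH0 : ∫⁻ x in Set.Ioo (0:ℝ) 1, {x | ε < x}.indicator
      (fun x => ENNReal.ofReal (f x ^ 2 / x ^ (2 * s))) x ≤ ENNReal.ofReal (A * ε ^ (-(2 * s))))
    (hH1 : ∫⁻ x in Set.Ioo (0:ℝ) 1, {x | ε < 1 - x}.indicator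
      (fun x => ENNReal.ofReal (f x ^ 2 / (1 - x) ^ (2 * s))) x ≤
        ENNReal.ofReal (A * ε ^ (-(2 * s)))) :
    energy s (regularize ε f) ≤
      ENNReal.ofReal ((335 + 492 / s + 40 / (1 - s)) * (A * ε ^ (-(2 * s)))) := by
  have hapx := lintegral_sub_regularize_sq_le hε hA hf hfi hW hL
  have h1 := gagliardo_regularize_le hε hs hs1 hA hf hfi hW hL hF
  have h2 := hardy_regularize_le (w := fun x => x) hε hs hA hf measurable_id
    (fun x hx => regularize_eq_zero hε (Or.inl hx)) hapx hH0
  have h3 := hardy_regularize_le (w := fun x => 1 - x) hε hs hA hf (by fun_prop)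
    (fun x hx => regularize_eq_zero hε (Or.inr (by linarith))) hapx hH1
  have h4 : 0 < 1 - s := by linarith
  refine (add_le_add (add_le_add h1 h2) h3).trans_eq ?_
  rw [← ENNReal.ofReal_add (by positivity) (by positivity),
    ← ENNReal.ofReal_add (by positivity) (by positivity)]
  congr 1
  ring

end EnergyRegularize

section EnergyConversion

open scoped ENNReal

theorem measurable_gagliardo (t : ℝ) {f : ℝ → ℝ} (hf : Measurable f) :
    Measurable fun q : ℝ × ℝ => (f q.1 - f q.2) ^ 2 / |q.1 - q.2| ^ (2 * t + 1) := by
  have h : Measurable fun q : ℝ × ℝ => |q.1 - q.2| :=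
    continuous_abs.measurable.comp (by fun_prop)
  fun_prop

theorem lintegral_gagliardo_eq_prod (t : ℝ) {f : ℝ → ℝ} (hf : Measurable f) :
    ∫⁻ x in Set.Ioo (0:ℝ) 1, ∫⁻ y in Set.Ioo (0:ℝ) 1,
      ENNReal.ofReal ((f x - f y) ^ 2 / |x - y| ^ (2 * t + 1)) =
    ∫⁻ q in Set.Ioo (0:ℝ) 1 ×ˢ Set.Ioo (0:ℝ) 1,
      ENNReal.ofReal ((f q.1 - f q.2) ^ 2 / |q.1 - q.2| ^ (2 * t + 1)) ∂(volume.prod volume) := by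
  rw [← Measure.prod_restrict,
    lintegral_prod _ (measurable_gagliardo t hf).ennreal_ofReal.aemeasurable]

theorem lintegral_gagliardo_eq {t : ℝ} {f : ℝ → ℝ} (hf : Measurable f)
    (h : gagliardoFinite t f) :
    ∫⁻ x in Set.Ioo (0:ℝ) 1, ∫⁻ y in Set.Ioo (0:ℝ) 1,
      ENNReal.ofReal ((f x - f y) ^ 2 / |x - y| ^ (2 * t + 1)) =
    ENNReal.ofReal (gagliardoSq t f) := by
  rw [lintegral_gagliardo_eq_prod t hf, gagliardoSq, ← ofReal_integral_eq_lintegral_ofReal h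
    (Filter.Eventually.of_forall fun q => by positivity)]
  congr 1
  exact setIntegral_prod _ h

theorem hardy_nonneg (t : ℝ) (f : ℝ → ℝ) :
    ∀ᵐ x ∂volume.restrict (Set.Ioo (0:ℝ) 1), 0 ≤ f x ^ 2 / x ^ (2 * t) :=
  (ae_restrict_iff' measurableSet_Ioo).2 (Filter.Eventually.of_forall fun _ hx =>
    div_nonneg (sq_nonneg _) (Real.rpow_nonneg hx.1.le _))

theorem hardy_one_sub_nonneg (t : ℝ) (f : ℝ → ℝ) :
    ∀ᵐ x ∂volume.restrict (Set.Ioo (0:ℝ) 1), 0 ≤ f x ^ 2 / (1 - x) ^ (2 * t) :=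
  (ae_restrict_iff' measurableSet_Ioo).2 (Filter.Eventually.of_forall fun _ hx =>
    div_nonneg (sq_nonneg _) (Real.rpow_nonneg (sub_nonneg.2 hx.2.le) _))

theorem Ht0NormSq_nonneg (t : ℝ) (f : ℝ → ℝ) : 0 ≤ Ht0NormSq t f :=
  add_nonneg (add_nonneg (integral_nonneg fun _ => integral_nonneg fun _ => by positivity)
    (integral_nonneg_of_ae (hardy_nonneg t f))) (integral_nonneg_of_ae (hardy_one_sub_nonneg t f))

theorem energy_eq {t : ℝ} {f : ℝ → ℝ} (hf : Measurable f) (h : Ht0Finite t f) :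
    energy t f = ENNReal.ofReal (Ht0NormSq t f) := by
  have h1 : 0 ≤ gagliardoSq t f := integral_nonneg fun _ => integral_nonneg fun _ => by positivity
  have h2 := integral_nonneg_of_ae (hardy_nonneg t f)
  have h3 := integral_nonneg_of_ae (hardy_one_sub_nonneg t f)
  rw [energy, lintegral_gagliardo_eq hf h.1,
    ← ofReal_integral_eq_lintegral_ofReal h.2.1 (hardy_nonneg t f),
    ← ofReal_integral_eq_lintegral_ofReal h.2.2 (hardy_one_sub_nonneg t f),
    ← ENNReal.ofReal_add h1 h2, ← ENNReal.ofReal_add (by positivity) h3]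
  rfl

theorem Ht0Finite_of_energy_ne_top {t : ℝ} {f : ℝ → ℝ} (hf : Measurable f)
    (h : energy t f ≠ ∞) : Ht0Finite t f := by
  rw [energy, ENNReal.add_ne_top, ENNReal.add_ne_top, lintegral_gagliardo_eq_prod t hf] at h
  obtain ⟨⟨h1, h2⟩, h3⟩ := h
  exact ⟨(lintegral_ofReal_ne_top_iff_integrable
      (measurable_gagliardo t hf).aestronglyMeasurable
      (Filter.Eventually.of_forall fun q => by positivity)).1 h1,
    (lintegral_ofReal_ne_top_iff_integrable
      (by fun_prop : Measurable fun x => f x ^ 2 / x ^ (2 * t)).aestronglyMeasurable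
      (hardy_nonneg t f)).1 h2,
    (lintegral_ofReal_ne_top_iff_integrable
      (by fun_prop : Measurable fun x => f x ^ 2 / (1 - x) ^ (2 * t)).aestronglyMeasurable
      (hardy_one_sub_nonneg t f)).1 h3⟩

theorem Ht0Finite_and_le_of_energy_le {t B : ℝ} {f : ℝ → ℝ} (hf : Measurable f) (hB : 0 ≤ B)
    (h : energy t f ≤ ENNReal.ofReal B) : Ht0Finite t f ∧ Ht0NormSq t f ≤ B := by
  have hfin := Ht0Finite_of_energy_ne_top hf (ne_top_of_le_ne_top ENNReal.ofReal_ne_top h)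
  rw [energy_eq hf hfin] at h
  exact ⟨hfin, (ENNReal.ofReal_le_ofReal_iff hB).1 h⟩

end EnergyConversion

section EnergyBounds

open scoped ENNReal

variable {ε r s : ℝ} {f : ℝ → ℝ}

theorem lintegral_ballKer_le_energy (hε : 0 < ε) (hr : 0 < r) (hr1 : r < 1) :
    ∫⁻ x in Set.Ioo (0:ℝ) 1, ∫⁻ z in Set.Ioo (0:ℝ) 1,
      ballKer (2 * ε) (x - z) * ENNReal.ofReal ((f z - f x) ^ 2) ≤
    ENNReal.ofReal (8 * ε ^ (2 * r) * ε) * energy r f := by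
  have hpow : (2 * ε) ^ (2 * r + 1) ≤ 8 * ε ^ (2 * r) * ε := by
    rw [Real.mul_rpow zero_le_two hε.le, Real.rpow_add_one hε.ne', mul_assoc]
    have : (2:ℝ) ^ (2 * r + 1) ≤ 2 ^ (3:ℝ) :=
      Real.rpow_le_rpow_of_exponent_le one_le_two (by linarith)
    have h8 : (2:ℝ) ^ (3:ℝ) = 8 := by norm_num
    rw [h8] at this
    gcongr
  calc _ ≤ ∫⁻ x in Set.Ioo (0:ℝ) 1, ∫⁻ y in Set.Ioo (0:ℝ) 1,
        ENNReal.ofReal (8 * ε ^ (2 * r) * ε) *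
          ENNReal.ofReal ((f x - f y) ^ 2 / |x - y| ^ (2 * r + 1)) := by
        refine lintegral_mono fun x => lintegral_mono fun z => ?_
        by_cases h : |x - z| ≤ 2 * ε
        · rw [ballKer_of_le h, one_mul, ← ENNReal.ofReal_mul (by positivity)]
          refine ENNReal.ofReal_le_ofReal ?_
          rcases (abs_nonneg (x - z)).eq_or_lt with h0 | h0
          · have : x = z := sub_eq_zero.1 (abs_eq_zero.1 h0.symm)
            subst this
            rw [sub_self, zero_pow two_ne_zero]
            positivity
          · have h1 : |x - z| ^ (2 * r + 1) ≤ 8 * ε ^ (2 * r) * ε :=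
              (Real.rpow_le_rpow h0.le h (by positivity)).trans hpow
            have h2 : 0 < |x - z| ^ (2 * r + 1) := by positivity
            calc (f z - f x) ^ 2 =
                |x - z| ^ (2 * r + 1) * ((f x - f z) ^ 2 / |x - z| ^ (2 * r + 1)) := by
                  field_simp
                  ring
              _ ≤ _ := by gcongr
        · have : ballKer (2 * ε) (x - z) = 0 :=
            Set.indicator_of_notMem (s := {u : ℝ | |u| ≤ 2 * ε}) h _
          simp [this]
    _ ≤ _ := by
      rw [lintegral_lintegral_const_mul _ ENNReal.ofReal_ne_top]
      gcongr
      rw [energy, add_assoc]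
      exact le_self_add

theorem lintegral_farKer_le_energy (hε : 0 < ε) (hrs : r ≤ s) :
    ∫⁻ x in Set.Ioo (0:ℝ) 1, ∫⁻ y in Set.Ioo (0:ℝ) 1,
      farKer (-(2 * s + 1)) ε (x - y) * ENNReal.ofReal ((f x - f y) ^ 2) ≤
    ENNReal.ofReal (ε ^ (2 * r) * ε ^ (-(2 * s))) * energy r f := by
  calc _ ≤ ∫⁻ x in Set.Ioo (0:ℝ) 1, ∫⁻ y in Set.Ioo (0:ℝ) 1,
        ENNReal.ofReal (ε ^ (2 * r) * ε ^ (-(2 * s))) *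
          ENNReal.ofReal ((f x - f y) ^ 2 / |x - y| ^ (2 * r + 1)) := by
        refine lintegral_mono fun x => lintegral_mono fun z => ?_
        by_cases h : ε < |x - z|
        · have h0 : 0 < |x - z| := hε.trans h
          rw [farKer_of_lt h, ← ENNReal.ofReal_mul (by positivity),
            ← ENNReal.ofReal_mul (by positivity)]
          refine ENNReal.ofReal_le_ofReal ?_
          have h1 : |x - z| ^ (2 * r - 2 * s) ≤ ε ^ (2 * r - 2 * s) :=
            Real.rpow_le_rpow_of_nonpos hε h.le (by linarith)
          rw [← Real.rpow_add hε, ← sub_eq_add_neg]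
          calc _ = |x - z| ^ (2 * r - 2 * s) * ((f x - f z) ^ 2 / |x - z| ^ (2 * r + 1)) := by
                rw [div_eq_mul_inv, ← Real.rpow_neg h0.le, mul_left_comm, ← Real.rpow_add h0,
                  mul_comm]
                congr 2
                ring
            _ ≤ _ := by gcongr
        · have : farKer (-(2 * s + 1)) ε (x - z) = 0 :=
            Set.indicator_of_notMem (s := {u : ℝ | ε < |u|}) h _
          rw [this, zero_mul]
          exact zero_le
    _ ≤ _ := by
      rw [lintegral_lintegral_const_mul _ ENNReal.ofReal_ne_top]
      gcongr
      rw [energy, add_assoc]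
      exact le_self_add

theorem lintegral_hardy_far_le {w : ℝ → ℝ} (hε : 0 < ε) (hrs : r ≤ s) :
    ∫⁻ x in Set.Ioo (0:ℝ) 1, {x | ε < w x}.indicator
      (fun x => ENNReal.ofReal (f x ^ 2 / w x ^ (2 * s))) x ≤
    ENNReal.ofReal (ε ^ (2 * r) * ε ^ (-(2 * s))) *
      ∫⁻ x in Set.Ioo (0:ℝ) 1, ENNReal.ofReal (f x ^ 2 / w x ^ (2 * r)) := by
  rw [← lintegral_const_mul' _ _ ENNReal.ofReal_ne_top]
  refine lintegral_mono fun x => ?_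
  by_cases h : ε < w x
  · have h0 : 0 < w x := hε.trans h
    rw [Set.indicator_of_mem (show x ∈ {x | ε < w x} from h),
      ← ENNReal.ofReal_mul (by positivity)]
    refine ENNReal.ofReal_le_ofReal ?_
    have h1 : w x ^ (2 * r - 2 * s) ≤ ε ^ (2 * r - 2 * s) :=
      Real.rpow_le_rpow_of_nonpos hε h.le (by linarith)
    rw [← Real.rpow_add hε, ← sub_eq_add_neg]
    calc _ = w x ^ (2 * r - 2 * s) * (f x ^ 2 / w x ^ (2 * r)) := by
          rw [Real.rpow_sub h0]
          have : w x ^ (2 * r) ≠ 0 := by positivity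
          field_simp
      _ ≤ _ := by gcongr
  · rw [Set.indicator_of_notMem (show x ∉ {x | ε < w x} from h)]
    exact zero_le

theorem lintegral_layerSq_le_energy (hε : 0 < ε) (hr : 0 < r) (hr1 : r < 1) (hf : Measurable f) :
    ∫⁻ x in Set.Ioo (0:ℝ) 1, layerSq ε f x ≤ ENNReal.ofReal (16 * ε ^ (2 * r)) * energy r f := by
  have hpow : (4 * ε) ^ (2 * r) ≤ 16 * ε ^ (2 * r) := by
    rw [Real.mul_rpow (by norm_num) hε.le]
    have : (4:ℝ) ^ (2 * r) ≤ 4 ^ (2:ℝ) :=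
      Real.rpow_le_rpow_of_exponent_le (by norm_num) (by linarith)
    have h8 : (4:ℝ) ^ (2:ℝ) = 16 := by norm_num
    rw [h8] at this
    gcongr
  have key : ∀ u v : ℝ, 0 < u → u ≤ 4 * ε → ENNReal.ofReal (v ^ 2) ≤
      ENNReal.ofReal (16 * ε ^ (2 * r)) * ENNReal.ofReal (v ^ 2 / u ^ (2 * r)) := by
    intro u v hu h
    rw [← ENNReal.ofReal_mul (by positivity)]
    refine ENNReal.ofReal_le_ofReal ?_
    have h1 : u ^ (2 * r) ≤ 16 * ε ^ (2 * r) :=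
      (Real.rpow_le_rpow hu.le h (by positivity)).trans hpow
    calc v ^ 2 = u ^ (2 * r) * (v ^ 2 / u ^ (2 * r)) := by
          have : u ^ (2 * r) ≠ 0 := by positivity
          field_simp
      _ ≤ _ := by gcongr
  calc _ ≤ ∫⁻ x in Set.Ioo (0:ℝ) 1, (ENNReal.ofReal (16 * ε ^ (2 * r)) *
        ENNReal.ofReal (f x ^ 2 / x ^ (2 * r)) + ENNReal.ofReal (16 * ε ^ (2 * r)) *
        ENNReal.ofReal (f x ^ 2 / (1 - x) ^ (2 * r))) := by
        refine setLIntegral_mono' measurableSet_Ioo fun x hx => ?_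
        by_cases h : x ∈ {x | x ≤ 4 * ε ∨ 1 - 4 * ε ≤ x}
        · rw [layerSq, Set.indicator_of_mem h]
          rcases h with h | h
          · exact (key x (f x) hx.1 h).trans le_self_add
          · exact (key (1 - x) (f x) (sub_pos.2 hx.2) (by linarith)).trans le_add_self
        · rw [layerSq, Set.indicator_of_notMem h]
          exact zero_le
    _ ≤ _ := by
      rw [lintegral_add_left (by fun_prop), lintegral_const_mul' _ _ ENNReal.ofReal_ne_top,
        lintegral_const_mul' _ _ ENNReal.ofReal_ne_top, ← mul_add]
      gcongr
      rw [energy, add_assoc]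
      exact le_add_self

theorem lintegral_sq_le_energy (hr : 0 < r) :
    ∫⁻ x in Set.Ioo (0:ℝ) 1, ENNReal.ofReal (f x ^ 2) ≤ energy r f := by
  refine le_trans ?_ (le_self_add.trans' le_add_self :
    ∫⁻ x in Set.Ioo (0:ℝ) 1, ENNReal.ofReal (f x ^ 2 / x ^ (2 * r)) ≤ energy r f)
  refine setLIntegral_mono' measurableSet_Ioo fun x hx => ENNReal.ofReal_le_ofReal ?_
  exact le_div_self (sq_nonneg _) (Real.rpow_pos_of_pos hx.1 _)
    (Real.rpow_le_one hx.1.le hx.2.le (by positivity))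

theorem regularize_bounds_of_energy_le {M : ℝ} (hε : 0 < ε) (hr : 0 < r) (hrs : r ≤ s)
    (hs : s < 1) (hM : 0 ≤ M) (hf : Measurable f) (hfi : IntegrableOn f (Set.Ioo 0 1))
    (h : energy r f ≤ ENNReal.ofReal M) :
    ∫⁻ x in Set.Ioo (0:ℝ) 1, ENNReal.ofReal ((f x - regularize ε f x) ^ 2) ≤
        ENNReal.ofReal (82 * (16 * ε ^ (2 * r) * M)) ∧
      energy s (regularize ε f) ≤ ENNReal.ofReal
        ((335 + 492 / s + 40 / (1 - s)) * (16 * ε ^ (2 * r) * M * ε ^ (-(2 * s)))) := by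
  have hA : 0 ≤ 16 * ε ^ (2 * r) * M := by positivity
  have hW : ∫⁻ x in Set.Ioo (0:ℝ) 1, ∫⁻ z in Set.Ioo (0:ℝ) 1,
      ballKer (2 * ε) (x - z) * ENNReal.ofReal ((f z - f x) ^ 2) ≤
        ENNReal.ofReal (16 * ε ^ (2 * r) * M * ε) := by
    refine (lintegral_ballKer_le_energy hε hr (hrs.trans_lt hs)).trans
      ((mul_le_mul' le_rfl h).trans ?_)
    rw [← ENNReal.ofReal_mul (by positivity)]
    refine ENNReal.ofReal_le_ofReal ?_
    have : 0 ≤ ε ^ (2 * r) * M * ε := by positivity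
    linarith
  have hL : ∫⁻ x in Set.Ioo (0:ℝ) 1, layerSq ε f x ≤ ENNReal.ofReal (16 * ε ^ (2 * r) * M) := by
    refine (lintegral_layerSq_le_energy hε hr (hrs.trans_lt hs) hf).trans
      ((mul_le_mul' le_rfl h).trans_eq ?_)
    rw [← ENNReal.ofReal_mul (by positivity)]
  have hfar : ENNReal.ofReal (ε ^ (2 * r) * ε ^ (-(2 * s))) * energy r f ≤
      ENNReal.ofReal (16 * ε ^ (2 * r) * M * ε ^ (-(2 * s))) := by
    refine (mul_le_mul' le_rfl h).trans ?_
    rw [← ENNReal.ofReal_mul (by positivity)]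
    refine ENNReal.ofReal_le_ofReal ?_
    have : 0 ≤ ε ^ (2 * r) * M * ε ^ (-(2 * s)) := by positivity
    linarith
  refine ⟨lintegral_sub_regularize_sq_le hε hA hf hfi hW hL,
    energy_regularize_le hε (hr.trans_le hrs) hs hA hf hfi hW hL
      ((lintegral_farKer_le_energy hε hrs).trans hfar) ?_ ?_⟩
  · refine (lintegral_hardy_far_le (w := fun x => x) hε hrs).trans
      (le_trans (mul_le_mul' le_rfl ?_) hfar)
    exact le_self_add.trans' le_add_self
  · refine (lintegral_hardy_far_le (w := fun x => 1 - x) hε hrs).trans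
      (le_trans (mul_le_mul' le_rfl ?_) hfar)
    exact le_add_self

end EnergyBounds

section PolynomialBounds

open scoped ENNReal
open Polynomial

theorem lintegral_eval_sq (p : ℝ[X]) :
    ∫⁻ x in Set.Ioo (0:ℝ) 1, ENNReal.ofReal (p.eval x ^ 2) =
      ENNReal.ofReal (∫ x in (0:ℝ)..1, p.eval x ^ 2) := by
  have hi : IntegrableOn (fun x => p.eval x ^ 2) (Set.Ioo (0:ℝ) 1) :=
    ((p.continuous.pow 2).integrableOn_Icc).mono_set Set.Ioo_subset_Icc_self
  rw [intervalIntegral.integral_of_le zero_le_one, integral_Ioc_eq_integral_Ioo,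
    ofReal_integral_eq_lintegral_ofReal hi (Filter.Eventually.of_forall fun _ => sq_nonneg _)]

theorem ofReal_eval_sub_eval_sq_le (p : ℝ[X]) {R x z : ℝ} (hx : x ∈ Set.Ioo (0:ℝ) 1)
    (hz : z ∈ Set.Ioo (0:ℝ) 1) (h : |x - z| ≤ R) :
    ENNReal.ofReal ((p.eval z - p.eval x) ^ 2) ≤ ENNReal.ofReal (2 * R) *
      ∫⁻ t in Set.Ioo (0:ℝ) 1, ballKer R (x - t) * ENNReal.ofReal (p.derivative.eval t ^ 2) := by
  have hsub : Set.uIoc x z ⊆ Set.Ioo 0 1 := fun t ht => by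
    rcases Set.mem_uIoc.1 ht with h | h
    · exact ⟨hx.1.trans h.1, h.2.trans_lt hz.2⟩
    · exact ⟨hz.1.trans h.1, h.2.trans_lt hx.2⟩
  have hftc : ∫ t in x..z, p.derivative.eval t = p.eval z - p.eval x :=
    intervalIntegral.integral_eq_sub_of_hasDerivAt (fun t _ => p.hasDerivAt t)
      (p.derivative.continuous.intervalIntegrable _ _)
  have hsq : (p.eval z - p.eval x) ^ 2 = (∫ t, (Set.uIoc x z).indicator (fun _ => (1:ℝ)) t *
      (Set.Ioo (0:ℝ) 1).indicator (fun t => p.derivative.eval t) t) ^ 2 := by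
    have : ∀ t, (Set.uIoc x z).indicator (fun _ => (1:ℝ)) t *
        (Set.Ioo (0:ℝ) 1).indicator (fun t => p.derivative.eval t) t =
        (Set.uIoc x z).indicator (fun t => p.derivative.eval t) t := fun t => by
      by_cases ht : t ∈ Set.uIoc x z
      · simp [ht, hsub ht]
      · simp [ht]
    simp only [this]
    rw [integral_indicator measurableSet_uIoc, ← hftc, ← sq_abs,
      intervalIntegral.abs_intervalIntegral_eq, sq_abs]
  rw [hsq]
  refine (ofReal_integral_mul_sq_le (x := x) (R := R) (M := 1)
    (p.derivative.continuous.measurable.indicator measurableSet_Ioo) zero_le_one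
    (fun t => ?_) (fun t ht => ?_)).trans_eq ?_
  · by_cases ht : t ∈ Set.uIoc x z <;> simp [ht]
  · refine Set.indicator_of_notMem (fun hm => ht.not_ge (le_trans ?_ h)) _
    rcases Set.mem_uIoc.1 hm with h | h
    · rw [abs_sub_comm x t, abs_sub_comm x z, abs_of_nonneg (by linarith),
        abs_of_nonneg (by linarith)]
      linarith
    · rw [abs_of_nonneg (by linarith), abs_of_nonneg (by linarith)]
      linarith
  · rw [one_pow, one_mul, ← lintegral_indicator measurableSet_Ioo]
    congr 1
    refine lintegral_congr fun t => ?_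
    by_cases ht : t ∈ Set.Ioo (0:ℝ) 1
    · rw [Set.indicator_of_mem ht, Set.indicator_of_mem ht]
    · rw [Set.indicator_of_notMem ht, Set.indicator_of_notMem ht]
      simp

theorem lintegral_ballKer_eval_le (p : ℝ[X]) {R : ℝ} (hR : 0 ≤ R) :
    ∫⁻ x in Set.Ioo (0:ℝ) 1, ∫⁻ z in Set.Ioo (0:ℝ) 1,
      ballKer R (x - z) * ENNReal.ofReal ((p.eval z - p.eval x) ^ 2) ≤
    ENNReal.ofReal (8 * R ^ 3 * ∫ x in (0:ℝ)..1, p.derivative.eval x ^ 2) := by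
  have hR2 : ∫⁻ u, ballKer R u ≠ ∞ := by
    rw [lintegral_ballKer]
    exact ENNReal.ofReal_ne_top
  have hm : Measurable fun t => ENNReal.ofReal (p.derivative.eval t ^ 2) :=
    (p.derivative.continuous.measurable.pow_const 2).ennreal_ofReal
  calc _ ≤ ∫⁻ x in Set.Ioo (0:ℝ) 1, ∫⁻ z in Set.Ioo (0:ℝ) 1,
        ballKer R (x - z) * (ENNReal.ofReal (2 * R) * ∫⁻ t in Set.Ioo (0:ℝ) 1,
          ballKer R (x - t) * ENNReal.ofReal (p.derivative.eval t ^ 2)) := by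
        refine setLIntegral_mono' measurableSet_Ioo fun x hx =>
          setLIntegral_mono' measurableSet_Ioo fun z hz => ?_
        by_cases h : |x - z| ≤ R
        · exact mul_le_mul' le_rfl (ofReal_eval_sub_eval_sq_le p hx hz h)
        · have : ballKer R (x - z) = 0 :=
            Set.indicator_of_notMem (s := {u : ℝ | |u| ≤ R}) h _
          rw [this, zero_mul]
          exact zero_le
    _ ≤ ENNReal.ofReal (2 * R) * (ENNReal.ofReal (2 * R) * (ENNReal.ofReal (2 * R) *
        ENNReal.ofReal (∫ x in (0:ℝ)..1, p.derivative.eval x ^ 2))) := by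
      refine (lintegral_lintegral_ker_mul_left_le (measurable_ballKer R) hR2 _ _).trans ?_
      rw [lintegral_ballKer, lintegral_const_mul' _ _ ENNReal.ofReal_ne_top]
      gcongr
      refine (lintegral_lintegral_ker_mul_right_le (measurable_ballKer R) hm _ _).trans_eq ?_
      rw [lintegral_ballKer, lintegral_eval_sq]
    _ = _ := by
      rw [← ENNReal.ofReal_mul (by positivity), ← ENNReal.ofReal_mul (by positivity),
        ← ENNReal.ofReal_mul (by positivity)]
      congr 1
      ring

theorem lintegral_layerSq_le_of_le {ε B : ℝ} {f : ℝ → ℝ} (hε : 0 < ε)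
    (hB : ∀ x ∈ Set.Ioo (0:ℝ) 1, f x ^ 2 ≤ B) :
    ∫⁻ x in Set.Ioo (0:ℝ) 1, layerSq ε f x ≤ ENNReal.ofReal (8 * ε * B) := by
  have hB0 : 0 ≤ B := (sq_nonneg _).trans (hB (1 / 2) (by norm_num))
  set S : Set ℝ := Set.Icc 0 (4 * ε) ∪ Set.Icc (1 - 4 * ε) 1
  have hS : MeasurableSet S := measurableSet_Icc.union measurableSet_Icc
  calc _ ≤ ∫⁻ x in Set.Ioo (0:ℝ) 1, S.indicator (fun _ => ENNReal.ofReal B) x := by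
        refine setLIntegral_mono' measurableSet_Ioo fun x hx => ?_
        by_cases h : x ∈ {x | x ≤ 4 * ε ∨ 1 - 4 * ε ≤ x}
        · have hxS : x ∈ S := by
            rcases h with h | h
            · exact Or.inl ⟨hx.1.le, h⟩
            · exact Or.inr ⟨h, hx.2.le⟩
          rw [layerSq, Set.indicator_of_mem h, Set.indicator_of_mem hxS]
          exact ENNReal.ofReal_le_ofReal (hB x hx)
        · rw [layerSq, Set.indicator_of_notMem h]
          exact zero_le
    _ ≤ ENNReal.ofReal B * volume S := by
      refine (setLIntegral_le_lintegral _ _).trans_eq ?_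
      rw [lintegral_indicator hS, setLIntegral_const]
    _ ≤ ENNReal.ofReal B * ENNReal.ofReal (8 * ε) := by
      gcongr
      refine (measure_union_le _ _).trans_eq ?_
      rw [Real.volume_Icc, Real.volume_Icc, ← ENNReal.ofReal_add (by linarith) (by linarith)]
      congr 1
      ring
    _ = _ := by rw [← ENNReal.ofReal_mul hB0, mul_comm]

theorem lintegral_farKer_sub_sq_le {ε s D : ℝ} {f : ℝ → ℝ} (hε : 0 < ε) (hs : 0 < s)
    (hf : Measurable f)
    (hD : ∫⁻ x in Set.Ioo (0:ℝ) 1, ENNReal.ofReal (f x ^ 2) ≤ ENNReal.ofReal D) :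
    ∫⁻ x in Set.Ioo (0:ℝ) 1, ∫⁻ y in Set.Ioo (0:ℝ) 1,
      farKer (-(2 * s + 1)) ε (x - y) * ENNReal.ofReal ((f x - f y) ^ 2) ≤
    ENNReal.ofReal (4 / s * D * ε ^ (-(2 * s))) := by
  have hk : Measurable fun q : ℝ × ℝ => farKer (-(2 * s + 1)) ε (q.1 - q.2) :=
    (measurable_farKer _ _).comp (by fun_prop)
  have hfar : ∫⁻ u, farKer (-(2 * s + 1)) ε u ≤ ENNReal.ofReal (1 / s * ε ^ (-(2 * s))) := by
    refine (lintegral_farKer_le (by linarith) hε).trans_eq ?_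
    congr 2
    · field_simp; ring
    · congr 1; ring
  calc _ ≤ ∫⁻ x in Set.Ioo (0:ℝ) 1, ∫⁻ y in Set.Ioo (0:ℝ) 1,
        (ENNReal.ofReal 2 * (farKer (-(2 * s + 1)) ε (x - y) * ENNReal.ofReal (f x ^ 2)) +
          ENNReal.ofReal 2 * (farKer (-(2 * s + 1)) ε (x - y) * ENNReal.ofReal (f y ^ 2))) := by
        refine lintegral_mono fun x => lintegral_mono fun y => ?_
        rw [mul_left_comm, mul_left_comm (ENNReal.ofReal 2), ← mul_add,
          ← ENNReal.ofReal_mul zero_le_two, ← ENNReal.ofReal_mul zero_le_two,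
          ← ENNReal.ofReal_add (by positivity) (by positivity)]
        gcongr
        nlinarith [sq_nonneg (f x + f y)]
    _ ≤ ENNReal.ofReal 2 * (ENNReal.ofReal (1 / s * ε ^ (-(2 * s))) * ENNReal.ofReal D) +
        ENNReal.ofReal 2 * (ENNReal.ofReal (1 / s * ε ^ (-(2 * s))) * ENNReal.ofReal D) := by
      rw [lintegral_lintegral_add_left _ (by unfold Function.uncurry; fun_prop),
        lintegral_lintegral_const_mul _ ENNReal.ofReal_ne_top,
        lintegral_lintegral_const_mul _ ENNReal.ofReal_ne_top]
      gcongr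
      · exact (lintegral_lintegral_ker_mul_left_le (measurable_farKer _ _)
          (ne_top_of_le_ne_top ENNReal.ofReal_ne_top hfar) _ _).trans (mul_le_mul' hfar hD)
      · exact (lintegral_lintegral_ker_mul_right_le (measurable_farKer _ _)
          (h := fun y => ENNReal.ofReal (f y ^ 2)) (by fun_prop) _ _).trans (mul_le_mul' hfar hD)
    _ = _ := by
      rw [← two_mul, ← ENNReal.ofReal_mul (by positivity), ← ENNReal.ofReal_mul (by positivity),
        ← ENNReal.ofReal_ofNat 2, ← ENNReal.ofReal_mul (by norm_num)]
      congr 1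
      ring

theorem lintegral_hardy_far_le_of_sq_le {ε s D : ℝ} {f w : ℝ → ℝ} (hε : 0 < ε) (hs : 0 < s)
    (hD : ∫⁻ x in Set.Ioo (0:ℝ) 1, ENNReal.ofReal (f x ^ 2) ≤ ENNReal.ofReal D) :
    ∫⁻ x in Set.Ioo (0:ℝ) 1, {x | ε < w x}.indicator
      (fun x => ENNReal.ofReal (f x ^ 2 / w x ^ (2 * s))) x ≤
    ENNReal.ofReal (D * ε ^ (-(2 * s))) := by
  have := lintegral_hardy_far_le (f := f) (w := w) (r := 0) hε hs.le
  simp only [mul_zero, Real.rpow_zero, div_one, one_mul] at this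
  refine this.trans ((mul_le_mul' le_rfl hD).trans_eq ?_)
  rw [← ENNReal.ofReal_mul (by positivity), mul_comm]

theorem regularize_eval_bounds {s : ℝ} (hs : 0 < s) (hs1 : s < 1) {k : ℕ} (hk : 1 ≤ k)
    {p : ℝ[X]} (hp : p.natDegree ≤ k) {ε : ℝ} (hε : ε = 1 / 100000 / (k:ℝ) ^ 2) :
    ∫⁻ x in Set.Ioo (0:ℝ) 1, ENNReal.ofReal ((p.eval x - regularize ε (fun x => p.eval x) x) ^ 2) ≤
        ENNReal.ofReal ((∫ x in (0:ℝ)..1, p.eval x ^ 2) / 4) ∧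
      energy s (regularize ε fun x => p.eval x) ≤ ENNReal.ofReal
        ((335 + 492 / s + 40 / (1 - s)) *
          ((1 + 4 / s) * (∫ x in (0:ℝ)..1, p.eval x ^ 2) * ε ^ (-(2 * s)))) := by
  set D := ∫ x in (0:ℝ)..1, p.eval x ^ 2 with hDdef
  have hD : 0 ≤ D := intervalIntegral.integral_nonneg zero_le_one fun _ _ => sq_nonneg _
  have hk1 : (1:ℝ) ≤ k := by exact_mod_cast hk
  have hk0 : (0:ℝ) < k := by linarith
  have hε0 : 0 < ε := by rw [hε]; positivity
  have hεk : ε * (k:ℝ) ^ 2 = 1 / 100000 := by rw [hε]; field_simp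
  have hm : Measurable fun x => p.eval x := p.continuous.measurable
  have hi : IntegrableOn (fun x => p.eval x) (Set.Ioo (0:ℝ) 1) :=
    p.continuous.integrableOn_Icc.mono_set Set.Ioo_subset_Icc_self
  have hsq := (lintegral_eval_sq p).le
  have hW : ∫⁻ x in Set.Ioo (0:ℝ) 1, ∫⁻ z in Set.Ioo (0:ℝ) 1,
      ballKer (2 * ε) (x - z) * ENNReal.ofReal ((p.eval z - p.eval x) ^ 2) ≤
        ENNReal.ofReal (D / 328 * ε) := by
    refine (lintegral_ballKer_eval_le p (by positivity)).trans (ENNReal.ofReal_le_ofReal ?_)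
    have h1 := integral_derivative_sq_le k p hp
    have h2 : ((k:ℝ) + 1) ^ 4 ≤ (2 * k) ^ 4 := by gcongr; linarith
    calc _ ≤ 8 * (2 * ε) ^ 3 * ((2 * k) ^ 4 * D) := by gcongr; exact h1.trans (by gcongr)
      _ = 1024 * (ε * (k:ℝ) ^ 2) ^ 2 * D * ε := by ring
      _ ≤ _ := by
        rw [hεk]
        gcongr
        linarith
  have hL : ∫⁻ x in Set.Ioo (0:ℝ) 1, layerSq ε (fun x => p.eval x) x ≤
      ENNReal.ofReal (D / 328) := by
    refine (lintegral_layerSq_le_of_le hε0 fun x hx =>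
      eval_sq_le k hk p hp (Set.Ioo_subset_Icc_self hx)).trans (ENNReal.ofReal_le_ofReal ?_)
    calc _ = 72 * (ε * (k:ℝ) ^ 2) * D := by ring
      _ ≤ _ := by rw [hεk]; linarith
  have hle : D / 328 ≤ (1 + 4 / s) * D := by
    have : 0 ≤ 4 / s * D := by positivity
    linarith
  refine ⟨?_, energy_regularize_le hε0 hs hs1 (by positivity) hm hi
    (hW.trans (by gcongr)) (hL.trans (by gcongr)) ?_ ?_ ?_⟩
  · refine (lintegral_sub_regularize_sq_le hε0 (by positivity) hm hi hW hL).trans_eq ?_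
    congr 1
    ring
  · refine (lintegral_farKer_sub_sq_le hε0 hs hm hsq).trans ?_
    gcongr
    linarith
  · refine (lintegral_hardy_far_le_of_sq_le (w := fun x => x) hε0 hs hsq).trans ?_
    gcongr
    exact le_mul_of_one_le_left hD (le_add_of_nonneg_right (by positivity))
  · refine (lintegral_hardy_far_le_of_sq_le (w := fun x => 1 - x) hε0 hs hsq).trans ?_
    gcongr
    exact le_mul_of_one_le_left hD (le_add_of_nonneg_right (by positivity))

end PolynomialBounds

section Duality

open scoped ENNReal

theorem memLp_two_of_lintegral_sq_le {f : ℝ → ℝ} {a : ℝ} (hf : Measurable f) (ha : 0 ≤ a)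
    (h : ∫⁻ x in Set.Ioo (0:ℝ) 1, ENNReal.ofReal (f x ^ 2) ≤ ENNReal.ofReal a) :
    MemLp f 2 (volume.restrict (Set.Ioo (0:ℝ) 1)) ∧ ∫ x in Set.Ioo (0:ℝ) 1, f x ^ 2 ≤ a := by
  have h0 : 0 ≤ᵐ[volume.restrict (Set.Ioo (0:ℝ) 1)] fun x => f x ^ 2 :=
    Filter.Eventually.of_forall fun _ => sq_nonneg _
  have hi := (lintegral_ofReal_ne_top_iff_integrable (hf.pow_const 2).aestronglyMeasurable h0).1
    (ne_top_of_le_ne_top ENNReal.ofReal_ne_top h)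
  refine ⟨(memLp_two_iff_integrable_sq hf.aestronglyMeasurable).2 hi, ?_⟩
  rw [← ofReal_integral_eq_lintegral_ofReal hi h0] at h
  exact (ENNReal.ofReal_le_ofReal_iff ha).1 h

theorem integral_mul_le_sqrt_mul_sqrt {μ : Measure ℝ} {f g : ℝ → ℝ} {a b : ℝ}
    (hf : MemLp f 2 μ) (hg : MemLp g 2 μ) (ha : ∫ x, f x ^ 2 ∂μ ≤ a) (hb : ∫ x, g x ^ 2 ∂μ ≤ b) :
    ∫ x, f x * g x ∂μ ≤ √a * √b := by
  have h := integral_mul_norm_le_Lp_mul_Lq (μ := μ) (f := f) (g := g) Real.HolderConjugate.two_two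
    (by simpa using hf) (by simpa using hg)
  simp only [Real.rpow_two, Real.norm_eq_abs, sq_abs, ← Real.sqrt_eq_rpow] at h
  calc ∫ x, f x * g x ∂μ ≤ ∫ x, |f x| * |g x| ∂μ := by
        refine integral_mono (hf.integrable_mul hg) ?_ fun x => ?_
        · exact hf.norm.integrable_mul hg.norm
        · simpa only [abs_mul] using le_abs_self (f x * g x)
    _ ≤ _ := h
    _ ≤ _ := by gcongr

/-- Splitting a pairing through an approximation of finite energy. -/
theorem integral_mul_le_of_approx {s N D a B : ℝ} {P f g : ℝ → ℝ} (hN : 0 ≤ N) (ha : 0 ≤ a)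
    (hB : 0 ≤ B)
    (hP : MemLp P 2 (volume.restrict (Set.Ioo (0:ℝ) 1)))
    (hPD : ∫ x in Set.Ioo (0:ℝ) 1, P x ^ 2 ≤ D)
    (hf : MemLp f 2 (volume.restrict (Set.Ioo (0:ℝ) 1))) (hfm : Measurable f) (hgm : Measurable g)
    (hψ : ∀ ψ : ℝ → ℝ, Measurable ψ → Ht0Finite s ψ →
      (∫ x in Set.Ioo (0:ℝ) 1, P x * ψ x) ≤ N * √(Ht0NormSq s ψ))
    (hfg : ∫⁻ x in Set.Ioo (0:ℝ) 1, ENNReal.ofReal ((f x - g x) ^ 2) ≤ ENNReal.ofReal a)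
    (hg : energy s g ≤ ENNReal.ofReal B) :
    ∫ x in Set.Ioo (0:ℝ) 1, P x * f x ≤ N * √B + √D * √a := by
  obtain ⟨hd, hda⟩ := memLp_two_of_lintegral_sq_le (hfm.sub hgm) ha hfg
  obtain ⟨hgfin, hgB⟩ := Ht0Finite_and_le_of_energy_le hgm hB hg
  have hg2 : MemLp g 2 (volume.restrict (Set.Ioo (0:ℝ) 1)) := by
    simpa using hf.sub hd
  have hsplit : ∫ x in Set.Ioo (0:ℝ) 1, P x * f x = (∫ x in Set.Ioo (0:ℝ) 1, P x * g x) +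
      ∫ x in Set.Ioo (0:ℝ) 1, P x * (f - g) x := by
    refine Eq.trans ?_ (integral_add (hP.integrable_mul hg2) (hP.integrable_mul hd))
    refine integral_congr_ae (Filter.Eventually.of_forall fun x => ?_)
    simp only [Pi.sub_apply]
    ring
  rw [hsplit]
  refine add_le_add ((hψ g hgm hgfin).trans ?_) (integral_mul_le_sqrt_mul_sqrt hP hd hPD hda)
  gcongr

/-- A polynomial in a negative-order ball has controlled `L²` norm. -/
theorem sqrt_integral_eval_sq_le {s : ℝ} (hs : 0 < s) (hs1 : s < 1) {k : ℕ} (hk : 1 ≤ k)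
    {p : Polynomial ℝ} (hp : p.natDegree ≤ k) {ε : ℝ} (hε : ε = 1 / 100000 / (k:ℝ) ^ 2)
    {N : ℝ} (hN : 0 ≤ N)
    (hψ : ∀ ψ : ℝ → ℝ, Measurable ψ → Ht0Finite s ψ →
      (∫ x in Set.Ioo (0:ℝ) 1, p.eval x * ψ x) ≤ N * √(Ht0NormSq s ψ)) :
    √(∫ x in (0:ℝ)..1, p.eval x ^ 2) ≤
      2 * √((335 + 492 / s + 40 / (1 - s)) * (1 + 4 / s)) * ε ^ (-s) * N := by
  obtain ⟨h1, h2⟩ := regularize_eval_bounds hs hs1 hk hp hε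
  set D := ∫ x in (0:ℝ)..1, p.eval x ^ 2 with hDdef
  have hD : 0 ≤ D := intervalIntegral.integral_nonneg zero_le_one fun _ _ => sq_nonneg _
  have hk0 : (0:ℝ) < k := by exact_mod_cast hk
  have hε0 : 0 < ε := by rw [hε]; positivity
  have hs' : 0 < 1 - s := by linarith
  have hm : Measurable fun x => p.eval x := p.continuous.measurable
  obtain ⟨hP, hPD⟩ := memLp_two_of_lintegral_sq_le hm hD (lintegral_eval_sq p).le
  have h := integral_mul_le_of_approx hN (by positivity) (by positivity) hP hPD hP hm
    (measurable_regularize hm) hψ h1 h2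
  have hDI : ∫ x in Set.Ioo (0:ℝ) 1, p.eval x * p.eval x = √D * √D := by
    rw [Real.mul_self_sqrt hD, hDdef, intervalIntegral.integral_of_le zero_le_one,
      integral_Ioc_eq_integral_Ioo]
    simp only [sq]
  have hsε : √(ε ^ (-(2 * s))) = ε ^ (-s) := by
    rw [show -(2 * s) = -s * 2 by ring, Real.rpow_mul hε0.le, Real.rpow_two,
      Real.sqrt_sq (by positivity)]
  have hB : √((335 + 492 / s + 40 / (1 - s)) * ((1 + 4 / s) * D * ε ^ (-(2 * s)))) =
      √((335 + 492 / s + 40 / (1 - s)) * (1 + 4 / s)) * ε ^ (-s) * √D := by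
    rw [← hsε, ← Real.sqrt_mul (by positivity), ← Real.sqrt_mul (by positivity)]
    congr 1
    ring
  have h4 : √(D / 4) = √D / 2 := by
    rw [show D / 4 = D / 2 ^ 2 by norm_num, Real.sqrt_div hD, Real.sqrt_sq zero_le_two]
  rw [hDI, hB, h4] at h
  rcases (Real.sqrt_nonneg D).eq_or_lt with h0 | h0
  · rw [← h0]
    positivity
  · refine le_of_mul_le_mul_right ?_ h0
    linarith

end Duality

theorem stmt_3 (r s : ℝ) (hr : 0 < r) (hrs : r ≤ s) (hs : s < 1)
    (hr2 : r ≠ 1 / 2) (hs2 : s ≠ 1 / 2) :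
    ∃ C : ℝ, 0 < C ∧ ∀ k : ℕ, 1 ≤ k → ∀ p : Polynomial ℝ, p.natDegree ≤ k →
      ∀ N : ℝ, 0 ≤ N →
      (∀ ψ : ℝ → ℝ, Measurable ψ → Ht0Finite s ψ →
        (∫ x in Set.Ioo (0:ℝ) 1, p.eval x * ψ x) ≤ N * Real.sqrt (Ht0NormSq s ψ)) →
      ∀ φ : ℝ → ℝ, Measurable φ → Ht0Finite r φ →
        (∫ x in Set.Ioo (0:ℝ) 1, p.eval x * φ x) ≤
          C * (k : ℝ) ^ (2 * (s - r)) * N * Real.sqrt (Ht0NormSq r φ) := by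
  have hs0 : 0 < s := hr.trans_le hrs
  have hs' : 0 < 1 - s := by linarith
  set K := 335 + 492 / s + 40 / (1 - s)
  have hK0 : 0 < K := by positivity
  set Q := 2 * √(K * (1 + 4 / s))
  refine ⟨(√(K * 16) + Q * √1312) * (1 / 100000) ^ (r - s), by positivity, ?_⟩
  intro k hk p hp N hN hψ φ hφ hφr
  have hk0 : (0:ℝ) < k := by exact_mod_cast hk
  set ε : ℝ := 1 / 100000 / (k:ℝ) ^ 2 with hε
  have hε0 : 0 < ε := by positivity
  have hM := Ht0NormSq_nonneg r φ
  set M := Ht0NormSq r φ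
  have hen : energy r φ ≤ ENNReal.ofReal M := (energy_eq hφ hφr).le
  obtain ⟨hφ2, -⟩ := memLp_two_of_lintegral_sq_le hφ hM ((lintegral_sq_le_energy hr).trans hen)
  obtain ⟨h1, h2⟩ := regularize_bounds_of_energy_le hε0 hr hrs hs hM hφ
    (hφ2.integrable one_le_two) hen
  have hm : Measurable fun x => p.eval x := p.continuous.measurable
  have hp2 := sqrt_integral_eval_sq_le hs0 hs hk hp hε hN hψ
  set D := ∫ x in (0:ℝ)..1, p.eval x ^ 2
  have hD : 0 ≤ D := intervalIntegral.integral_nonneg zero_le_one fun _ _ => sq_nonneg _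
  obtain ⟨hP, hPD⟩ := memLp_two_of_lintegral_sq_le hm hD (lintegral_eval_sq p).le
  have h := integral_mul_le_of_approx hN (by positivity) (by positivity) hP hPD hφ2 hφ
    (measurable_regularize hφ) hψ h1 h2
  have hsq : ∀ a : ℝ, √(ε ^ (2 * a)) = ε ^ a := fun a => by
    rw [mul_comm 2 a, Real.rpow_mul hε0.le, Real.rpow_two, Real.sqrt_sq (by positivity)]
  have hB : √(K * (16 * ε ^ (2 * r) * M * ε ^ (-(2 * s)))) = √(K * 16) * ε ^ (r - s) * √M := by
    rw [← hsq (r - s), ← Real.sqrt_mul (by positivity), ← Real.sqrt_mul (by positivity),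
      mul_sub, sub_eq_add_neg, Real.rpow_add hε0]
    congr 1
    ring
  have ha : √(82 * (16 * ε ^ (2 * r) * M)) = √1312 * ε ^ r * √M := by
    rw [← hsq r, ← Real.sqrt_mul (by positivity), ← Real.sqrt_mul (by positivity)]
    congr 1
    ring
  have hεk : ε ^ (r - s) = (1 / 100000) ^ (r - s) * (k:ℝ) ^ (2 * (s - r)) := by
    rw [hε, Real.div_rpow (by norm_num) (by positivity), div_eq_mul_inv,
      ← Real.rpow_neg (by positivity), ← Real.rpow_two, ← Real.rpow_mul hk0.le]
    congr 2
    ring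
  have hrs' : ε ^ (r - s) = ε ^ (-s) * ε ^ r := by
    rw [← Real.rpow_add hε0]
    congr 1
    ring
  calc _ ≤ _ := h
    _ ≤ N * (√(K * 16) * ε ^ (r - s) * √M) + Q * ε ^ (-s) * N * (√1312 * ε ^ r * √M) := by
      rw [hB, ha]
      gcongr
    _ = (√(K * 16) + Q * √1312) * ε ^ (r - s) * N * √M := by
      rw [hrs']
      ring
    _ = _ := by
      rw [hεk]
      ring
end

section
/- There exists a constant C > 0 such that for every integer k ≥ 1, every real polynomial p of degree at most k, and every N ≥ 0 the following holds: if ∫₀¹ p ψ ≤ N ‖ψ‖_{H^{1/2}_{00}(I)} for every measurable ψ : (0,1) → ℝ with finite ‖ψ‖_{H^{1/2}_{00}(I)}, then (∫₀¹ p(x)² dx)^{1/2} ≤ C k N. (Inverse inequality ‖p‖_{L²(I)} ≲ k ‖p‖_{(H^{1/2}_{00}(I))'}, i.e. the case r = 0, s = 1/2 of the inverse inequalities in negative Sobolev norms.) -/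
open MeasureTheory

/-- Squared Gagliardo seminorm `|φ|_{1/2,(0,h)}²` on the interval `(0,h)`. -/
noncomputable def gagHalfSq (h : ℝ) (φ : ℝ → ℝ) : ℝ :=
  ∫ x in Set.Ioo (0:ℝ) h, ∫ y in Set.Ioo (0:ℝ) h, (φ x - φ y) ^ 2 / (x - y) ^ 2

/-- Finiteness of the Gagliardo double integral on `(0,h)`. -/
def gagHalfFinite (h : ℝ) (φ : ℝ → ℝ) : Prop :=
  IntegrableOn (fun q : ℝ × ℝ => (φ q.1 - φ q.2) ^ 2 / (q.1 - q.2) ^ 2)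
    (Set.Ioo (0:ℝ) h ×ˢ Set.Ioo (0:ℝ) h) (volume.prod volume)

/-- Squared `H^{1/2}_{00}((0,h))` norm. -/
noncomputable def H1200NormSq (h : ℝ) (ψ : ℝ → ℝ) : ℝ :=
  gagHalfSq h ψ + (∫ x in Set.Ioo (0:ℝ) h, ψ x ^ 2 / x)
    + ∫ x in Set.Ioo (0:ℝ) h, ψ x ^ 2 / (h - x)

/-- Finiteness of the `H^{1/2}_{00}((0,h))` norm. -/
def H1200Finite (h : ℝ) (ψ : ℝ → ℝ) : Prop :=
  gagHalfFinite h ψ ∧ IntegrableOn (fun x => ψ x ^ 2 / x) (Set.Ioo (0:ℝ) h) ∧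
    IntegrableOn (fun x => ψ x ^ 2 / (h - x)) (Set.Ioo (0:ℝ) h)

namespace Polynomial

/-- Markov's inequality at the right endpoint of `[1/2, 1]`. -/
lemma derivative_eval_one_le {P : Polynomial ℝ} {n : ℕ} (hP : P.natDegree ≤ n) {M : ℝ}
    (hM : 0 < M) (h : ∀ s ∈ Set.Icc (1 / 2 : ℝ) 1, |P.eval s| ≤ M) :
    P.derivative.eval 1 ≤ 4 * (n : ℝ) ^ 2 * M := by
  set R : Polynomial ℝ := C M⁻¹ * P.comp (C (3 / 4) + C (1 / 4) * X) with hR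
  have hdeg : R.degree ≤ n := by
    rw [← natDegree_le_iff_degree_le]
    refine (natDegree_C_mul_le _ _).trans (natDegree_comp_le.trans ?_)
    have : (C (3 / 4 : ℝ) + C (1 / 4) * X).natDegree ≤ 1 := by compute_degree
    calc _ ≤ P.natDegree * 1 := by gcongr
      _ ≤ n := by simpa using hP
  have hbd : ∀ y ∈ Set.Icc (-1 : ℝ) 1, |R.eval y| ≤ 1 := by
    intro y hy
    have := h (3 / 4 + 1 / 4 * y) ⟨by linarith [hy.1], by linarith [hy.2]⟩
    simp only [hR, eval_mul, eval_C, eval_comp, eval_add, eval_X, abs_mul, abs_inv, abs_of_pos hM]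
    rw [inv_mul_le_iff₀ hM]
    simpa using this
  have key := Chebyshev.eval_iterate_derivative_le_of_forall_abs_le_one (k := 1) le_rfl hdeg hbd
  have hT : (derivative (Chebyshev.T ℝ n)).eval 1 = (n : ℝ) ^ 2 := by
    rw [Chebyshev.T_derivative_eq_U]
    simp [sq]
  have hR' : (derivative R).eval 1 = M⁻¹ * (P.derivative.eval 1 * (1 / 4)) := by
    have h1 : (3 / 4 + 1 / 4 : ℝ) = 1 := by norm_num
    simp only [hR, derivative_C_mul, derivative_comp, derivative_add, derivative_C, derivative_X,
      eval_mul, eval_C, eval_comp, eval_add, eval_X, mul_one, zero_add, h1]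
    ring
  simp only [Function.iterate_one] at key
  rw [hT, hR', inv_mul_le_iff₀ hM] at key
  linarith

lemma integral_eval_comp_mul_sq_le (p : Polynomial ℝ) {s : ℝ} (hs : s ∈ Set.Icc (1 / 2 : ℝ) 1) :
    ∫ x in (0 : ℝ)..1, p.eval (s * x) ^ 2 ≤ 2 * ∫ x in (0 : ℝ)..1, p.eval x ^ 2 := by
  have hs0 : 0 < s := by linarith [hs.1]
  rw [intervalIntegral.integral_comp_mul_left (fun x => p.eval x ^ 2) hs0.ne']
  have h1 : ∫ x in (s * 0)..(s * 1), p.eval x ^ 2 ≤ ∫ x in (0 : ℝ)..1, p.eval x ^ 2 := by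
    apply intervalIntegral.integral_mono_interval (by simp) (by simpa using hs0.le)
      (by simpa using hs.2)
    · exact Filter.Eventually.of_forall fun x => sq_nonneg _
    · exact (by fun_prop : Continuous fun x => p.eval x ^ 2).intervalIntegrable _ _
  have h0 : 0 ≤ ∫ x in (0 : ℝ)..1, p.eval x ^ 2 :=
    intervalIntegral.integral_nonneg zero_le_one fun x _ => sq_nonneg _
  have h2 : s⁻¹ ≤ 2 := by
    rw [inv_le_comm₀ hs0 two_pos]; linarith [hs.1]
  rw [smul_eq_mul]
  exact (mul_le_mul_of_nonneg_left h1 (inv_nonneg.2 hs0.le)).trans (by gcongr)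

lemma sq_integral_mul_le {f g : ℝ → ℝ} (hf : Continuous f) (hg : Continuous g) :
    (∫ x in (0 : ℝ)..1, f x * g x) ^ 2 ≤
      (∫ x in (0 : ℝ)..1, f x ^ 2) * ∫ x in (0 : ℝ)..1, g x ^ 2 := by
  have hi : ∀ {u : ℝ → ℝ}, Continuous u → IntervalIntegrable u volume 0 1 :=
    fun hu => hu.intervalIntegrable _ _
  have h : ∀ t : ℝ, 0 ≤ (∫ x in (0 : ℝ)..1, f x ^ 2) * (t * t) +
      (2 * ∫ x in (0 : ℝ)..1, f x * g x) * t + ∫ x in (0 : ℝ)..1, g x ^ 2 := by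
    intro t
    have h0 : 0 ≤ ∫ x in (0 : ℝ)..1, (t * f x + g x) ^ 2 :=
      intervalIntegral.integral_nonneg zero_le_one fun x _ => sq_nonneg _
    have h1 : ∀ x, (t * f x + g x) ^ 2 = t * t * f x ^ 2 + 2 * t * (f x * g x) + g x ^ 2 :=
      fun x => by ring
    simp only [h1] at h0
    rw [intervalIntegral.integral_add (hi (by fun_prop)) (hi (by fun_prop)),
      intervalIntegral.integral_add (hi (by fun_prop)) (hi (by fun_prop)),
      intervalIntegral.integral_const_mul, intervalIntegral.integral_const_mul] at h0
    linarith
  have := discrim_le_zero h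
  rw [discrim] at this
  linarith

lemma integral_sq_mul_derivative_le {p : Polynomial ℝ} {k : ℕ} (hp : p.natDegree ≤ k)
    (hA : 0 < ∫ x in (0 : ℝ)..1, p.eval x ^ 2) :
    ∫ x in (0 : ℝ)..1, (x * p.derivative.eval x) ^ 2 ≤
      32 * (k : ℝ) ^ 4 * ∫ x in (0 : ℝ)..1, p.eval x ^ 2 := by
  set A := ∫ x in (0 : ℝ)..1, p.eval x ^ 2 with hAdef
  set q : ℝ → ℝ := fun x => x * p.derivative.eval x with hq
  have hqc : Continuous q := by fun_prop
  set Q := ∫ x in (0 : ℝ)..1, q x ^ 2 with hQdef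
  change Q ≤ _
  have hQ0 : 0 ≤ Q := intervalIntegral.integral_nonneg zero_le_one fun x _ => sq_nonneg _
  rcases hQ0.eq_or_lt with hQ | hQ
  · rw [← hQ]; positivity
  set F : Polynomial ℝ := ∑ j ∈ Finset.range (k + 1),
    C (p.coeff j * ∫ x in (0 : ℝ)..1, x ^ j * q x) * X ^ j with hF
  have hFdeg : F.natDegree ≤ k := by
    apply natDegree_sum_le_of_forall_le
    intro j hj
    exact (natDegree_C_mul_X_pow_le _ _).trans (by simpa [Nat.lt_succ_iff] using hj)
  have hFe : ∀ s, F.eval s = ∫ x in (0 : ℝ)..1, p.eval (s * x) * q x := by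
    intro s
    have h1 : ∀ x, p.eval (s * x) * q x =
        ∑ j ∈ Finset.range (k + 1), p.coeff j * s ^ j * (x ^ j * q x) := by
      intro x
      rw [eval_eq_sum_range' (Nat.lt_succ_of_le hp), Finset.sum_mul]
      exact Finset.sum_congr rfl fun j _ => by ring
    simp only [h1]
    rw [intervalIntegral.integral_finsetSum
      fun j _ => (by fun_prop : Continuous _).intervalIntegrable _ _]
    simp only [hF, eval_finsetSum, intervalIntegral.integral_const_mul, eval_mul, eval_C,
      eval_pow, eval_X]
    exact Finset.sum_congr rfl fun j _ => by ring
  have hF' : F.derivative.eval 1 = Q := by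
    have h1 : ∀ x, q x ^ 2 =
        ∑ j ∈ Finset.range (k + 1), p.coeff j * j * (x ^ j * q x) := by
      intro x
      have : q x = ∑ j ∈ Finset.range (k + 1), p.coeff j * j * x ^ j := by
        simp only [hq]
        conv_lhs => rw [as_sum_range' p (k + 1) (Nat.lt_succ_of_le hp)]
        simp only [derivative_sum, eval_finsetSum, derivative_monomial, eval_monomial,
          Finset.mul_sum]
        refine Finset.sum_congr rfl fun j _ => ?_
        rcases j with _ | j
        · simp
        · simp [pow_succ]; ring
      rw [sq]
      nth_rewrite 1 [this]
      rw [Finset.sum_mul]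
      exact Finset.sum_congr rfl fun j _ => by ring
    simp only [hQdef, h1]
    rw [intervalIntegral.integral_finsetSum
      fun j _ => (by fun_prop : Continuous _).intervalIntegrable _ _]
    simp only [hF, derivative_sum, eval_finsetSum, intervalIntegral.integral_const_mul,
      derivative_C_mul_X_pow, eval_mul, eval_C, eval_pow, eval_X, one_pow, mul_one]
    exact Finset.sum_congr rfl fun j _ => by ring
  have hM : 0 < Real.sqrt (2 * A * Q) := Real.sqrt_pos.2 (by positivity)
  have := derivative_eval_one_le hFdeg hM fun s hs => by
    apply Real.abs_le_sqrt
    rw [hFe]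
    refine (sq_integral_mul_le (by fun_prop) hqc).trans ?_
    gcongr
    exact integral_eval_comp_mul_sq_le p hs
  rw [hF'] at this
  have h2 : Q ^ 2 ≤ (4 * (k : ℝ) ^ 2 * Real.sqrt (2 * A * Q)) ^ 2 := by gcongr
  rw [mul_pow, Real.sq_sqrt (by positivity)] at h2
  refine le_of_mul_le_mul_right ?_ hQ
  calc Q * Q = Q ^ 2 := by ring
    _ ≤ _ := h2
    _ = _ := by ring

/-- Markov's inequality in `L²(0,1)`. -/
lemma integral_derivative_sq_le {p : Polynomial ℝ} {k : ℕ} (hp : p.natDegree ≤ k)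
    (hA : 0 < ∫ x in (0 : ℝ)..1, p.eval x ^ 2) :
    ∫ x in (0 : ℝ)..1, p.derivative.eval x ^ 2 ≤
      128 * (k : ℝ) ^ 4 * ∫ x in (0 : ℝ)..1, p.eval x ^ 2 := by
  have hr : ∀ f : ℝ → ℝ, ∫ x in (0 : ℝ)..1, f (1 - x) = ∫ x in (0 : ℝ)..1, f x := by
    intro f
    rw [intervalIntegral.integral_comp_sub_left]; simp
  set r : Polynomial ℝ := p.comp (1 - X) with hrdef
  have hrdeg : r.natDegree ≤ k := by
    refine natDegree_comp_le.trans ?_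
    have : (1 - X : Polynomial ℝ).natDegree ≤ 1 := by compute_degree
    calc _ ≤ p.natDegree * 1 := by gcongr
      _ ≤ k := by simpa using hp
  have hrA : ∫ x in (0 : ℝ)..1, r.eval x ^ 2 = ∫ x in (0 : ℝ)..1, p.eval x ^ 2 := by
    rw [← hr fun x => p.eval x ^ 2]
    simp [hrdef]
  have h1 := integral_sq_mul_derivative_le hp hA
  have h2 := integral_sq_mul_derivative_le hrdeg (hrA ▸ hA)
  rw [hrA, ← hr] at h2
  have h3 : ∀ x : ℝ, ((1 - x) * r.derivative.eval (1 - x)) ^ 2 =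
      ((1 - x) * p.derivative.eval x) ^ 2 := by
    intro x
    simp [hrdef, derivative_comp]
  simp only [h3] at h2
  have h4 : ∫ x in (0 : ℝ)..1, p.derivative.eval x ^ 2 ≤
      ∫ x in (0 : ℝ)..1, (2 * (x * p.derivative.eval x) ^ 2 +
        2 * ((1 - x) * p.derivative.eval x) ^ 2) := by
    apply intervalIntegral.integral_mono_on zero_le_one
      ((by fun_prop : Continuous _).intervalIntegrable _ _)
      ((by fun_prop : Continuous _).intervalIntegrable _ _)
    intro x _
    nlinarith [sq_nonneg ((2 * x - 1) * p.derivative.eval x)]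
  rw [intervalIntegral.integral_add ((by fun_prop : Continuous _).intervalIntegrable _ _)
    ((by fun_prop : Continuous _).intervalIntegrable _ _), intervalIntegral.integral_const_mul,
    intervalIntegral.integral_const_mul] at h4
  linarith

lemma eval_sq_le {p : Polynomial ℝ} {k : ℕ} (hk : 1 ≤ k) (hp : p.natDegree ≤ k)
    (hA : 0 < ∫ x in (0 : ℝ)..1, p.eval x ^ 2) {x : ℝ} (hx : x ∈ Set.Icc (0 : ℝ) 1) :
    p.eval x ^ 2 ≤ 130 * (k : ℝ) ^ 2 * ∫ x in (0 : ℝ)..1, p.eval x ^ 2 := by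
  set A := ∫ x in (0 : ℝ)..1, p.eval x ^ 2 with hAdef
  have hB := integral_derivative_sq_le hp hA
  have hk' : (1 : ℝ) ≤ k := by exact_mod_cast hk
  set h : ℝ → ℝ := fun z => (k : ℝ) ^ 2 * p.eval z ^ 2 + ((k : ℝ) ^ 2)⁻¹ * p.derivative.eval z ^ 2
    with hh
  have hi : ∀ {u : ℝ → ℝ} {a b}, Continuous u → IntervalIntegrable u volume a b :=
    fun hu => hu.intervalIntegrable _ _
  have hc : Continuous h := by fun_prop
  have hnn : ∀ z, 0 ≤ h z := fun z => by positivity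
  have hI : ∫ z in (0 : ℝ)..1, h z ≤ 129 * (k : ℝ) ^ 2 * A := by
    simp only [hh]
    rw [intervalIntegral.integral_add (hi (by fun_prop)) (hi (by fun_prop)),
      intervalIntegral.integral_const_mul, intervalIntegral.integral_const_mul]
    calc _ ≤ (k : ℝ) ^ 2 * A + ((k : ℝ) ^ 2)⁻¹ * (128 * (k : ℝ) ^ 4 * A) := by gcongr
      _ = _ := by field_simp; ring
  have hd : ∀ y ∈ Set.Icc (0 : ℝ) 1, p.eval x ^ 2 ≤ p.eval y ^ 2 + 129 * (k : ℝ) ^ 2 * A := by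
    intro y hy
    have hF : ∫ z in y..x, 2 * p.eval z * p.derivative.eval z = p.eval x ^ 2 - p.eval y ^ 2 := by
      apply intervalIntegral.integral_eq_sub_of_hasDerivAt
      · intro z _
        convert! (p.hasDerivAt z).pow 2 using 1
        simp
      · exact hi (by fun_prop)
    have h1 : |∫ z in y..x, 2 * p.eval z * p.derivative.eval z| ≤ |∫ z in y..x, h z| := by
      rw [← Real.norm_eq_abs]
      refine intervalIntegral.norm_integral_le_abs_of_norm_le
        (Filter.Eventually.of_forall fun z => ?_) (hi hc)
      rw [Real.norm_eq_abs, abs_le]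
      have e1 : h z = (k * p.eval z) ^ 2 + ((k : ℝ)⁻¹ * p.derivative.eval z) ^ 2 := by
        simp only [hh]; ring
      have e2 : 2 * p.eval z * p.derivative.eval z =
          2 * (k * p.eval z) * ((k : ℝ)⁻¹ * p.derivative.eval z) := by
        field_simp
      rw [e1, e2]
      constructor
      · nlinarith [sq_nonneg (k * p.eval z + (k : ℝ)⁻¹ * p.derivative.eval z)]
      · nlinarith [sq_nonneg (k * p.eval z - (k : ℝ)⁻¹ * p.derivative.eval z)]
    have h2 : |∫ z in y..x, h z| ≤ |∫ z in (0 : ℝ)..1, h z| := by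
      apply intervalIntegral.abs_integral_mono_interval
      · rw [Set.uIoc_of_le zero_le_one]
        exact Set.Ioc_subset_Ioc (le_min hy.1 hx.1) (max_le hy.2 hx.2)
      · exact Filter.Eventually.of_forall hnn
      · exact hi hc
    rw [abs_of_nonneg (intervalIntegral.integral_nonneg zero_le_one fun z _ => hnn z)] at h2
    rw [hF] at h1
    linarith [le_abs_self (p.eval x ^ 2 - p.eval y ^ 2)]
  have hm : ∫ _y in (0 : ℝ)..1, p.eval x ^ 2 ≤
      ∫ y in (0 : ℝ)..1, (p.eval y ^ 2 + 129 * (k : ℝ) ^ 2 * A) :=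
    intervalIntegral.integral_mono_on zero_le_one (hi (by fun_prop)) (hi (by fun_prop)) hd
  rw [intervalIntegral.integral_add (hi (by fun_prop)) (hi (by fun_prop))] at hm
  simp only [intervalIntegral.integral_const, sub_zero, one_smul] at hm
  nlinarith [mul_le_mul_of_nonneg_right (one_le_pow₀ hk' : (1 : ℝ) ≤ k ^ 2) hA.le]

lemma sq_eval_sub_le (p : Polynomial ℝ) (x y : ℝ) :
    ENNReal.ofReal ((p.eval x - p.eval y) ^ 2) ≤ ENNReal.ofReal |x - y| *
      ∫⁻ z in Set.uIcc x y, ENNReal.ofReal (p.derivative.eval z ^ 2) := by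
  wlog hxy : x ≤ y generalizing x y
  · rw [← neg_sub, neg_sq, abs_sub_comm, Set.uIcc_comm]
    exact this y x (le_of_not_ge hxy)
  rcases hxy.eq_or_lt with rfl | hlt
  · simp
  have hi : ∀ {u : ℝ → ℝ}, Continuous u → IntervalIntegrable u volume x y :=
    fun hu => hu.intervalIntegrable _ _
  set d := ∫ z in x..y, p.derivative.eval z ^ 2 with hd
  have hFTC : ∫ z in x..y, p.derivative.eval z = p.eval y - p.eval x :=
    intervalIntegral.integral_eq_sub_of_hasDerivAt (fun z _ => p.hasDerivAt z) (hi (by fun_prop))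
  have hreal : (p.eval x - p.eval y) ^ 2 ≤ |x - y| * d := by
    set c := (p.eval y - p.eval x) / (y - x) with hc
    have h0 : 0 ≤ ∫ z in x..y, (p.derivative.eval z - c) ^ 2 :=
      intervalIntegral.integral_nonneg hxy fun z _ => sq_nonneg _
    have h1 : ∀ z, (p.derivative.eval z - c) ^ 2 =
        p.derivative.eval z ^ 2 - 2 * c * p.derivative.eval z + c ^ 2 := fun z => by ring
    simp only [h1] at h0
    rw [intervalIntegral.integral_add (hi (by fun_prop)) (hi (by fun_prop)),
      intervalIntegral.integral_sub (hi (by fun_prop)) (hi (by fun_prop)),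
      intervalIntegral.integral_const_mul, hFTC, intervalIntegral.integral_const,
      smul_eq_mul] at h0
    have hpos : 0 < y - x := sub_pos.2 hlt
    have h2 : c * (y - x) = p.eval y - p.eval x := div_mul_cancel₀ _ hpos.ne'
    rw [abs_sub_comm, abs_of_pos hpos]
    rw [← h2] at h0
    calc (p.eval x - p.eval y) ^ 2 = (y - x) * (c ^ 2 * (y - x)) := by
          rw [← neg_sub, ← h2]; ring
      _ ≤ (y - x) * d := by
          gcongr
          linarith
  have hl : ∫⁻ z in Set.uIcc x y, ENNReal.ofReal (p.derivative.eval z ^ 2) = ENNReal.ofReal d := by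
    rw [hd, intervalIntegral.integral_of_le hxy, ← integral_Icc_eq_integral_Ioc, Set.uIcc_of_le hxy,
      ofReal_integral_eq_lintegral_ofReal]
    · exact (by fun_prop : Continuous fun z => p.derivative.eval z ^ 2).integrableOn_Icc
    · exact Filter.Eventually.of_forall fun z => sq_nonneg _
  rw [hl, ← ENNReal.ofReal_mul (abs_nonneg _)]
  exact ENNReal.ofReal_le_ofReal hreal

end Polynomial

lemma lintegral_near_diagonal_le {g : ℝ → ENNReal} (hg : Measurable g) (δ : ℝ) :
    ∫⁻ x, ∫⁻ y, (Set.Icc (-δ) δ).indicator (fun u => ENNReal.ofReal |u|⁻¹) (y - x) *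
      ∫⁻ z in Set.uIcc x y, g z ≤ ENNReal.ofReal (2 * δ) * ∫⁻ z, g z := by
  set κ : ℝ → ENNReal := (Set.Icc (-δ) δ).indicator (fun u => ENNReal.ofReal |u|⁻¹) with hκ
  have hκm : Measurable κ := by
    apply Measurable.indicator _ measurableSet_Icc
    fun_prop
  have hS : MeasurableSet {q : (ℝ × ℝ) × ℝ | q.2 ∈ Set.uIcc q.1.1 (q.1.1 + q.1.2)} := by
    have h1 : MeasurableSet {q : (ℝ × ℝ) × ℝ | min q.1.1 (q.1.1 + q.1.2) ≤ q.2} :=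
      measurableSet_le (by fun_prop) (by fun_prop)
    have h2 : MeasurableSet {q : (ℝ × ℝ) × ℝ | q.2 ≤ max q.1.1 (q.1.1 + q.1.2)} :=
      measurableSet_le (by fun_prop) (by fun_prop)
    exact h1.inter h2
  set G : (ℝ × ℝ) × ℝ → ENNReal :=
    {q : (ℝ × ℝ) × ℝ | q.2 ∈ Set.uIcc q.1.1 (q.1.1 + q.1.2)}.indicator fun q => g q.2 with hG
  have hGm : Measurable G := Measurable.indicator (by fun_prop) hS
  have hGe : ∀ x u, ∫⁻ z in Set.uIcc x (x + u), g z = ∫⁻ z, G ((x, u), z) := by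
    intro x u
    rw [← lintegral_indicator measurableSet_uIcc]
    rfl
  have hvol : ∀ u z, ∫⁻ x, G ((x, u), z) ≤ ENNReal.ofReal |u| * g z := by
    intro u z
    calc ∫⁻ x, G ((x, u), z) ≤ ∫⁻ x, (Set.uIcc (z - u) z).indicator (fun _ => g z) x := by
          apply lintegral_mono
          intro x
          by_cases h1 : z ∈ Set.uIcc x (x + u)
          · have h2 : x ∈ Set.uIcc (z - u) z := by
              rw [Set.mem_uIcc] at h1 ⊢
              grind
            rw [Set.indicator_of_mem h2]
            exact Set.indicator_le_self' (fun _ _ => zero_le) ((x, u), z)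
          · have h3 : G ((x, u), z) = 0 := Set.indicator_of_notMem h1 _
            exact h3.le.trans zero_le
      _ = ENNReal.ofReal |u| * g z := by
          rw [lintegral_indicator measurableSet_uIcc, setLIntegral_const, Real.volume_interval, mul_comm]
          simp
  have hin : ∀ u, ∫⁻ x, κ u * ∫⁻ z, G ((x, u), z) ≤
      (Set.Icc (-δ) δ).indicator (fun _ => ∫⁻ z, g z) u := by
    intro u
    rw [lintegral_const_mul _ (by fun_prop), lintegral_lintegral_swap (by fun_prop)]
    have h1 : ∫⁻ z, ∫⁻ x, G ((x, u), z) ≤ ENNReal.ofReal |u| * ∫⁻ z, g z := by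
      rw [← lintegral_const_mul _ hg]
      exact lintegral_mono fun z => hvol u z
    by_cases hu : u ∈ Set.Icc (-δ) δ
    · simp only [hκ, Set.indicator_of_mem hu]
      refine (mul_le_mul_right h1 _).trans ?_
      rw [← mul_assoc, ← ENNReal.ofReal_mul (by positivity)]
      refine mul_le_of_le_one_left zero_le ?_
      rw [ENNReal.ofReal_le_one]
      exact inv_mul_le_one
    · simp [hκ, Set.indicator_of_notMem hu]
  calc _ = ∫⁻ x, ∫⁻ u, κ u * ∫⁻ z, G ((x, u), z) := by
        refine lintegral_congr fun x => ?_
        rw [← lintegral_add_left_eq_self _ x]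
        simp only [add_sub_cancel_left, hGe]
    _ = ∫⁻ u, ∫⁻ x, κ u * ∫⁻ z, G ((x, u), z) := by
        apply lintegral_lintegral_swap
        apply Measurable.aemeasurable
        apply Measurable.mul (by fun_prop)
        exact Measurable.lintegral_prod_right' hGm
    _ ≤ ∫⁻ u, (Set.Icc (-δ) δ).indicator (fun _ => ∫⁻ z, g z) u := lintegral_mono hin
    _ = _ := by
        rw [lintegral_indicator measurableSet_Icc, setLIntegral_const, Real.volume_Icc, mul_comm]
        ring_nf

lemma lintegral_cauchy_kernel {δ : ℝ} (hδ : 0 < δ) (x : ℝ) :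
    ∫⁻ y, ENNReal.ofReal (2 / (δ ^ 2 + (y - x) ^ 2)) = ENNReal.ofReal (2 * Real.pi / δ) := by
  rw [lintegral_sub_right_eq_self (fun u => ENNReal.ofReal (2 / (δ ^ 2 + u ^ 2))) x]
  have h : ∀ u : ℝ, 2 / (δ ^ 2 + u ^ 2) = 2 / δ ^ 2 * (1 + (u / δ) ^ 2)⁻¹ := by
    intro u
    field_simp
  simp only [h]
  rw [← ofReal_integral_eq_lintegral_ofReal]
  · rw [integral_const_mul, Measure.integral_comp_div (fun u => (1 + u ^ 2)⁻¹),
      integral_univ_inv_one_add_sq, abs_of_pos hδ, smul_eq_mul]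
    congr 1
    field_simp
  · exact (integrable_inv_one_add_sq.comp_div hδ.ne').const_mul _
  · exact Filter.Eventually.of_forall fun u => by positivity

lemma sq_sub_div_sq_le {a b s t d δ : ℝ} (hδ : 0 < δ) (hs : |s| ≤ 1) (ht : |t| ≤ 1)
    (hst : |s - t| ≤ |d| / δ) :
    (a * s - b * t) ^ 2 / d ^ 2 ≤ 2 * a ^ 2 * (2 / (δ ^ 2 + d ^ 2)) +
      2 * b ^ 2 * (2 / (δ ^ 2 + d ^ 2)) +
      2 * (if |d| ≤ δ then |d|⁻¹ * (|d|⁻¹ * (a - b) ^ 2) else 0) := by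
  rcases eq_or_ne d 0 with rfl | hd
  · have : (0 : ℝ) ≤ 2 * a ^ 2 * (2 / (δ ^ 2 + 0 ^ 2)) + 2 * b ^ 2 * (2 / (δ ^ 2 + 0 ^ 2)) := by
      positivity
    simpa using this
  have hd2 : 0 < d ^ 2 := by positivity
  have hs2 : s ^ 2 ≤ 1 := (sq_le_one_iff_abs_le_one s).2 hs
  have ht2 : t ^ 2 ≤ 1 := (sq_le_one_iff_abs_le_one t).2 ht
  split_ifs with h
  · have hdδ : d ^ 2 ≤ δ ^ 2 := sq_le_sq' (by linarith [neg_abs_le d]) ((le_abs_self d).trans h)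
    have hst2 : (s - t) ^ 2 ≤ d ^ 2 / δ ^ 2 := by
      rw [← div_pow, ← sq_abs (s - t), ← sq_abs (d / δ), abs_div, abs_of_pos hδ]
      gcongr
    have hm : 1 / δ ^ 2 ≤ 2 / (δ ^ 2 + d ^ 2) := by
      rw [div_le_div_iff₀ (by positivity) (by positivity)]; linarith
    have hinv : |d|⁻¹ * (|d|⁻¹ * (a - b) ^ 2) = (a - b) ^ 2 / d ^ 2 := by
      rw [← sq_abs d]; field_simp
    rw [hinv]
    have h1 : (a * s - b * t) ^ 2 ≤ 2 * (a - b) ^ 2 + 2 * b ^ 2 * (d ^ 2 / δ ^ 2) := by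
      calc (a * s - b * t) ^ 2 = ((a - b) * s + b * (s - t)) ^ 2 := by ring
        _ ≤ 2 * ((a - b) * s) ^ 2 + 2 * (b * (s - t)) ^ 2 := by
            nlinarith [sq_nonneg ((a - b) * s - b * (s - t))]
        _ = 2 * (a - b) ^ 2 * s ^ 2 + 2 * b ^ 2 * (s - t) ^ 2 := by ring
        _ ≤ 2 * (a - b) ^ 2 * 1 + 2 * b ^ 2 * (d ^ 2 / δ ^ 2) := by gcongr
        _ = _ := by ring
    have h0 : 0 ≤ 2 * a ^ 2 * (2 / (δ ^ 2 + d ^ 2)) := by positivity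
    calc (a * s - b * t) ^ 2 / d ^ 2
        ≤ (2 * (a - b) ^ 2 + 2 * b ^ 2 * (d ^ 2 / δ ^ 2)) / d ^ 2 := by gcongr
      _ = 2 * b ^ 2 * (1 / δ ^ 2) + 2 * ((a - b) ^ 2 / d ^ 2) := by field_simp; ring
      _ ≤ 2 * b ^ 2 * (2 / (δ ^ 2 + d ^ 2)) + 2 * ((a - b) ^ 2 / d ^ 2) := by gcongr
      _ ≤ _ := by linarith
  · have hdδ : δ ^ 2 ≤ d ^ 2 := by
      rw [← sq_abs d]
      have := (not_le.1 h).le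
      gcongr
    have hm : 1 / d ^ 2 ≤ 2 / (δ ^ 2 + d ^ 2) := by
      rw [div_le_div_iff₀ (by positivity) (by positivity)]; linarith
    have h1 : (a * s - b * t) ^ 2 ≤ 2 * a ^ 2 + 2 * b ^ 2 := by
      calc (a * s - b * t) ^ 2 ≤ 2 * a ^ 2 * s ^ 2 + 2 * b ^ 2 * t ^ 2 := by
            nlinarith [sq_nonneg (a * s + b * t)]
        _ ≤ 2 * a ^ 2 * 1 + 2 * b ^ 2 * 1 := by gcongr
        _ = _ := by ring
    calc (a * s - b * t) ^ 2 / d ^ 2 ≤ (2 * a ^ 2 + 2 * b ^ 2) / d ^ 2 := by gcongr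
      _ = (2 * a ^ 2 + 2 * b ^ 2) * (1 / d ^ 2) := by ring
      _ ≤ (2 * a ^ 2 + 2 * b ^ 2) * (2 / (δ ^ 2 + d ^ 2)) := by gcongr
      _ = _ := by ring

lemma lintegral_Ioo_ofReal_sq (p : Polynomial ℝ) :
    ∫⁻ x in Set.Ioo (0 : ℝ) 1, ENNReal.ofReal (p.eval x ^ 2) =
      ENNReal.ofReal (∫ x in (0 : ℝ)..1, p.eval x ^ 2) := by
  rw [intervalIntegral.integral_of_le zero_le_one, integral_Ioc_eq_integral_Ioo,
    ofReal_integral_eq_lintegral_ofReal]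
  · exact ((by fun_prop : Continuous fun z => p.eval z ^ 2).integrableOn_Icc).mono_set
      Set.Ioo_subset_Icc_self
  · exact Filter.Eventually.of_forall fun z => sq_nonneg _

/-- Bound for the `H^{1/2}` seminorm of the product of a polynomial and a cutoff function whose
transition layers have width `δ`. -/
lemma lintegral_gagliardo_mul_le (p : Polynomial ℝ) {η : ℝ → ℝ} {δ : ℝ} (hδ : 0 < δ)
    (h1 : ∀ x ∈ Set.Ioo (0 : ℝ) 1, |η x| ≤ 1)
    (hη : ∀ x y, |η x - η y| ≤ |x - y| / δ) :
    ∫⁻ x in Set.Ioo (0 : ℝ) 1, ∫⁻ y in Set.Ioo (0 : ℝ) 1,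
      ENNReal.ofReal ((p.eval x * η x - p.eval y * η y) ^ 2 / (x - y) ^ 2) ≤
    ENNReal.ofReal (8 * Real.pi / δ * (∫ x in (0 : ℝ)..1, p.eval x ^ 2) +
      4 * δ * ∫ x in (0 : ℝ)..1, p.derivative.eval x ^ 2) := by
  set A := ∫ x in (0 : ℝ)..1, p.eval x ^ 2
  set B := ∫ x in (0 : ℝ)..1, p.derivative.eval x ^ 2
  have hA0 : 0 ≤ A := intervalIntegral.integral_nonneg zero_le_one fun x _ => sq_nonneg _
  have hB0 : 0 ≤ B := intervalIntegral.integral_nonneg zero_le_one fun x _ => sq_nonneg _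
  set μ : Measure ℝ := volume.restrict (Set.Ioo (0 : ℝ) 1) with hμ
  set m : ℝ → ℝ → ENNReal := fun x y => ENNReal.ofReal (2 / (δ ^ 2 + (y - x) ^ 2)) with hm
  have hmm : Measurable (Function.uncurry m) := by
    simp only [hm, Function.uncurry_def]
    fun_prop
  set q : ℝ → ENNReal := fun x => ENNReal.ofReal (p.eval x ^ 2) with hq
  have hqm : Measurable q := by fun_prop
  set g : ℝ → ENNReal :=
    (Set.Ioo (0 : ℝ) 1).indicator fun z => ENNReal.ofReal (p.derivative.eval z ^ 2) with hg
  have hgm : Measurable g := Measurable.indicator (by fun_prop) measurableSet_Ioo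
  set κ : ℝ → ENNReal := (Set.Icc (-δ) δ).indicator (fun u => ENNReal.ofReal |u|⁻¹) with hκ
  set H : ℝ → ℝ → ENNReal := fun x y => κ (y - x) * ∫⁻ z in Set.uIcc x y, g z with hH
  have hfar : ∫⁻ x, ∫⁻ y, q x * m x y ∂μ ∂μ ≤ ENNReal.ofReal (2 * Real.pi / δ * A) := by
    calc ∫⁻ x, ∫⁻ y, q x * m x y ∂μ ∂μ
        ≤ ∫⁻ x, q x * ENNReal.ofReal (2 * Real.pi / δ) ∂μ := by
          refine lintegral_mono fun x => ?_
          rw [lintegral_const_mul _ (by fun_prop), ← lintegral_cauchy_kernel hδ x]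
          gcongr
          exact Measure.restrict_le_self
      _ = _ := by
          rw [lintegral_mul_const _ hqm, hμ, lintegral_Ioo_ofReal_sq, mul_comm,
            ← ENNReal.ofReal_mul (by positivity)]
  have hfar' : ∫⁻ x, ∫⁻ y, q y * m x y ∂μ ∂μ ≤ ENNReal.ofReal (2 * Real.pi / δ * A) := by
    rw [lintegral_lintegral_swap (by fun_prop)]
    refine le_of_eq_of_le ?_ hfar
    refine lintegral_congr fun y => lintegral_congr fun x => ?_
    simp only [hm]
    rw [← neg_sub, neg_sq]
  have hnear : ∫⁻ x, ∫⁻ y, H x y ∂μ ∂μ ≤ ENNReal.ofReal (2 * δ * B) := by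
    calc ∫⁻ x, ∫⁻ y, H x y ∂μ ∂μ ≤ ∫⁻ x, ∫⁻ y, H x y :=
          (lintegral_mono fun x => setLIntegral_le_lintegral _ (H x)).trans
            (setLIntegral_le_lintegral _ fun x => ∫⁻ y, H x y)
      _ ≤ ENNReal.ofReal (2 * δ) * ∫⁻ z, g z := lintegral_near_diagonal_le hgm δ
      _ = _ := by
          rw [hg, lintegral_indicator measurableSet_Ioo, lintegral_Ioo_ofReal_sq,
            ← ENNReal.ofReal_mul (by positivity)]
  have hpt : ∀ x ∈ Set.Ioo (0 : ℝ) 1, ∀ y ∈ Set.Ioo (0 : ℝ) 1,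
      ENNReal.ofReal ((p.eval x * η x - p.eval y * η y) ^ 2 / (x - y) ^ 2) ≤
        2 * (q x * m x y) + (2 * (q y * m x y) + 2 * H x y) := by
    intro x hx y hy
    refine (ENNReal.ofReal_le_ofReal
      (sq_sub_div_sq_le hδ (h1 x hx) (h1 y hy) (hη x y))).trans ?_
    have hsq : (x - y) ^ 2 = (y - x) ^ 2 := by ring
    refine ENNReal.ofReal_add_le.trans ?_
    refine (add_le_add_left ENNReal.ofReal_add_le _).trans ?_
    rw [add_assoc]
    refine add_le_add (le_of_eq ?_) (add_le_add (le_of_eq ?_) ?_)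
    · rw [ENNReal.ofReal_mul (by positivity), ENNReal.ofReal_mul (by positivity), hsq, mul_assoc]
      simp [hq, hm]
    · rw [ENNReal.ofReal_mul (by positivity), ENNReal.ofReal_mul (by positivity), hsq, mul_assoc]
      simp [hq, hm]
    · rw [ENNReal.ofReal_mul (by positivity), ENNReal.ofReal_ofNat]
      gcongr
      split_ifs with hd
      · have hmem : y - x ∈ Set.Icc (-δ) δ := by
          rw [abs_le] at hd
          exact ⟨by linarith [hd.2], by linarith [hd.1]⟩
        simp only [hH, hκ, Set.indicator_of_mem hmem]
        rw [abs_sub_comm y x, ENNReal.ofReal_mul (by positivity)]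
        gcongr
        have hgz : ∫⁻ z in Set.uIcc x y, g z =
            ∫⁻ z in Set.uIcc x y, ENNReal.ofReal (p.derivative.eval z ^ 2) := by
          refine setLIntegral_congr_fun measurableSet_uIcc fun z hz => ?_
          have : z ∈ Set.Ioo (0 : ℝ) 1 := Set.ordConnected_Ioo.uIcc_subset hx hy hz
          simp only [hg, Set.indicator_of_mem this]
        rw [hgz, ENNReal.ofReal_mul (by positivity)]
        refine (mul_le_mul_right (p.sq_eval_sub_le x y) _).trans ?_
        rw [← mul_assoc, ← ENNReal.ofReal_mul (by positivity)]
        refine mul_le_of_le_one_left zero_le ?_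
        rw [ENNReal.ofReal_le_one]
        exact inv_mul_le_one
      · simp
  calc _ ≤ ∫⁻ x, ∫⁻ y, (2 * (q x * m x y) + (2 * (q y * m x y) + 2 * H x y)) ∂μ ∂μ :=
        setLIntegral_mono' measurableSet_Ioo fun x hx =>
          setLIntegral_mono' measurableSet_Ioo fun y hy => hpt x hx y hy
    _ = 2 * ∫⁻ x, ∫⁻ y, q x * m x y ∂μ ∂μ + (2 * ∫⁻ x, ∫⁻ y, q y * m x y ∂μ ∂μ +
          2 * ∫⁻ x, ∫⁻ y, H x y ∂μ ∂μ) := by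
        have e : ∀ x, ∫⁻ y, (2 * (q x * m x y) + (2 * (q y * m x y) + 2 * H x y)) ∂μ =
            2 * ∫⁻ y, q x * m x y ∂μ + (2 * ∫⁻ y, q y * m x y ∂μ + 2 * ∫⁻ y, H x y ∂μ) := by
          intro x
          rw [lintegral_add_left (by fun_prop), lintegral_add_left (by fun_prop),
            lintegral_const_mul' 2 _ (by simp), lintegral_const_mul' 2 _ (by simp),
            lintegral_const_mul' 2 _ (by simp)]
        simp only [e]
        have m1 : Measurable fun x => ∫⁻ y, q x * m x y ∂μ :=
          Measurable.lintegral_prod_right' (f := fun w : ℝ × ℝ => q w.1 * m w.1 w.2) (by fun_prop)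
        have m2 : Measurable fun x => ∫⁻ y, q y * m x y ∂μ :=
          Measurable.lintegral_prod_right' (f := fun w : ℝ × ℝ => q w.2 * m w.1 w.2) (by fun_prop)
        rw [lintegral_add_left (by fun_prop), lintegral_add_left (by fun_prop),
            lintegral_const_mul' 2 _ (by simp), lintegral_const_mul' 2 _ (by simp),
            lintegral_const_mul' 2 _ (by simp)]
    _ ≤ 2 * ENNReal.ofReal (2 * Real.pi / δ * A) + (2 * ENNReal.ofReal (2 * Real.pi / δ * A) +
          2 * ENNReal.ofReal (2 * δ * B)) := by gcongr
    _ = _ := by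
        have e2 : (2 : ENNReal) = ENNReal.ofReal 2 := by simp
        rw [e2, ← ENNReal.ofReal_mul (by positivity), ← ENNReal.ofReal_mul (by positivity),
          ← ENNReal.ofReal_add (by positivity) (by positivity),
          ← ENNReal.ofReal_add (by positivity) (by positivity)]
        congr 1
        ring

lemma gagHalf_of_lintegral_le {φ : ℝ → ℝ} (hφ : Measurable φ) {h K : ℝ} (hK : 0 ≤ K)
    (hle : ∫⁻ x in Set.Ioo (0 : ℝ) h, ∫⁻ y in Set.Ioo (0 : ℝ) h,
      ENNReal.ofReal ((φ x - φ y) ^ 2 / (x - y) ^ 2) ≤ ENNReal.ofReal K) :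
    gagHalfFinite h φ ∧ gagHalfSq h φ ≤ K := by
  have hm : Measurable fun q : ℝ × ℝ => (φ q.1 - φ q.2) ^ 2 / (q.1 - q.2) ^ 2 := by fun_prop
  have hnn : ∀ q : ℝ × ℝ, 0 ≤ (φ q.1 - φ q.2) ^ 2 / (q.1 - q.2) ^ 2 := fun q => by positivity
  have hle' : ∫⁻ q in Set.Ioo (0 : ℝ) h ×ˢ Set.Ioo (0 : ℝ) h,
      ENNReal.ofReal ((φ q.1 - φ q.2) ^ 2 / (q.1 - q.2) ^ 2) ∂(volume.prod volume) ≤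
      ENNReal.ofReal K := by
    rw [← Measure.prod_restrict, lintegral_prod _ (by fun_prop)]
    exact hle
  have hint : gagHalfFinite h φ := by
    refine ⟨hm.aestronglyMeasurable, ?_⟩
    rw [hasFiniteIntegral_iff_ofReal (Filter.Eventually.of_forall hnn)]
    exact hle'.trans_lt ENNReal.ofReal_lt_top
  refine ⟨hint, ?_⟩
  have heq : gagHalfSq h φ = ∫ q in Set.Ioo (0 : ℝ) h ×ˢ Set.Ioo (0 : ℝ) h,
      (φ q.1 - φ q.2) ^ 2 / (q.1 - q.2) ^ 2 ∂(volume.prod volume) :=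
    (setIntegral_prod _ hint).symm
  rw [heq, integral_eq_lintegral_of_nonneg_ae (Filter.Eventually.of_forall hnn)
    hm.aestronglyMeasurable]
  exact ENNReal.toReal_le_of_le_ofReal hK hle'

/-- The piecewise linear cutoff on `(0,1)` with transition layers of width `δ`. -/
noncomputable def layerCutoff (δ x : ℝ) : ℝ := min 1 (min (x / δ) ((1 - x) / δ))

lemma continuous_layerCutoff (δ : ℝ) : Continuous (layerCutoff δ) := by
  unfold layerCutoff
  fun_prop

lemma layerCutoff_nonneg {δ x : ℝ} (hδ : 0 < δ) (hx : x ∈ Set.Ioo (0 : ℝ) 1) :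
    0 ≤ layerCutoff δ x :=
  le_min zero_le_one (le_min (div_nonneg hx.1.le hδ.le)
    (div_nonneg (by linarith [hx.2]) hδ.le))

lemma layerCutoff_le_one (δ x : ℝ) : layerCutoff δ x ≤ 1 := min_le_left _ _

lemma abs_layerCutoff_sub_le {δ : ℝ} (hδ : 0 < δ) (x y : ℝ) :
    |layerCutoff δ x - layerCutoff δ y| ≤ |x - y| / δ := by
  unfold layerCutoff
  have h1 : |x / δ - y / δ| = |x - y| / δ := by
    rw [← sub_div, abs_div, abs_of_pos hδ]
  have h2 : |(1 - x) / δ - (1 - y) / δ| = |x - y| / δ := by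
    rw [← sub_div, abs_div, abs_of_pos hδ, sub_sub_sub_cancel_left, abs_sub_comm]
  refine (abs_min_sub_min_le_max _ _ _ _).trans (max_le (by simp; positivity) ?_)
  refine (abs_min_sub_min_le_max _ _ _ _).trans ?_
  rw [h1, h2, max_self]

lemma one_sub_layerCutoff_le {δ x : ℝ} (hδ : 0 < δ) (hx : x ∈ Set.Ioo (0 : ℝ) 1) :
    1 - layerCutoff δ x ≤
      (Set.Iio δ).indicator 1 x + (Set.Ioi (1 - δ)).indicator 1 x := by
  have h0 := layerCutoff_nonneg hδ hx
  have i1 : (0 : ℝ) ≤ (Set.Iio δ).indicator 1 x := Set.indicator_nonneg (by simp) x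
  have i2 : (0 : ℝ) ≤ (Set.Ioi (1 - δ)).indicator 1 x := Set.indicator_nonneg (by simp) x
  by_cases h1 : x ∈ Set.Iio δ
  · rw [Set.indicator_of_mem h1, Pi.one_apply]
    linarith
  by_cases h2 : x ∈ Set.Ioi (1 - δ)
  · rw [Set.indicator_of_mem h2, Pi.one_apply]
    linarith
  have : layerCutoff δ x = 1 := by
    rw [Set.mem_Iio, not_lt] at h1
    rw [Set.mem_Ioi, not_lt] at h2
    refine min_eq_left (le_min ?_ ?_)
    · rwa [one_le_div hδ]
    · rw [one_le_div hδ]; linarith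
  linarith

lemma integral_Ioo_one_sub_layerCutoff_le {δ : ℝ} (hδ : 0 < δ) :
    ∫ x in Set.Ioo (0 : ℝ) 1, (1 - layerCutoff δ x) ≤ 2 * δ := by
  have hc := continuous_layerCutoff δ
  have hi : ∀ s : Set ℝ, MeasurableSet s →
      IntegrableOn (s.indicator (1 : ℝ → ℝ)) (Set.Ioo (0 : ℝ) 1) := fun s hs =>
    IntegrableOn.indicator (integrableOn_const (by simp)) hs
  calc ∫ x in Set.Ioo (0 : ℝ) 1, (1 - layerCutoff δ x)
      ≤ ∫ x in Set.Ioo (0 : ℝ) 1,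
          ((Set.Iio δ).indicator (1 : ℝ → ℝ) x + (Set.Ioi (1 - δ)).indicator (1 : ℝ → ℝ) x) := by
        apply setIntegral_mono_on _ ((hi _ measurableSet_Iio).add (hi _ measurableSet_Ioi))
          measurableSet_Ioo fun x hx => one_sub_layerCutoff_le hδ hx
        exact ((by fun_prop : Continuous fun x => 1 - layerCutoff δ x).integrableOn_Icc).mono_set
          Set.Ioo_subset_Icc_self
    _ ≤ δ + δ := by
        rw [integral_add (hi _ measurableSet_Iio) (hi _ measurableSet_Ioi),
          setIntegral_indicator measurableSet_Iio, setIntegral_indicator measurableSet_Ioi,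
          Set.Ioo_inter_Iio, Set.Ioo_inter_Ioi]
        simp only [Pi.one_apply, integral_const, smul_eq_mul, mul_one,
          measureReal_restrict_apply_univ, Real.volume_real_Ioo]
        gcongr
        · exact max_le (by simp) hδ.le
        · refine max_le ?_ hδ.le
          linarith [le_max_right 0 (1 - δ)]
    _ = 2 * δ := by ring

lemma sq_mul_layerCutoff_div_le {δ a x : ℝ} (hδ : 0 < δ) (hx : x ∈ Set.Ioo (0 : ℝ) 1) :
    (a * layerCutoff δ x) ^ 2 / x ≤ δ⁻¹ * a ^ 2 ∧
      (a * layerCutoff δ x) ^ 2 / (1 - x) ≤ δ⁻¹ * a ^ 2 := by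
  have h0 := layerCutoff_nonneg hδ hx
  have h1 := layerCutoff_le_one δ x
  have hsq : layerCutoff δ x ^ 2 ≤ layerCutoff δ x := by nlinarith
  have hl : layerCutoff δ x ≤ x / δ := (min_le_right _ _).trans (min_le_left _ _)
  have hr : layerCutoff δ x ≤ (1 - x) / δ := (min_le_right _ _).trans (min_le_right _ _)
  have key : ∀ w : ℝ, 0 < w → layerCutoff δ x ≤ w / δ →
      (a * layerCutoff δ x) ^ 2 / w ≤ δ⁻¹ * a ^ 2 := by
    intro w hw h
    rw [div_le_iff₀ hw, mul_pow]
    calc a ^ 2 * layerCutoff δ x ^ 2 ≤ a ^ 2 * (w / δ) := by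
          gcongr
          exact hsq.trans h
      _ = _ := by ring
  exact ⟨key x hx.1 hl, key (1 - x) (by linarith [hx.2]) hr⟩

lemma integral_Ioo_div_le {u v w : ℝ → ℝ} (hu : Measurable u) (hv : Continuous v)
    (hw : Measurable w) (hpos : ∀ x ∈ Set.Ioo (0 : ℝ) 1, 0 < w x)
    (h : ∀ x ∈ Set.Ioo (0 : ℝ) 1, u x ^ 2 / w x ≤ v x) :
    IntegrableOn (fun x => u x ^ 2 / w x) (Set.Ioo (0 : ℝ) 1) ∧
      ∫ x in Set.Ioo (0 : ℝ) 1, u x ^ 2 / w x ≤ ∫ x in (0 : ℝ)..1, v x := by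
  have hvi : IntegrableOn v (Set.Ioo (0 : ℝ) 1) :=
    hv.integrableOn_Icc.mono_set Set.Ioo_subset_Icc_self
  have hi : IntegrableOn (fun x => u x ^ 2 / w x) (Set.Ioo (0 : ℝ) 1) := by
    refine Integrable.mono' hvi (by fun_prop : Measurable _).aestronglyMeasurable ?_
    refine (ae_restrict_iff' measurableSet_Ioo).2 (Filter.Eventually.of_forall fun x hx => ?_)
    rw [Real.norm_of_nonneg (div_nonneg (sq_nonneg _) (hpos x hx).le)]
    exact h x hx
  refine ⟨hi, ?_⟩
  rw [intervalIntegral.integral_of_le zero_le_one, integral_Ioc_eq_integral_Ioo]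
  exact setIntegral_mono_on hi hvi measurableSet_Ioo h

theorem stmt_4 : ∃ C : ℝ, 0 < C ∧ ∀ k : ℕ, 1 ≤ k → ∀ p : Polynomial ℝ, p.natDegree ≤ k →
    ∀ N : ℝ, 0 ≤ N →
    (∀ ψ : ℝ → ℝ, Measurable ψ → H1200Finite 1 ψ →
      (∫ x in Set.Ioo (0:ℝ) 1, p.eval x * ψ x) ≤ N * Real.sqrt (H1200NormSq 1 ψ)) →
    Real.sqrt (∫ x in Set.Ioo (0:ℝ) 1, p.eval x ^ 2) ≤ C * (k : ℝ) * N := by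
  refine ⟨250, by norm_num, fun k hk p hp N hN hdual => ?_⟩
  have hk' : (1 : ℝ) ≤ k := by exact_mod_cast hk
  have hI : ∀ f : ℝ → ℝ, ∫ x in Set.Ioo (0 : ℝ) 1, f x = ∫ x in (0 : ℝ)..1, f x := fun f => by
    rw [intervalIntegral.integral_of_le zero_le_one, integral_Ioc_eq_integral_Ioo]
  rw [hI]
  set A := ∫ x in (0 : ℝ)..1, p.eval x ^ 2 with hAdef
  have hA0 : 0 ≤ A := intervalIntegral.integral_nonneg zero_le_one fun x _ => sq_nonneg _
  rcases hA0.eq_or_lt with hA | hA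
  · rw [← hA, Real.sqrt_zero]
    positivity
  set B := ∫ x in (0 : ℝ)..1, p.derivative.eval x ^ 2
  have hB0 : 0 ≤ B := intervalIntegral.integral_nonneg zero_le_one fun x _ => sq_nonneg _
  have hB : B ≤ 128 * (k : ℝ) ^ 4 * A := Polynomial.integral_derivative_sq_le hp hA
  set δ : ℝ := 1 / (520 * (k : ℝ) ^ 2) with hδdef
  have hδ : 0 < δ := by positivity
  have hηc := continuous_layerCutoff δ
  set ψ : ℝ → ℝ := fun x => p.eval x * layerCutoff δ x with hψ
  have hψc : Continuous ψ := by fun_prop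
  obtain ⟨hgf, hg⟩ := gagHalf_of_lintegral_le (φ := ψ) hψc.measurable
    (by positivity : 0 ≤ 8 * Real.pi / δ * A + 4 * δ * B)
    (lintegral_gagliardo_mul_le p hδ
      (fun x hx => abs_le.2 ⟨by linarith [layerCutoff_nonneg hδ hx], layerCutoff_le_one δ x⟩)
      (abs_layerCutoff_sub_le hδ))
  obtain ⟨hlf, hl⟩ := integral_Ioo_div_le (v := fun x => δ⁻¹ * p.eval x ^ 2) hψc.measurable
    (by fun_prop) measurable_id (fun x hx => hx.1)
    (fun x hx => (sq_mul_layerCutoff_div_le hδ hx).1)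
  obtain ⟨hrf, hr⟩ := integral_Ioo_div_le (v := fun x => δ⁻¹ * p.eval x ^ 2) hψc.measurable
    (by fun_prop) (measurable_id.const_sub 1) (fun x hx => sub_pos.2 hx.2)
    (fun x hx => (sq_mul_layerCutoff_div_le hδ hx).2)
  rw [intervalIntegral.integral_const_mul, ← hAdef] at hl hr
  have hnorm : H1200NormSq 1 ψ ≤ (125 * k) ^ 2 * A := by
    have hδi : δ⁻¹ = 520 * (k : ℝ) ^ 2 := by rw [hδdef, one_div, inv_inv]
    have hδB : 4 * δ * B ≤ 4 * δ * (128 * (k : ℝ) ^ 4 * A) := by gcongr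
    have hδk : 4 * δ * (128 * (k : ℝ) ^ 4 * A) = 512 / 520 * ((k : ℝ) ^ 2 * A) := by
      rw [hδdef]; field_simp; norm_num
    have hpi : 8 * Real.pi / δ * A = 4160 * Real.pi * ((k : ℝ) ^ 2 * A) := by
      rw [div_eq_mul_inv, hδi]; ring
    have hkA : 0 ≤ (k : ℝ) ^ 2 * A := by positivity
    have hpi' : 4160 * Real.pi * ((k : ℝ) ^ 2 * A) ≤ 4160 * 3.15 * ((k : ℝ) ^ 2 * A) := by
      gcongr
      exact Real.pi_lt_d2.le
    rw [hδi] at hl hr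
    have h3 : H1200NormSq 1 ψ ≤ (8 * Real.pi / δ * A + 4 * δ * B) + 520 * (k : ℝ) ^ 2 * A +
        520 * (k : ℝ) ^ 2 * A := add_le_add (add_le_add hg hl) hr
    linarith
  have hlow : A / 2 ≤ ∫ x in Set.Ioo (0 : ℝ) 1, p.eval x * ψ x := by
    have hic : ∀ {f : ℝ → ℝ}, Continuous f → IntegrableOn f (Set.Ioo (0 : ℝ) 1) := fun hf =>
      hf.integrableOn_Icc.mono_set Set.Ioo_subset_Icc_self
    have h1 : ∫ x in Set.Ioo (0 : ℝ) 1, p.eval x ^ 2 * (1 - layerCutoff δ x) ≤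
        ∫ x in Set.Ioo (0 : ℝ) 1, 130 * (k : ℝ) ^ 2 * A * (1 - layerCutoff δ x) := by
      refine setIntegral_mono_on (hic (by fun_prop)) (hic (by fun_prop)) measurableSet_Ioo
        fun x hx => ?_
      exact mul_le_mul_of_nonneg_right
        (Polynomial.eval_sq_le hk hp hA (Set.Ioo_subset_Icc_self hx))
        (sub_nonneg.2 (layerCutoff_le_one δ x))
    have h2 : 130 * (k : ℝ) ^ 2 * A * (2 * δ) = A / 2 := by
      rw [hδdef]; field_simp; norm_num
    have h3 : ∫ x in Set.Ioo (0 : ℝ) 1, p.eval x ^ 2 * (1 - layerCutoff δ x) =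
        A - ∫ x in Set.Ioo (0 : ℝ) 1, p.eval x * ψ x := by
      rw [hAdef, ← hI, ← integral_sub (hic (by fun_prop)) (hic (by fun_prop))]
      congr 1
      ext x
      simp only [hψ]
      ring
    rw [integral_const_mul, h3] at h1
    have h4 := mul_le_mul_of_nonneg_left (integral_Ioo_one_sub_layerCutoff_le hδ)
      (by positivity : 0 ≤ 130 * (k : ℝ) ^ 2 * A)
    linarith
  have hfin := hlow.trans (hdual ψ hψc.measurable ⟨hgf, hlf, hrf⟩)
  have hsq : Real.sqrt (H1200NormSq 1 ψ) ≤ 125 * k * Real.sqrt A := by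
    refine (Real.sqrt_le_sqrt hnorm).trans_eq ?_
    rw [Real.sqrt_mul (by positivity), Real.sqrt_sq (by positivity)]
  have hsA : 0 < Real.sqrt A := Real.sqrt_pos.2 hA
  have hfin' : A / 2 ≤ N * (125 * k * Real.sqrt A) :=
    hfin.trans (mul_le_mul_of_nonneg_left hsq hN)
  refine le_of_mul_le_mul_right ?_ hsA
  rw [Real.mul_self_sqrt hA0]
  linarith
end

section
/- There exists a constant C > 0 such that for every integer k ≥ 1, every real polynomial p of degree at most k, and every N ≥ 0 the following holds: if ∫₀¹ p v ≤ N (∫₀¹ v'(x)² dx)^{1/2} for every Lipschitz function v : [0,1] → ℝ with v(0) = v(1) = 0, then for every measurable ψ : (0,1) → ℝ with finite ‖ψ‖_{H^{1/2}_{00}(I)} one has ∫₀¹ p ψ ≤ C k N ‖ψ‖_{H^{1/2}_{00}(I)}. (Inverse inequality ‖p‖_{(H^{1/2}_{00}(I))'} ≲ k ‖p‖_{(H¹₀(I))'}, i.e. the case s = 1 of the inverse inequalities in negative Sobolev norms.) -/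
open MeasureTheory

namespace Polynomial

/-- The integral of a real polynomial over the unit interval. -/
noncomputable def unitIntegral (q : ℝ[X]) : ℝ := ∫ x in (0:ℝ)..1, q.eval x

/-- The weight `x (1 - x)` of the unit interval. -/
noncomputable def unitWeight : ℝ[X] := X * (1 - X)

lemma intervalIntegrable_eval (q : ℝ[X]) (a b : ℝ) :
    IntervalIntegrable (fun x => q.eval x) volume a b :=
  q.continuous.intervalIntegrable a b

lemma unitIntegral_add (p q : ℝ[X]) :
    unitIntegral (p + q) = unitIntegral p + unitIntegral q := by
  simp only [unitIntegral, eval_add]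
  exact intervalIntegral.integral_add (p.intervalIntegrable_eval 0 1)
    (q.intervalIntegrable_eval 0 1)

lemma unitIntegral_C_mul (a : ℝ) (q : ℝ[X]) :
    unitIntegral (C a * q) = a * unitIntegral q := by
  simp [unitIntegral]

lemma unitIntegral_nonneg {q : ℝ[X]} (h : ∀ x ∈ Set.Icc (0:ℝ) 1, 0 ≤ q.eval x) :
    0 ≤ unitIntegral q :=
  intervalIntegral.integral_nonneg zero_le_one h

lemma unitIntegral_derivative (q : ℝ[X]) :
    unitIntegral (derivative q) = q.eval 1 - q.eval 0 :=
  intervalIntegral.integral_eq_sub_of_hasDerivAt (fun x _ => q.hasDerivAt x)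
    ((derivative q).intervalIntegrable_eval 0 1)

lemma unitIntegral_eq_setIntegral (q : ℝ[X]) :
    unitIntegral q = ∫ x in Set.Ioo (0:ℝ) 1, q.eval x := by
  rw [unitIntegral, intervalIntegral.integral_of_le zero_le_one, integral_Ioc_eq_integral_Ioo]

lemma unitIntegral_mul_sq_nonneg (m : ℕ) (q : ℝ[X]) :
    0 ≤ unitIntegral (unitWeight ^ m * q ^ 2) := by
  refine unitIntegral_nonneg fun x hx => ?_
  have h : 0 ≤ x * (1 - x) := mul_nonneg hx.1 (by linarith [hx.2])
  simp only [unitWeight, eval_mul, eval_pow, eval_sub, eval_X, eval_one]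
  positivity

lemma derivative_unitWeight : derivative unitWeight = 1 - C 2 * X := by
  simp only [unitWeight, derivative_mul, derivative_X, derivative_sub, derivative_one,
    show (C 2 : ℝ[X]) = 2 from rfl]
  ring

lemma derivative_unitWeight_pow_succ_mul (m : ℕ) (q : ℝ[X]) :
    derivative (unitWeight ^ (m + 1) * q) =
      unitWeight ^ m * (C ((m : ℝ) + 1) * (1 - C 2 * X) * q + unitWeight * derivative q) := by
  simp only [derivative_mul, derivative_pow_succ, derivative_unitWeight]
  simp only [map_add, map_natCast, map_one]
  ring

lemma unitIntegral_derivative_unitWeight_pow_succ_mul (m : ℕ) (q : ℝ[X]) :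
    unitIntegral (derivative (unitWeight ^ (m + 1) * q)) = 0 := by
  rw [unitIntegral_derivative]
  simp [unitWeight]

/-- Weighted Markov inequality with Gegenbauer weights on the unit interval. -/
theorem unitIntegral_weighted_derivative_sq_le (n : ℕ) : ∀ (m : ℕ) (P : ℝ[X]),
    P.natDegree ≤ n →
    unitIntegral (unitWeight ^ (m + 1) * derivative P ^ 2) ≤
      (n : ℝ) * (n + 2 * m + 1) * unitIntegral (unitWeight ^ m * P ^ 2) := by
  induction n with
  | zero =>
    intro m P hP
    rw [derivative_of_natDegree_zero (Nat.le_zero.mp hP)]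
    simp [unitIntegral]
  | succ n ih =>
    intro m P hP
    have hIH := ih (m + 1) (derivative P) ((natDegree_derivative_le P).trans (by omega))
    set G : ℝ[X] := C ((m : ℝ) + 1) * (1 - C 2 * X) * derivative P
      + unitWeight * derivative (derivative P) with hG
    set A := unitIntegral (unitWeight ^ (m + 1) * derivative P ^ 2)
    set B := unitIntegral (unitWeight ^ m * P ^ 2)
    set D := unitIntegral (unitWeight ^ (m + 1 + 1) * derivative (derivative P) ^ 2)
    have hGP : unitIntegral (unitWeight ^ m * (G * P)) + A = 0 := by
      rw [← unitIntegral_add, ← unitIntegral_derivative_unitWeight_pow_succ_mul m (derivative P * P)]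
      congr 1
      rw [derivative_unitWeight_pow_succ_mul, derivative_mul, hG]
      ring
    have hGG : unitIntegral (unitWeight ^ m * G ^ 2) = D + 2 * (m + 1) * A := by
      have hdG : derivative G = C ((m : ℝ) + 2) * (1 - C 2 * X) * derivative (derivative P)
          + unitWeight * derivative (derivative (derivative P))
          - C (2 * ((m : ℝ) + 1)) * derivative P := by
        rw [hG]
        simp only [derivative_mul, derivative_unitWeight, derivative_C,
          derivative_sub, derivative_one, derivative_X, map_add, map_mul, map_one,
          show (C 2 : ℝ[X]) = 2 from rfl]
        simp only [map_natCast, derivative_ofNat]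
        ring
      have h₁ := unitIntegral_derivative_unitWeight_pow_succ_mul m (derivative P * G)
      have h₂ := unitIntegral_derivative_unitWeight_pow_succ_mul (m + 1)
        (derivative P * derivative (derivative P))
      have h₃ : derivative (unitWeight ^ (m + 1) * (derivative P * G)) +
          (unitWeight ^ (m + 1 + 1) * derivative (derivative P) ^ 2 +
            C (2 * ((m : ℝ) + 1)) * (unitWeight ^ (m + 1) * derivative P ^ 2)) =
          unitWeight ^ m * G ^ 2 + derivative (unitWeight ^ (m + 1 + 1) *
            (derivative P * derivative (derivative P))) := by
        rw [derivative_unitWeight_pow_succ_mul, derivative_unitWeight_pow_succ_mul,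
          derivative_mul, derivative_mul, hdG, hG]
        simp only [map_add, map_mul, map_natCast, map_one, Nat.cast_add, Nat.cast_one,
          show (C 2 : ℝ[X]) = 2 from rfl]
        ring
      have h₄ := congrArg unitIntegral h₃
      simp only [unitIntegral_add, unitIntegral_C_mul, h₁, h₂] at h₄
      linarith
    set t : ℝ := ((n + 1 : ℕ) : ℝ) * ((n + 1 : ℕ) + 2 * m + 1) with ht
    have htpos : 0 < t := by positivity
    have hsq : 0 ≤ unitIntegral (unitWeight ^ m * G ^ 2)
        + (2 * t * unitIntegral (unitWeight ^ m * (G * P)) + t ^ 2 * B) := by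
      have h := unitIntegral_mul_sq_nonneg m (G + C t * P)
      rw [← unitIntegral_C_mul, ← unitIntegral_C_mul, ← unitIntegral_add, ← unitIntegral_add]
      convert h using 2
      simp only [map_mul, map_pow, show (C 2 : ℝ[X]) = 2 from rfl]
      ring
    have hD : D + 2 * (m + 1) * A ≤ t * A := by
      have : t * A = n * (n + 2 * ((m + 1 : ℕ) : ℝ) + 1) * A + 2 * (m + 1) * A := by
        rw [ht]; push_cast; ring
      linarith
    have : 0 ≤ t * (t * B - A) := by
      rw [hGG, eq_neg_of_add_eq_zero_left hGP] at hsq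
      nlinarith
    linarith [nonneg_of_mul_nonneg_right this htpos]

lemma exists_derivative_eq_natDegree_le (p : ℝ[X]) :
    ∃ Q : ℝ[X], derivative Q = p ∧ Q.natDegree ≤ p.natDegree + 1 := by
  refine ⟨∑ i ∈ Finset.range (p.natDegree + 1), C (p.coeff i / ((i : ℝ) + 1)) * X ^ (i + 1), ?_, ?_⟩
  · conv_rhs => rw [p.as_sum_range_C_mul_X_pow]
    rw [derivative_sum]
    refine Finset.sum_congr rfl fun i _ => ?_
    rw [derivative_C_mul_X_pow, Nat.add_sub_cancel]
    push_cast
    rw [div_mul_cancel₀ _ (by positivity)]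
  · refine natDegree_sum_le_of_forall_le _ _ fun i hi => (natDegree_C_mul_X_pow_le _ _).trans ?_
    have := Finset.mem_range.mp hi
    omega

lemma lipschitzOnWith_eval_Icc (p : ℝ[X]) (a b : ℝ) :
    ∃ L : NNReal, LipschitzOnWith L (fun x => p.eval x) (Set.Icc a b) := by
  have h : ContDiff ℝ 1 (fun x => p.eval x) := p.contDiff_aeval 1
  exact h.contDiffOn.exists_lipschitzOnWith one_ne_zero (convex_Icc a b) isCompact_Icc

/-- A polynomial that is bounded by `N` in the dual norm of `H¹₀(0,1)` is the derivative of a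
polynomial of `L²` norm at most `N`. -/
lemma exists_derivative_eq_unitIntegral_sq_le {p : ℝ[X]} {N : ℝ}
    (h : ∀ v : ℝ → ℝ, (∃ L : NNReal, LipschitzOnWith L v (Set.Icc 0 1)) →
      v 0 = 0 → v 1 = 0 →
      (∫ x in Set.Ioo (0:ℝ) 1, p.eval x * v x) ≤
        N * Real.sqrt (∫ x in Set.Ioo (0:ℝ) 1, deriv v x ^ 2)) :
    ∃ P : ℝ[X], derivative P = p ∧ P.natDegree ≤ p.natDegree + 1 ∧
      unitIntegral (P ^ 2) ≤ N ^ 2 := by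
  obtain ⟨Q, hQ, hQdeg⟩ := exists_derivative_eq_natDegree_le p
  set P := Q - C (unitIntegral Q) with hPdef
  have hP : derivative P = p := by simp [hPdef, hQ]
  have hPmean : unitIntegral P = 0 := by
    have : P = Q + C (-unitIntegral Q) * 1 := by simp [hPdef, sub_eq_add_neg]
    rw [this, unitIntegral_add, unitIntegral_C_mul]
    simp [unitIntegral]
  obtain ⟨S, hS, -⟩ := exists_derivative_eq_natDegree_le (-P)
  set R := S - C (S.eval 0) with hRdef
  have hR : derivative R = -P := by simp [hRdef, hS]
  have hR0 : R.eval 0 = 0 := by simp [hRdef]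
  have hR1 : R.eval 1 = 0 := by
    have h₁ := unitIntegral_derivative R
    have h₂ := unitIntegral_C_mul (-1) P
    simp only [map_neg, map_one, neg_mul, one_mul, hPmean, neg_zero] at h₂
    rw [hR, h₂, hR0] at h₁
    linarith
  refine ⟨P, hP, (natDegree_sub_C).trans_le hQdeg, ?_⟩
  have key := h (fun x => R.eval x) (R.lipschitzOnWith_eval_Icc 0 1) hR0 hR1
  have hl : ∫ x in Set.Ioo (0:ℝ) 1, p.eval x * R.eval x = unitIntegral (P ^ 2) := by
    have h₁ := unitIntegral_derivative (P * R)
    have h₂ : p * R = derivative (P * R) + P ^ 2 := by rw [derivative_mul, hP, hR]; ring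
    simp only [eval_mul, hR0, hR1, mul_zero, sub_zero] at h₁
    simp only [← eval_mul]
    rw [← unitIntegral_eq_setIntegral, h₂, unitIntegral_add, h₁, zero_add]
  have hr : ∫ x in Set.Ioo (0:ℝ) 1, deriv (fun x => R.eval x) x ^ 2 = unitIntegral (P ^ 2) := by
    simp only [unitIntegral_eq_setIntegral, Polynomial.deriv, hR, eval_neg, eval_pow, neg_sq]
  rw [hl, hr] at key
  have hE : 0 ≤ unitIntegral (P ^ 2) := by simpa using unitIntegral_mul_sq_nonneg 0 P
  have hs := Real.sq_sqrt hE
  have hs0 := Real.sqrt_nonneg (unitIntegral (P ^ 2))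
  nlinarith [sq_nonneg (N - √(unitIntegral (P ^ 2)))]

/-- Cauchy–Schwarz inequality with the weight `x (1 - x)` on the unit interval. -/
lemma setIntegral_eval_mul_le_sqrt_mul_sqrt (p : ℝ[X]) {ψ : ℝ → ℝ} (hψ : Measurable ψ)
    (h₀ : IntegrableOn (fun x => ψ x ^ 2 / x) (Set.Ioo (0:ℝ) 1))
    (h₁ : IntegrableOn (fun x => ψ x ^ 2 / (1 - x)) (Set.Ioo (0:ℝ) 1)) :
    (∫ x in Set.Ioo (0:ℝ) 1, p.eval x * ψ x) ≤ √(unitIntegral (unitWeight * p ^ 2)) *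
      √((∫ x in Set.Ioo (0:ℝ) 1, ψ x ^ 2 / x) + ∫ x in Set.Ioo (0:ℝ) 1, ψ x ^ 2 / (1 - x)) := by
  have hw : IntegrableOn (fun x => (unitWeight * p ^ 2).eval x) (Set.Ioo (0:ℝ) 1) :=
    ((unitWeight * p ^ 2).continuous.integrableOn_Icc).mono_set Set.Ioo_subset_Icc_self
  have hpt : ∀ t : ℝ, ∀ x ∈ Set.Ioo (0:ℝ) 1, 0 ≤ (unitWeight * p ^ 2).eval x * (t * t)
      + 2 * t * (p.eval x * ψ x) + (ψ x ^ 2 / x + ψ x ^ 2 / (1 - x)) := by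
    rintro t x ⟨hx0, hx1⟩
    have hx1' : 0 < 1 - x := by linarith
    have : (unitWeight * p ^ 2).eval x * (t * t) + 2 * t * (p.eval x * ψ x)
        + (ψ x ^ 2 / x + ψ x ^ 2 / (1 - x)) =
        (x * (1 - x) * p.eval x * t + ψ x) ^ 2 / (x * (1 - x)) := by
      simp only [unitWeight, eval_mul, eval_pow, eval_sub, eval_X, eval_one]
      field_simp
      ring
    rw [this]
    positivity
  have hpψ : IntegrableOn (fun x => p.eval x * ψ x) (Set.Ioo (0:ℝ) 1) := by
    refine Integrable.mono' (hw.add (h₀.add h₁))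
      (p.continuous.measurable.mul hψ).aestronglyMeasurable ?_
    filter_upwards [ae_restrict_mem measurableSet_Ioo] with x hx
    have hp := hpt 1 x hx
    have hm := hpt (-1) x hx
    have hz := hpt 0 x hx
    have hwx : 0 ≤ (unitWeight * p ^ 2).eval x := by
      have : 0 ≤ x * (1 - x) := mul_nonneg hx.1.le (by linarith [hx.2])
      simp only [unitWeight, eval_mul, eval_pow, eval_sub, eval_X, eval_one]
      positivity
    simp only [Real.norm_eq_abs, Pi.add_apply]
    rw [abs_le]
    constructor <;> linarith
  set A := unitIntegral (unitWeight * p ^ 2)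
  set X' := ∫ x in Set.Ioo (0:ℝ) 1, p.eval x * ψ x
  have hquad : ∀ t : ℝ, 0 ≤ A * (t * t) + 2 * X' * t + ((∫ x in Set.Ioo (0:ℝ) 1, ψ x ^ 2 / x)
      + ∫ x in Set.Ioo (0:ℝ) 1, ψ x ^ 2 / (1 - x)) := by
    intro t
    have h := setIntegral_nonneg measurableSet_Ioo (hpt t) (μ := volume)
    have hi : IntegrableOn (fun x => (unitWeight * p ^ 2).eval x * (t * t)
        + 2 * t * (p.eval x * ψ x)) (Set.Ioo (0:ℝ) 1) := (hw.mul_const _).add (hpψ.const_mul _)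
    have hj : IntegrableOn (fun x => ψ x ^ 2 / x + ψ x ^ 2 / (1 - x)) (Set.Ioo (0:ℝ) 1) :=
      h₀.add h₁
    rw [integral_add hi hj, integral_add (hw.mul_const _) (hpψ.const_mul _), integral_add h₀ h₁,
      integral_mul_const, integral_const_mul, ← unitIntegral_eq_setIntegral] at h
    linarith
  have hd := discrim_le_zero hquad
  have hA0 : 0 ≤ A := by simpa using unitIntegral_mul_sq_nonneg 1 p
  rw [← Real.sqrt_mul hA0]
  refine Real.le_sqrt_of_sq_le ?_
  rw [discrim] at hd
  linarith

end Polynomial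

lemma gagHalfSq_nonneg (h : ℝ) (φ : ℝ → ℝ) : 0 ≤ gagHalfSq h φ :=
  integral_nonneg fun _ => integral_nonneg fun _ => by positivity

theorem stmt_5 : ∃ C : ℝ, 0 < C ∧ ∀ k : ℕ, 1 ≤ k → ∀ p : Polynomial ℝ, p.natDegree ≤ k →
    ∀ N : ℝ, 0 ≤ N →
    (∀ v : ℝ → ℝ, (∃ L : NNReal, LipschitzOnWith L v (Set.Icc 0 1)) →
      v 0 = 0 → v 1 = 0 →
      (∫ x in Set.Ioo (0:ℝ) 1, p.eval x * v x) ≤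
        N * Real.sqrt (∫ x in Set.Ioo (0:ℝ) 1, deriv v x ^ 2)) →
    ∀ ψ : ℝ → ℝ, Measurable ψ → H1200Finite 1 ψ →
      (∫ x in Set.Ioo (0:ℝ) 1, p.eval x * ψ x) ≤
        C * (k : ℝ) * N * Real.sqrt (H1200NormSq 1 ψ) := by
  refine ⟨3, by norm_num, fun k hk p hp N hN hdual ψ hψ hfin => ?_⟩
  obtain ⟨P, rfl, hdeg, hPN⟩ := Polynomial.exists_derivative_eq_unitIntegral_sq_le hdual
  have hmarkov := Polynomial.unitIntegral_weighted_derivative_sq_le (k + 1) 0 P (by omega)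
  simp only [zero_add, pow_one, pow_zero, one_mul] at hmarkov
  have hk' : (1 : ℝ) ≤ k := by exact_mod_cast hk
  have hconst : ((k + 1 : ℕ) : ℝ) * ((k + 1 : ℕ) + 2 * (0 : ℕ) + 1) ≤ (3 * k) ^ 2 := by
    push_cast
    nlinarith
  refine (Polynomial.setIntegral_eval_mul_le_sqrt_mul_sqrt _ hψ hfin.2.1 hfin.2.2).trans ?_
  refine mul_le_mul (Real.sqrt_le_iff.mpr ⟨by positivity, ?_⟩) (Real.sqrt_le_sqrt ?_)
    (Real.sqrt_nonneg _) (by positivity)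
  · calc _ ≤ _ := hmarkov
      _ ≤ (3 * (k : ℝ)) ^ 2 * N ^ 2 :=
        mul_le_mul hconst hPN (by simpa using Polynomial.unitIntegral_mul_sq_nonneg 0 P)
          (by positivity)
      _ = (3 * (k : ℝ) * N) ^ 2 := by ring
  · rw [H1200NormSq]
    linarith [gagHalfSq_nonneg 1 ψ]
end
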